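/- arXiv:2412.15116 — 4 statements merged into one kernel-verified Lean document; each statement's English description precedes it below -/
import Mathlib

section
/- Let h_i be any one-dimensional marginal of the Charlier ensemble (parameters n ≥ 1, α > 0) or of the Krawtchouk ensemble (parameters K ≥ n ≥ 1, p ∈ (0,1)). Set a(u) := 2·((1+u)·log(1+u) − u)/u² for u ∈ [−1,∞). Then: (i) P(h_i − E[h_i] ≥ t) ≤ exp(−(t²/(2·E[h_i]))·a(t/E[h_i])) for all t ≥ 0; (ii) P(h_i − E[h_i] ≤ −t) ≤ exp(−(t²/(2·E[h_i]))·a(−t/E[h_i])) for all 0 ≤ t ≤ E[h_i]; (iii) Var(h_i) ≤ E[h_i]. -/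
open scoped BigOperators

noncomputable section

/-- Unnormalized Charlier weight. -/
def charlierWeight (n : ℕ) (α : ℝ) (h : Fin n → ℕ) : ℝ :=
  (∏ i : Fin n, ∏ j : Fin n, if i < j then ((h j : ℝ) - (h i : ℝ)) ^ 2 else 1) *
    ∏ j : Fin n, α ^ (h j) / (Nat.factorial (h j) : ℝ)

/-- The pmf of the `i`-th marginal of the Charlier ensemble. -/
def charlierProb (n : ℕ) (α : ℝ) (i : Fin n) (k : ℕ) : ℝ :=
  (∑' h : {h : Fin n → ℕ // StrictMono h ∧ h i = k}, charlierWeight n α h.1) /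
    ∑' h : {h : Fin n → ℕ // StrictMono h}, charlierWeight n α h.1

/-- Unnormalized Krawtchouk weight. -/
def krawtchoukWeight (n K : ℕ) (p : ℝ) (h : Fin n → ℕ) : ℝ :=
  (∏ i : Fin n, ∏ j : Fin n, if i < j then ((h j : ℝ) - (h i : ℝ)) ^ 2 else 1) *
    ∏ j : Fin n, (Nat.choose K (h j) : ℝ) * p ^ (h j) * (1 - p) ^ (K - h j)

/-- The pmf of the `i`-th marginal of the Krawtchouk ensemble. -/
def krawtchoukProb (n K : ℕ) (p : ℝ) (i : Fin n) (k : ℕ) : ℝ :=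
  (∑' h : {h : Fin n → ℕ // StrictMono h ∧ (∀ j, h j ≤ K) ∧ h i = k},
      krawtchoukWeight n K p h.1) /
    ∑' h : {h : Fin n → ℕ // StrictMono h ∧ ∀ j, h j ≤ K}, krawtchoukWeight n K p h.1

/-- The mean of a pmf on ℕ. -/
def pmfMean (p : ℕ → ℝ) : ℝ := ∑' k : ℕ, (k : ℝ) * p k

/-- The variance of a pmf on ℕ. -/
def pmfVar (p : ℕ → ℝ) : ℝ := ∑' k : ℕ, ((k : ℝ) - pmfMean p) ^ 2 * p k

/-- `P(h - E[h] ≥ t)` for a pmf `p` on ℕ. -/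
def upperTail (p : ℕ → ℝ) (t : ℝ) : ℝ :=
  ∑' k : {k : ℕ // pmfMean p + t ≤ (k : ℝ)}, p k.1

/-- `P(h - E[h] ≤ -t)` for a pmf `p` on ℕ. -/
def lowerTail (p : ℕ → ℝ) (t : ℝ) : ℝ :=
  ∑' k : {k : ℕ // (k : ℝ) ≤ pmfMean p - t}, p k.1

/-- The function `a(u) = 2((1+u)log(1+u) - u)/u²`. -/
def aFun (u : ℝ) : ℝ := 2 * ((1 + u) * Real.log (1 + u) - u) / u ^ 2

/-! Part A -/
structure ULC (p : ℕ → ℝ) : Prop where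
  nn : ∀ k, 0 ≤ p k
  sum1 : HasSum p 1
  ulc : ∀ k l : ℕ, k ≤ l → p k * (((l:ℝ)+1) * p (l+1)) ≤ (((k:ℝ)+1) * p (k+1)) * p l

lemma ULC.summ {p : ℕ → ℝ} (h : ULC p) (R : ℝ) (hR : 0 ≤ R) :
    Summable (fun k => p k * R ^ k) := by
  obtain ⟨k0, hk0⟩ : ∃ k, 0 < p k := by
    by_contra! hc
    have : p = 0 := by
      ext k; exact le_antisymm (hc k) (h.nn k)
    have h1 := h.sum1
    rw [this] at h1
    exact zero_ne_one (hasSum_zero.unique h1)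
  apply summable_of_ratio_norm_eventually_le (r := 1/2) (by norm_num)
  set c := ((k0:ℝ)+1) * p (k0+1) / p k0 with hc
  have hc0 : 0 ≤ c := by
    have := h.nn (k0+1); positivity
  obtain ⟨N, hN⟩ := exists_nat_ge (2 * c * R)
  filter_upwards [Filter.eventually_ge_atTop (max k0 N)] with k hk
  have hk1 : k0 ≤ k := le_trans (le_max_left _ _) hk
  have hk2 : (N:ℝ) ≤ k := by exact_mod_cast le_trans (le_max_right _ _) hk
  have hu := h.ulc k0 k hk1
  have h1 : ((k:ℝ)+1) * p (k+1) ≤ c * p k := by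
    rw [hc, div_mul_eq_mul_div, le_div_iff₀ hk0]; linarith
  have hp1 := h.nn (k+1)
  have hp := h.nn k
  have hRk : 0 ≤ R ^ k := by positivity
  rw [Real.norm_of_nonneg (by positivity), Real.norm_of_nonneg (by positivity)]
  have h2 : p (k+1) * R ≤ 1/2 * p k := by
    have h3 : ((k:ℝ)+1) * (p (k+1) * R) ≤ (k+1) * (1/2 * p k) := by
      calc ((k:ℝ)+1) * (p (k+1) * R) = (((k:ℝ)+1) * p (k+1)) * R := by ring
        _ ≤ (c * p k) * R := by gcongr
        _ = (c * R) * p k := by ring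
        _ ≤ (1/2 * (k+1)) * p k := mul_le_mul_of_nonneg_right (by linarith) hp
        _ = _ := by ring
    exact le_of_mul_le_mul_left h3 (by positivity)
  calc p (k+1) * R^(k+1) = (p (k+1) * R) * R^k := by ring
    _ ≤ (1/2 * p k) * R^k := by gcongr
    _ = _ := by ring

lemma ULC.summ_k {p : ℕ → ℝ} (h : ULC p) (R : ℝ) (hR : 0 ≤ R) :
    Summable (fun k : ℕ => (k:ℝ) * (p k * R ^ k)) := by
  refine Summable.of_nonneg_of_le (fun k => ?_) (fun k => ?_) (h.summ (2*R) (by positivity))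
  · have := h.nn k; positivity
  · have := h.nn k
    have hk : (k:ℝ) ≤ 2^k := by exact_mod_cast Nat.lt_two_pow_self.le
    calc (k:ℝ) * (p k * R ^ k) ≤ 2^k * (p k * R^k) := by gcongr
      _ = _ := by rw [mul_pow]; ring

lemma ULC.summ_b {p : ℕ → ℝ} (h : ULC p) (R : ℝ) (hR : 0 ≤ R) :
    Summable (fun k : ℕ => (((k:ℝ)+1) * p (k+1)) * R ^ k) := by
  have h1 := (summable_nat_add_iff 1).2 (h.summ_k (R+1) (by positivity))
  refine Summable.of_nonneg_of_le (fun k => ?_) (fun k => ?_) h1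
  · have := h.nn (k+1); positivity
  · have := h.nn (k+1)
    push_cast
    have h2 : R^k ≤ (R+1)^(k+1) := by
      calc R^k ≤ (R+1)^k := by gcongr; linarith
        _ ≤ (R+1)^(k+1) := pow_le_pow_right₀ (by linarith) (by omega)
    calc (((k:ℝ)+1) * p (k+1)) * R ^ k ≤ (((k:ℝ)+1) * p (k+1)) * (R+1)^(k+1) := by gcongr
      _ = _ := by ring

lemma ULC.hasSum_mean {p : ℕ → ℝ} (h : ULC p) : HasSum (fun k : ℕ => (k:ℝ) * p k) (pmfMean p) := by
  have := h.summ_k 1 zero_le_one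
  simp only [one_pow, mul_one] at this
  exact this.hasSum

lemma ULC.hasSum_b {p : ℕ → ℝ} (h : ULC p) :
    HasSum (fun k : ℕ => ((k:ℝ)+1) * p (k+1)) (pmfMean p) := by
  have := (hasSum_nat_add_iff' 1).2 h.hasSum_mean
  simpa using this

lemma ULC.cheb {p : ℕ → ℝ} (h : ULC p) {g : ℕ → ℝ} (hg : Monotone g) {A B : ℝ}
    (hA : HasSum (fun k : ℕ => g k * (((k:ℝ)+1) * p (k+1))) A)
    (hB : HasSum (fun k : ℕ => g k * p k) B) : A ≤ pmfMean p * B := by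
  set μ := pmfMean p
  set b : ℕ → ℝ := fun k => ((k:ℝ)+1) * p (k+1) with hb
  have key : ∀ k l, (g k - g l) * (b k * p l - p k * b l) ≤ 0 := by
    intro k l
    rcases le_total k l with hkl | hkl
    · have := h.ulc k l hkl
      exact mul_nonpos_of_nonpos_of_nonneg (sub_nonpos.2 (hg hkl)) (by simp only [hb]; linarith)
    · have := h.ulc l k hkl
      exact mul_nonpos_of_nonneg_of_nonpos (sub_nonneg.2 (hg hkl)) (by simp only [hb]; linarith)
  have hbs : HasSum b μ := h.hasSum_b
  have h1 : ∀ l, A * p l - B * b l - μ * (g l * p l) + 1 * (g l * b l) ≤ 0 := by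
    intro l
    have := (((hA.mul_right (p l)).sub (hB.mul_right (b l))).sub
      (hbs.mul_right (g l * p l))).add (h.sum1.mul_right (g l * b l))
    refine hasSum_le (fun k => ?_) this hasSum_zero
    have := key k l
    simp only [hb] at this ⊢
    linarith
  have h2 := (((h.sum1.mul_left A).sub (hbs.mul_left B)).sub (hB.mul_left μ)).add (hA.mul_left 1)
  have := hasSum_le (fun l => by simpa using h1 l) h2 hasSum_zero
  linarith

lemma ULC.var {p : ℕ → ℝ} (h : ULC p) : pmfVar p ≤ pmfMean p := by
  set μ := pmfMean p
  have hs : Summable (fun k : ℕ => (k:ℝ) * ((k:ℝ) * p k)) := by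
    refine Summable.of_nonneg_of_le (fun k => ?_) (fun k => ?_) (h.summ_k 2 (by positivity))
    · have := h.nn k; positivity
    · have := h.nn k
      have hk : (k:ℝ) ≤ 2^k := by exact_mod_cast Nat.lt_two_pow_self.le
      rw [mul_comm (p k)]
      gcongr
  obtain ⟨C, hC⟩ := hs
  have h3 := (hasSum_nat_add_iff' 1).2 (hC.sub h.hasSum_mean)
  have h4 := h.cheb (g := fun k => (k:ℝ)) Nat.mono_cast
    (A := C - μ) (by
      convert! h3 using 1
      · ext k; push_cast; ring
      · simp [μ]) h.hasSum_mean
  have h5 : HasSum (fun k : ℕ => ((k:ℝ) - μ)^2 * p k) (C - 2 * μ * μ + μ^2 * 1) := by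
    convert! (hC.sub (h.hasSum_mean.mul_left (2*μ))).add (h.sum1.mul_left (μ^2)) using 1
    ext k; ring
  have : pmfVar p = C - 2 * μ * μ + μ^2 * 1 := h5.tsum_eq
  rw [this]
  nlinarith

lemma ULC.deriv {p : ℕ → ℝ} (h : ULC p) (z : ℝ) :
    HasDerivAt (fun z => ∑' k, p k * z ^ k) (∑' k : ℕ, (((k:ℝ)+1) * p (k+1)) * z ^ k) z := by
  set R := |z| + 1
  have hR : 0 ≤ R := by positivity
  have h1 : Summable (fun k : ℕ => p k * ((k:ℝ) * R^(k-1))) := by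
    rw [← summable_nat_add_iff 1]
    refine (h.summ_b R hR).congr (fun k => ?_)
    simp only [Nat.add_sub_cancel]; push_cast; ring
  have h2 := hasDerivAt_tsum_of_isPreconnected (g := fun k z => p k * z ^ k)
    (g' := fun k z => p k * ((k:ℝ) * z^(k-1))) (y := z) (y₀ := z)
    (t := Metric.ball 0 R) h1 Metric.isOpen_ball (convex_ball 0 R).isPreconnected
    (fun k y _ => (hasDerivAt_pow k y).const_mul (p k))
    (fun k y hy => by
      have := h.nn k
      have hy' : |y| ≤ R := by simpa using (mem_ball_zero_iff.1 hy).le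
      rw [norm_mul, norm_mul, norm_pow, Real.norm_of_nonneg this, Real.norm_of_nonneg (by positivity : (0:ℝ) ≤ k)]
      rw [Real.norm_eq_abs]
      gcongr)
    (by simp [R])
    (by
      refine Summable.of_norm ?_
      refine (h.summ |z| (abs_nonneg z)).congr (fun k => ?_)
      rw [norm_mul, norm_pow, Real.norm_of_nonneg (h.nn k), Real.norm_eq_abs])
    (by simp [R])
  convert! h2 using 1
  have h3 : Summable (fun k : ℕ => p k * ((k:ℝ) * z^(k-1))) := by
    refine Summable.of_norm_bounded h1 (fun k => ?_)
    have := h.nn k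
    rw [norm_mul, norm_mul, norm_pow, Real.norm_of_nonneg this, Real.norm_of_nonneg (by positivity : (0:ℝ) ≤ k)]
    rw [Real.norm_eq_abs]
    have : |z| ≤ R := by simp [R]
    gcongr
  rw [h3.tsum_eq_zero_add]
  simp
  apply tsum_congr; intro k; ring

lemma ULC.mgf {p : ℕ → ℝ} (h : ULC p) (z : ℝ) (hz : 0 ≤ z) :
    ∑' k, p k * z ^ k ≤ Real.exp (pmfMean p * (z - 1)) := by
  set μ := pmfMean p
  set G : ℝ → ℝ := fun z => ∑' k, p k * z ^ k with hG
  set D : ℝ → ℝ := fun z => ∑' k : ℕ, (((k:ℝ)+1) * p (k+1)) * z ^ k with hD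
  have hd : ∀ z, HasDerivAt (fun z => G z * Real.exp (-μ * z))
      ((D z - μ * G z) * Real.exp (-μ * z)) z := by
    intro z
    have := (h.deriv z).mul ((((hasDerivAt_id z).const_mul (-μ))).exp)
    convert! this using 1
    simp only [hD, hG, id, mul_one]; ring
  have hG1 : G 1 = 1 := by simp [hG, h.sum1.tsum_eq]
  have hdiff : Differentiable ℝ (fun z => G z * Real.exp (-μ * z)) := fun z => (hd z).differentiableAt
  suffices hs : G z * Real.exp (-μ * z) ≤ G 1 * Real.exp (-μ * 1) by
    have h5 : G z = (G z * Real.exp (-μ * z)) * Real.exp (μ * z) := by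
      rw [mul_assoc, ← Real.exp_add]; simp
    change G z ≤ _
    rw [h5]
    calc _ ≤ (G 1 * Real.exp (-μ * 1)) * Real.exp (μ * z) := by gcongr
      _ = _ := by rw [hG1, one_mul, ← Real.exp_add]; congr 1; ring
  have hB : ∀ z, 0 ≤ z → HasSum (fun k => z ^ k * p k) (G z) := by
    intro z hz
    simp_rw [mul_comm _ (p _)]
    exact (h.summ z hz).hasSum
  have hA : ∀ z, 0 ≤ z → HasSum (fun k : ℕ => z ^ k * (((k:ℝ)+1) * p (k+1))) (D z) := by
    intro z hz
    simp_rw [mul_comm (z ^ _)]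
    exact (h.summ_b z hz).hasSum
  rcases le_total 1 z with h1 | h1
  · refine antitoneOn_of_deriv_nonpos (convex_Ici 1) hdiff.continuous.continuousOn
      hdiff.differentiableOn (fun x hx => ?_) (Set.mem_Ici.2 le_rfl) (Set.mem_Ici.2 h1) h1
    rw [interior_Ici] at hx
    have hx1 : (1:ℝ) ≤ x := (Set.mem_Ioi.1 hx).le
    rw [(hd x).deriv]
    have := h.cheb (g := fun k => x ^ k) (pow_right_mono₀ hx1) (hA x (by linarith)) (hB x (by linarith))
    exact mul_nonpos_of_nonpos_of_nonneg (by linarith) (Real.exp_pos _).le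
  · refine monotoneOn_of_deriv_nonneg (convex_Icc 0 1) hdiff.continuous.continuousOn
      hdiff.differentiableOn (fun x hx => ?_) ⟨hz, h1⟩ ⟨zero_le_one, le_rfl⟩ h1
    rw [interior_Icc] at hx
    rw [(hd x).deriv]
    have hx0 := hx.1.le
    have := h.cheb (g := fun k => -x ^ k) (fun a b hab => by
        simpa using pow_le_pow_of_le_one hx0 hx.2.le hab) (A := - D x) (B := - G x)
        (by simpa using (hA x hx0).neg) (by simpa using (hB x hx0).neg)
    exact mul_nonneg (by linarith) (Real.exp_pos _).le

lemma ULC.tail {p : ℕ → ℝ} (h : ULC p) (z : ℝ) (hz : 0 ≤ z) (P : ℕ → Prop)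
    (hP : ∀ k, P k → z ^ (pmfMean p * z) ≤ z ^ k) :
    ∑' k : {k : ℕ // P k}, p k.1 ≤
      Real.exp (-(pmfMean p * (z * Real.log z - (z - 1)))) := by
  set μ := pmfMean p
  have e1 : z ^ (μ * z) = Real.exp (μ * z * Real.log z) := by
    rcases hz.eq_or_lt with h0 | h0
    · simp [← h0]
    · rw [Real.rpow_def_of_pos h0]; congr 1; ring
  have h1 : (∑' k : {k : ℕ // P k}, p k.1) * z ^ (μ * z) ≤ ∑' k, p k * z ^ k := by
    rw [← tsum_mul_right]
    have hs : Summable (fun k : {k : ℕ // P k} => p k.1 * z ^ k.1) :=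
      (h.summ z hz).subtype {k | P k}
    have hs2 : Summable (fun k : {k : ℕ // P k} => p k.1 * z ^ (μ * z)) :=
      (h.sum1.summable.subtype {k | P k}).mul_right _
    refine (hs2.tsum_le_tsum (fun k => ?_) hs).trans ?_
    · have := h.nn k.1
      have := hP k.1 k.2
      gcongr
    · exact (h.summ z hz).tsum_subtype_le _ {k | P k} (fun k => by have := h.nn k; positivity)
  have h2 := h1.trans (h.mgf z hz)
  rw [e1] at h2
  rw [← le_div_iff₀ (Real.exp_pos _), ← Real.exp_sub] at h2
  refine h2.trans (le_of_eq ?_)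
  congr 1; ring

lemma ULC.tail_le_one {p : ℕ → ℝ} (h : ULC p) (P : ℕ → Prop) :
    ∑' k : {k : ℕ // P k}, p k.1 ≤ 1 := by
  have := h.sum1.summable.tsum_subtype_le _ {k | P k} h.nn
  rwa [h.sum1.tsum_eq] at this

lemma expo_eq (μ t : ℝ) (hμ : 0 < μ) (u : ℝ) (hu : u = t / μ ∨ u = -(t / μ)) :
    -(t ^ 2 / (2 * μ)) * aFun u = -(μ * ((1 + u) * Real.log (1 + u) - u)) := by
  by_cases h0 : t = 0
  · rcases hu with rfl | rfl <;> simp [h0]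
  · unfold aFun
    have : u ^ 2 = t^2/μ^2 := by rcases hu with rfl | rfl <;> ring
    rw [this]; field_simp

theorem ULC.conc {p : ℕ → ℝ} (h : ULC p) :
    (∀ t : ℝ, 0 ≤ t →
      upperTail p t ≤ Real.exp (-(t ^ 2 / (2 * pmfMean p)) * aFun (t / pmfMean p))) ∧
    (∀ t : ℝ, 0 ≤ t → t ≤ pmfMean p →
      lowerTail p t ≤ Real.exp (-(t ^ 2 / (2 * pmfMean p)) * aFun (-(t / pmfMean p)))) ∧
    pmfVar p ≤ pmfMean p := by
  have hm : 0 ≤ pmfMean p := tsum_nonneg (fun k => mul_nonneg (Nat.cast_nonneg k) (h.nn k))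
  refine ⟨fun t ht => ?_, fun t ht htm => ?_, h.var⟩
  · rcases hm.eq_or_lt with h0 | h0
    · rw [show ∀ x y : ℝ, -(x / (2 * pmfMean p)) * y = 0 by simp [← h0], Real.exp_zero]; exact h.tail_le_one _
    · rw [expo_eq _ t h0 _ (Or.inl rfl)]
      have hq : 0 ≤ t / pmfMean p := by positivity
      have := h.tail (1 + t / pmfMean p) (by positivity) (fun k => pmfMean p + t ≤ (k:ℝ)) (fun k hk => by
        rw [← Real.rpow_natCast]
        apply Real.rpow_le_rpow_of_exponent_le (by linarith)
        rw [mul_add, mul_div_cancel₀ _ h0.ne']; linarith)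
      rw [add_sub_cancel_left] at this
      exact this
  · rcases hm.eq_or_lt with h0 | h0
    · rw [show ∀ x y : ℝ, -(x / (2 * pmfMean p)) * y = 0 by simp [← h0], Real.exp_zero]; exact h.tail_le_one _
    · rw [expo_eq _ t h0 _ (Or.inr rfl)]
      have hq : 0 ≤ t / pmfMean p := by positivity
      have hq1 : t / pmfMean p ≤ 1 := by rwa [div_le_one h0]
      have := h.tail (1 + -(t / pmfMean p)) (by linarith) (fun k => (k:ℝ) ≤ pmfMean p - t) (fun k hk => by
        have e : pmfMean p * (1 + -(t / pmfMean p)) = pmfMean p - t := by field_simp; ring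
        rw [e, ← Real.rpow_natCast]
        rcases (show 0 ≤ 1 + -(t / pmfMean p) by linarith).eq_or_lt with h1 | h1
        · rw [← h1, mul_zero] at e
          have hk0 : (k:ℝ) = 0 := le_antisymm (by linarith) (Nat.cast_nonneg k)
          rw [hk0, ← e]
        · exact Real.rpow_le_rpow_of_exponent_ge h1 (by linarith) hk)
      rw [add_sub_cancel_left] at this
      exact this

/-! Part B -/
lemma four_tsum {L : Type*} [DistribLattice L] (f₁ f₂ f₃ f₄ : L → ℝ)
    (h₁ : 0 ≤ f₁) (h₂ : 0 ≤ f₂) (h₃ : 0 ≤ f₃) (h₄ : 0 ≤ f₄)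
    (s₁ : Summable f₁) (s₂ : Summable f₂) (s₃ : Summable f₃) (s₄ : Summable f₄)
    (h : ∀ a b, f₁ a * f₂ b ≤ f₃ (a ⊓ b) * f₄ (a ⊔ b)) :
    (∑' a, f₁ a) * ∑' a, f₂ a ≤ (∑' a, f₃ a) * ∑' a, f₄ a := by
  classical
  have h1 := s₁.hasSum.mul s₂.hasSum
  have ht : Filter.Tendsto (fun s : Finset L => (∑ a ∈ s, f₁ a) * ∑ a ∈ s, f₂ a) Filter.atTop
      (nhds ((∑' a, f₁ a) * ∑' a, f₂ a)) := Filter.Tendsto.mul s₁.hasSum s₂.hasSum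
  refine le_of_tendsto' ht (fun s => ?_)
  refine (four_functions_theorem f₁ f₂ f₃ f₄ h₁ h₂ h₃ h₄ h s s).trans ?_
  exact mul_le_mul (s₃.sum_le_tsum _ (fun a _ => h₃ a)) (s₄.sum_le_tsum _ (fun a _ => h₄ a))
    (Finset.sum_nonneg (fun a _ => h₄ a)) (tsum_nonneg h₃)

def VV (n : ℕ) (h : Fin n → ℤ) : ℝ :=
  ∏ i : Fin n, ∏ j : Fin n, if i < j then ((h j : ℝ) - (h i : ℝ)) ^ 2 else 1

lemma VV_nonneg (n : ℕ) (h : Fin n → ℤ) : 0 ≤ VV n h :=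
  Finset.prod_nonneg fun i _ => Finset.prod_nonneg fun j _ => by split_ifs <;> positivity

open Classical in
def FF (n : ℕ) (w : Fin n → ℤ → ℝ) (h : Fin n → ℤ) : ℝ :=
  if StrictMono h then VV n h * ∏ j, w j (h j) else 0

lemma FF_nonneg (n : ℕ) (w : Fin n → ℤ → ℝ) (h0 : ∀ j x, 0 ≤ w j x) (h : Fin n → ℤ) :
    0 ≤ FF n w h := by
  unfold FF; split_ifs
  · exact mul_nonneg (VV_nonneg n h) (Finset.prod_nonneg fun j _ => h0 j _)
  · exact le_rfl

lemma pair_ineq (ua ub va vb : ℤ) (_h1 : ua < ub) (_h2 : va < vb) :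
    ((ub + 1) - (ua + 1)) * (vb - va) ≤
      ((min ub vb + 1) - (min ua va + 1)) * (max ub vb - max ua va) := by
  rcases le_total ua va with ha | ha <;> rcases le_total ub vb with hb | hb <;>
    simp only [ha, hb, min_eq_left, min_eq_right, max_eq_left, max_eq_right] <;> nlinarith

lemma FF_ineq (n : ℕ) (w : Fin n → ℤ → ℝ) (h0 : ∀ j x, 0 ≤ w j x)
    (hw : ∀ j x y, y < x → w j x * w j y ≤ w j (x-1) * w j (y+1)) (u v : Fin n → ℤ) :
    FF n w (u + 1) * FF n w v ≤ FF n w (u ⊓ v + 1) * FF n w (u ⊔ v) := by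
  by_cases hu : StrictMono (u + 1)
  swap
  · rw [FF, if_neg hu, zero_mul]
    exact mul_nonneg (FF_nonneg n w h0 _) (FF_nonneg n w h0 _)
  by_cases hv : StrictMono v
  swap
  · rw [show FF n w v = 0 from if_neg hv, mul_zero]
    exact mul_nonneg (FF_nonneg n w h0 _) (FF_nonneg n w h0 _)
  have hu' : StrictMono u := fun a b hab => by simpa using hu hab
  have hi : StrictMono (u ⊓ v + 1) := fun a b hab => by
    have := hu' hab
    have := hv hab
    simp only [Pi.add_apply, Pi.inf_apply, Pi.one_apply]
    omega
  have hs : StrictMono (u ⊔ v) := fun a b hab => by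
    have := hu' hab
    have := hv hab
    simp only [Pi.sup_apply]
    omega
  rw [FF, FF, FF, FF, if_pos hu, if_pos hv, if_pos hi, if_pos hs]
  rw [mul_mul_mul_comm, mul_mul_mul_comm (VV n (u ⊓ v + 1))]
  have hV : VV n (u+1) * VV n v ≤ VV n (u ⊓ v + 1) * VV n (u ⊔ v) := by
    unfold VV
    simp only [← Finset.prod_mul_distrib]
    refine Finset.prod_le_prod (fun i _ => Finset.prod_nonneg fun j _ => ?_) (fun i _ => ?_)
    · split_ifs <;> positivity
    refine Finset.prod_le_prod (fun j _ => ?_) (fun j _ => ?_)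
    · split_ifs <;> positivity
    split_ifs with hij
    · rw [← mul_pow, ← mul_pow]
      have h1 := hu' hij
      have h2 := hv hij
      have h3 := pair_ineq _ _ _ _ h1 h2
      have h4 : (0:ℤ) ≤ ((u j + 1) - (u i + 1)) * (v j - v i) :=
        mul_nonneg (by omega) (by omega)
      have h5 := pow_le_pow_left₀ h4 h3 2
      exact_mod_cast h5
    · exact le_rfl
  have hW : (∏ j, w j ((u+1) j)) * ∏ j, w j (v j) ≤
      (∏ j, w j ((u ⊓ v + 1) j)) * ∏ j, w j ((u ⊔ v) j) := by
    simp only [← Finset.prod_mul_distrib]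
    refine Finset.prod_le_prod (fun j _ => mul_nonneg (h0 _ _) (h0 _ _)) (fun j _ => ?_)
    simp only [Pi.add_apply, Pi.inf_apply, Pi.one_apply, Pi.sup_apply]
    rcases le_or_gt (v j) (u j) with h | h
    · have := hw j (u j + 1) (v j) (by omega)
      rw [inf_eq_right.2 h, sup_eq_left.2 h]
      simp only [add_sub_cancel_right] at this
      linarith
    · rw [inf_eq_left.2 h.le, sup_eq_right.2 h.le]
  exact mul_le_mul hV hW (mul_nonneg (Finset.prod_nonneg fun j _ => h0 _ _)
    (Finset.prod_nonneg fun j _ => h0 _ _)) (mul_nonneg (VV_nonneg _ _) (VV_nonneg _ _))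

/-- general weight -/
def gW (n : ℕ) (w : ℕ → ℝ) (h : Fin n → ℕ) : ℝ :=
  (∏ i : Fin n, ∏ j : Fin n, if i < j then ((h j : ℝ) - (h i : ℝ)) ^ 2 else 1) *
    ∏ j : Fin n, w (h j)

lemma gW_nonneg (n : ℕ) (w : ℕ → ℝ) (h0 : ∀ k, 0 ≤ w k) (h : Fin n → ℕ) : 0 ≤ gW n w h :=
  mul_nonneg (Finset.prod_nonneg fun i _ => Finset.prod_nonneg fun j _ => by
    split_ifs <;> positivity) (Finset.prod_nonneg fun j _ => h0 _)

lemma gW_le (n : ℕ) (w : ℕ → ℝ) (h0 : ∀ k, 0 ≤ w k) (h : Fin n → ℕ) :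
    gW n w h ≤ ∏ j, (w (h j) * ((h j : ℝ) + 1) ^ (4 * n)) := by
  unfold gW
  rw [Finset.prod_mul_distrib, mul_comm]
  refine mul_le_mul_of_nonneg_left ?_ (Finset.prod_nonneg fun j _ => h0 _)
  calc _ ≤ ∏ i : Fin n, ∏ j : Fin n, (((h i : ℝ) + 1)^2 * ((h j : ℝ) + 1)^2) := by
        refine Finset.prod_le_prod (fun i _ => Finset.prod_nonneg fun j _ => ?_) (fun i _ => ?_)
        · split_ifs <;> positivity
        refine Finset.prod_le_prod (fun j _ => ?_) (fun j _ => ?_)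
        · split_ifs <;> positivity
        have a0 : (0:ℝ) ≤ h i := Nat.cast_nonneg _
        have b0 : (0:ℝ) ≤ h j := Nat.cast_nonneg _
        have ab := mul_nonneg a0 b0
        rw [← mul_pow]
        split_ifs
        · apply sq_le_sq'
          · nlinarith
          · nlinarith
        · apply one_le_pow₀; nlinarith
    _ = _ := by
        simp only [Finset.prod_mul_distrib, Finset.prod_const, Finset.card_univ, Fintype.card_fin, ← Finset.prod_pow]
        rw [← Finset.prod_mul_distrib]
        refine Finset.prod_congr rfl fun j _ => ?_
        rw [← pow_mul, ← pow_add]; congr 1; ring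

lemma summable_pi (n : ℕ) (f : ℕ → ℝ) (h0 : ∀ k, 0 ≤ f k) (hf : Summable f) :
    Summable (fun h : Fin n → ℕ => ∏ j, f (h j)) := by
  classical
  refine summable_of_sum_le (c := ∏ j : Fin n, ∑' k, f k)
    (fun h => Finset.prod_nonneg fun j _ => h0 _) (fun s => ?_)
  calc _ ≤ ∑ h ∈ Fintype.piFinset (fun j => s.image (fun h => h j)), ∏ j, f (h j) := by
        refine Finset.sum_le_sum_of_subset_of_nonneg (fun h hh => ?_)
          (fun h _ _ => Finset.prod_nonneg fun j _ => h0 _)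
        rw [Fintype.mem_piFinset]
        exact fun j => Finset.mem_image_of_mem (fun h => h j) hh
    _ = ∏ j, ∑ k ∈ s.image (fun h => h j), f k := (Finset.prod_univ_sum _ _).symm
    _ ≤ _ := Finset.prod_le_prod (fun j _ => Finset.sum_nonneg fun k _ => h0 k)
        (fun j _ => hf.sum_le_tsum _ (fun k _ => h0 k))

lemma summable_gW (n : ℕ) (w : ℕ → ℝ) (h0 : ∀ k, 0 ≤ w k)
    (hs : Summable (fun k : ℕ => w k * ((k:ℝ)+1)^(4*n))) : Summable (gW n w) :=
  Summable.of_nonneg_of_le (gW_nonneg n w h0) (gW_le n w h0)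
    (summable_pi n (fun k : ℕ => w k * ((k:ℝ)+1)^(4*n)) (fun k => mul_nonneg (h0 k) (by positivity)) hs)

def ee (w : ℕ → ℝ) (x : ℤ) : ℝ := if 0 ≤ x then w x.toNat else 0

lemma ee_nonneg {w : ℕ → ℝ} (h0 : ∀ k, 0 ≤ w k) (x : ℤ) : 0 ≤ ee w x := by
  unfold ee; split_ifs; exacts [h0 _, le_rfl]

lemma ee_lc {w : ℕ → ℝ} (h0 : ∀ k, 0 ≤ w k)
    (hw : ∀ k l : ℕ, k ≤ l → w k * w (l+1) ≤ w (k+1) * w l) (x y : ℤ) (hxy : y < x) :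
    ee w x * ee w y ≤ ee w (x-1) * ee w (y+1) := by
  by_cases hy : 0 ≤ y
  · obtain ⟨k, rfl⟩ := Int.eq_ofNat_of_zero_le hy
    obtain ⟨l, hl⟩ := Int.eq_ofNat_of_zero_le (show 0 ≤ x - 1 by omega)
    obtain rfl : x = ((l + 1 : ℕ) : ℤ) := by push_cast; omega
    have := hw k l (by omega)
    have e1 : ((l + 1 : ℕ) : ℤ) - 1 = (l : ℤ) := by push_cast; ring
    have e2 : (k : ℤ) + 1 = ((k + 1 : ℕ) : ℤ) := by push_cast; ring
    rw [e1, e2]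
    unfold ee
    rw [if_pos (by positivity), if_pos (by positivity), if_pos (by positivity), if_pos (by positivity)]
    simp only [Int.toNat_natCast]
    linarith
  · rw [ee.eq_def w y, if_neg hy, mul_zero]
    exact mul_nonneg (ee_nonneg h0 _) (ee_nonneg h0 _)

def wj {n : ℕ} (i : Fin n) (w : ℕ → ℝ) (j : Fin n) : ℤ → ℝ :=
  ee (fun k => (if j = i then (Nat.factorial k : ℝ) else 1) * w k)

open Classical in
def QQ {n : ℕ} (i : Fin n) (w : ℕ → ℝ) (k : ℤ) (h : Fin n → ℤ) : ℝ :=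
  if h i = k then FF n (wj i w) h else 0

def SS {n : ℕ} (i : Fin n) (w : ℕ → ℝ) (k : ℕ) : ℝ :=
  ∑' h : {h : Fin n → ℕ // StrictMono h ∧ h i = k}, gW n w h.1

section
variable {n : ℕ} (i : Fin n) (w : ℕ → ℝ)

def emb (k : ℕ) (h : {h : Fin n → ℕ // StrictMono h ∧ h i = k}) : Fin n → ℤ := fun j => (h.1 j : ℤ)

lemma emb_inj (k : ℕ) : Function.Injective (emb i k) := by
  intro a b hab
  ext j
  have := congrFun hab j
  simpa [emb] using this

lemma QQ_emb (k : ℕ) (h : {h : Fin n → ℕ // StrictMono h ∧ h i = k}) :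
    QQ i w k (emb i k h) = (Nat.factorial k : ℝ) * gW n w h.1 := by
  obtain ⟨h, hm, hk⟩ := h
  have hm' : StrictMono (fun j => (h j : ℤ)) := fun a b hab => by
    have := hm hab
    simp only; omega
  have e1 : emb i k ⟨h, hm, hk⟩ = fun j => (h j : ℤ) := rfl
  rw [e1, QQ, if_pos (by simp [hk]), FF, if_pos hm']
  simp only [VV, gW, wj, ee, Int.cast_natCast, Int.toNat_natCast, Nat.cast_nonneg, if_true]
  rw [Finset.prod_mul_distrib, Finset.prod_ite_eq' ]
  simp only [Finset.mem_univ, if_true, hk]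
  ring

lemma QQ_zero (k : ℕ) (h : Fin n → ℤ) (hh : h ∉ Set.range (emb i k)) : QQ i w k h = 0 := by
  by_contra hne
  apply hh
  unfold QQ at hne
  split_ifs at hne with h1
  · unfold FF at hne
    split_ifs at hne with h2
    · have h3 : ∀ j, 0 ≤ h j := by
        intro j
        by_contra hj
        apply hne
        have hz : wj i w j (h j) = 0 := by simp [wj, ee, hj]
        have : ∏ j, wj i w j (h j) = 0 := Finset.prod_eq_zero (Finset.mem_univ j) hz
        rw [this, mul_zero]
      refine ⟨⟨fun j => (h j).toNat, fun a b hab => ?_, ?_⟩, ?_⟩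
      · have := h2 hab
        have := h3 a
        have := h3 b
        simp only; omega
      · simp [h1]
      · ext j
        simp [emb, h3 j]
    · exact absurd rfl hne
  · exact absurd rfl hne

variable {w}

lemma QQ_summable (hs : Summable (gW n w)) (k : ℕ) : Summable (QQ i w k) := by
  rw [← (emb_inj i k).summable_iff (fun x hx => QQ_zero i w k x hx)]
  have : Summable (fun h : {h : Fin n → ℕ // StrictMono h ∧ h i = k} => (Nat.factorial k : ℝ) * gW n w h.1) :=
    (hs.subtype {h : Fin n → ℕ | StrictMono h ∧ h i = k}).mul_left _
  exact this.congr (fun h => (QQ_emb i w k h).symm)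

lemma QQ_tsum (k : ℕ) : ∑' h, QQ i w k h = (Nat.factorial k : ℝ) * SS i w k := by
  rw [← (emb_inj i k).tsum_eq (f := QQ i w k) (fun x hx => by
    by_contra hc; exact hx (QQ_zero i w k x hc))]
  rw [SS, ← tsum_mul_left]
  exact tsum_congr (fun h => QQ_emb i w k h)

lemma wj_nonneg (h0 : ∀ k, 0 ≤ w k) : ∀ j x, 0 ≤ wj i w j x := fun j x => ee_nonneg (fun k => by
    have := h0 k
    split_ifs <;> positivity) x

lemma wj_lc (h0 : ∀ k, 0 ≤ w k)
    (hw : ∀ k l : ℕ, k ≤ l → w k * (((l:ℝ)+1) * w (l+1)) ≤ (((k:ℝ)+1) * w (k+1)) * w l) :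
∀ j x y, y < x → wj i w j x * wj i w j y ≤ wj i w j (x-1) * wj i w j (y+1):= by
    intro j
    apply ee_lc
    · intro k
      have := h0 k
      split_ifs <;> positivity
    · intro k l hkl
      have h1 := hw k l hkl
      split_ifs
      · rw [Nat.factorial_succ, Nat.factorial_succ]
        push_cast
        have : (0:ℝ) ≤ (Nat.factorial k : ℝ) * (Nat.factorial l : ℝ) := by positivity
        have := mul_le_mul_of_nonneg_left h1 this
        linarith
      · simp only [one_mul]
        have hkl' : (k:ℝ) ≤ l := by exact_mod_cast hkl
        have h2 : 0 ≤ w (k+1) * w l := mul_nonneg (h0 _) (h0 _)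
        have h3 : ((l:ℝ)+1) * (w k * w (l+1)) ≤ (l+1) * (w (k+1) * w l) := by
          calc _ ≤ (((k:ℝ)+1) * w (k+1)) * w l := by linarith
            _ = (k+1) * (w (k+1) * w l) := by ring
            _ ≤ _ := by gcongr
        exact le_of_mul_le_mul_left h3 (by positivity)

lemma QQ_nonneg (h0 : ∀ k, 0 ≤ w k) (k : ℤ) (h : Fin n → ℤ) : 0 ≤ QQ i w k h := by
  unfold QQ; split_ifs
  · exact FF_nonneg _ _ (wj_nonneg i h0) _
  · exact le_rfl

lemma QQ_ineq (h0 : ∀ k, 0 ≤ w k)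
    (hw : ∀ k l : ℕ, k ≤ l → w k * (((l:ℝ)+1) * w (l+1)) ≤ (((k:ℝ)+1) * w (k+1)) * w l)
    (k l : ℤ) (hkl : k ≤ l) (u v : Fin n → ℤ) :
    QQ i w (l+1) (u+1) * QQ i w k v ≤ QQ i w (k+1) (u ⊓ v + 1) * QQ i w l (u ⊔ v) := by
  by_cases h1 : u i = l
  swap
  · have : QQ i w (l+1) (u + 1) = 0 := by
      unfold QQ; rw [if_neg]; simpa using h1
    rw [this, zero_mul]
    exact mul_nonneg (QQ_nonneg i h0 _ _) (QQ_nonneg i h0 _ _)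
  by_cases h2 : v i = k
  swap
  · have : QQ i w k v = 0 := by
      unfold QQ; rw [if_neg h2]
    rw [this, mul_zero]
    exact mul_nonneg (QQ_nonneg i h0 _ _) (QQ_nonneg i h0 _ _)
  have e1 : (u + 1) i = l + 1 := by simp [h1]
  have e2 : (u ⊓ v + 1) i = k + 1 := by simp [h1, h2, hkl]
  have e3 : (u ⊔ v) i = l := by simp [h1, h2, hkl]
  have := FF_ineq n (wj i w) (wj_nonneg i h0) (wj_lc i h0 hw) u v
  simp only [QQ]
  rw [if_pos e1, if_pos h2, if_pos e2, if_pos e3]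
  exact this

lemma QQ_shift_summable (hs : Summable (gW n w)) (k : ℕ) :
    Summable (fun u : Fin n → ℤ => QQ i w ((k:ℤ)+1) (u + 1)) := by
  have h := QQ_summable i hs (k+1)
  push_cast at h
  have hinj : Function.Injective (fun u : Fin n → ℤ => u + 1) := add_left_injective 1
  have h2 := h.comp_injective hinj
  simp only [Function.comp_def] at h2
  exact h2

lemma QQ_shift_tsum (k : ℕ) : ∑' u : Fin n → ℤ, QQ i w ((k:ℤ)+1) (u + 1) =
    (Nat.factorial (k+1) : ℝ) * SS i w (k+1) := by
  rw [← QQ_tsum]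
  push_cast
  exact (Equiv.addRight (1 : Fin n → ℤ)).tsum_eq (QQ i w ((k:ℤ)+1))

lemma SS_ineq (h0 : ∀ k, 0 ≤ w k)
    (hw : ∀ k l : ℕ, k ≤ l → w k * (((l:ℝ)+1) * w (l+1)) ≤ (((k:ℝ)+1) * w (k+1)) * w l)
    (hs : Summable (gW n w)) (k l : ℕ) (hkl : k ≤ l) :
    SS i w k * (((l:ℝ)+1) * SS i w (l+1)) ≤ (((k:ℝ)+1) * SS i w (k+1)) * SS i w l := by
  have hkl' : (k:ℤ) ≤ l := by exact_mod_cast hkl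
  have main := four_tsum (fun u : Fin n → ℤ => QQ i w ((l:ℤ)+1) (u + 1)) (QQ i w k)
    (fun u : Fin n → ℤ => QQ i w ((k:ℤ)+1) (u + 1)) (QQ i w l)
    (fun _ => QQ_nonneg i h0 _ _) (fun _ => QQ_nonneg i h0 _ _)
    (fun _ => QQ_nonneg i h0 _ _) (fun _ => QQ_nonneg i h0 _ _)
    (QQ_shift_summable i hs l) (QQ_summable i hs k) (QQ_shift_summable i hs k)
    (QQ_summable i hs l) (fun u v => QQ_ineq i h0 hw k l hkl' u v)
  rw [QQ_shift_tsum, QQ_shift_tsum, QQ_tsum, QQ_tsum] at main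
  generalize SS i w k = A at *
  generalize SS i w l = B at *
  generalize SS i w (k+1) = C at *
  generalize SS i w (l+1) = D at *
  have hf : (0:ℝ) < (Nat.factorial k : ℝ) * (Nat.factorial l : ℝ) := by positivity
  rw [Nat.factorial_succ, Nat.factorial_succ] at main
  push_cast at main
  refine le_of_mul_le_mul_left ?_ hf
  calc _ = ((l:ℝ) + 1) * (Nat.factorial l : ℝ) * D * ((Nat.factorial k : ℝ) * A) := by ring
    _ ≤ _ := main
    _ = _ := by ring

theorem gen_ULC (h0 : ∀ k, 0 ≤ w k)
    (hw : ∀ k l : ℕ, k ≤ l → w k * (((l:ℝ)+1) * w (l+1)) ≤ (((k:ℝ)+1) * w (k+1)) * w l)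
    (hs : Summable (gW n w)) (hpos : ∀ j : Fin n, 0 < w j) :
    ULC (fun k => SS i w k / ∑' h : {h : Fin n → ℕ // StrictMono h}, gW n w h.1) := by
  have hS0 : ∀ k, 0 ≤ SS i w k := fun k => tsum_nonneg fun h => gW_nonneg n w h0 _
  have hsub : Summable (fun h : {h : Fin n → ℕ // StrictMono h} => gW n w h.1) :=
    hs.subtype {h : Fin n → ℕ | StrictMono h}
  have hZ : 0 < ∑' h : {h : Fin n → ℕ // StrictMono h}, gW n w h.1 := by
    refine hsub.tsum_pos (fun h => gW_nonneg n w h0 _) ⟨fun j => (j : ℕ), fun a b hab => hab⟩ ?_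
    refine mul_pos (Finset.prod_pos fun a _ => Finset.prod_pos fun b _ => ?_)
      (Finset.prod_pos fun j _ => hpos j)
    split_ifs with hab
    · have : ((a:ℕ):ℝ) < (b:ℕ) := by exact_mod_cast hab
      have : 0 < ((b:ℕ):ℝ) - (a:ℕ) := by linarith
      positivity
    · exact one_pos
  set Z := ∑' h : {h : Fin n → ℕ // StrictMono h}, gW n w h.1 with hZdef
  refine ⟨fun k => div_nonneg (hS0 k) hZ.le, ?_, fun k l hkl => ?_⟩
  · have h1 : HasSum (Set.indicator {h : Fin n → ℕ | StrictMono h} (gW n w)) Z := by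
      rw [← hasSum_subtype_iff_indicator]
      exact hsub.hasSum
    have h2 := h1.tsum_fiberwise (fun h => h i)
    have h3 : (fun k => ∑' b : (fun h : Fin n → ℕ => h i) ⁻¹' {k},
        Set.indicator {h : Fin n → ℕ | StrictMono h} (gW n w) b) = SS i w := by
      ext k
      rw [tsum_subtype]
      change _ = ∑' h : {h : Fin n → ℕ | StrictMono h ∧ h i = k}, gW n w h
      rw [tsum_subtype, Set.indicator_indicator]
      have : (fun h : Fin n → ℕ => h i) ⁻¹' {k} ∩ {h : Fin n → ℕ | StrictMono h} =
          {h : Fin n → ℕ | StrictMono h ∧ h i = k} := by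
        ext h
        simp [and_comm]
      rw [this]
    rw [h3] at h2
    have := h2.div_const Z
    rwa [div_self hZ.ne'] at this
  · have := SS_ineq i h0 hw hs k l hkl
    have hZ2 : 0 ≤ 1 / (Z * Z) := by positivity
    have h5 := mul_le_mul_of_nonneg_right this hZ2
    calc _ = SS i w k * (((l:ℝ)+1) * SS i w (l+1)) * (1 / (Z * Z)) := by field_simp
      _ ≤ _ := h5
      _ = _ := by field_simp
end

lemma charlier_ULC (n : ℕ) (α : ℝ) (hα : 0 < α) (i : Fin n) : ULC (charlierProb n α i) := by
  refine gen_ULC i (w := fun k => α ^ k / (Nat.factorial k : ℝ)) (fun k => by positivity)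
    (fun k l _ => ?_) (summable_gW n _ (fun k => by positivity) ?_) (fun j => by positivity)
  · simp only [Nat.factorial_succ]
    push_cast
    apply le_of_eq
    field_simp
    ring
  · have h1 := (Real.summable_pow_div_factorial (Real.exp 1 * α)).mul_left
      ((Nat.factorial (4*n) : ℝ) * Real.exp 1)
    refine Summable.of_nonneg_of_le (fun k => by positivity) (fun k => ?_) h1
    have h2 := Real.pow_div_factorial_le_exp ((k:ℝ)+1) (by positivity) (4*n)
    rw [div_le_iff₀ (by positivity), Real.exp_add] at h2
    have h3 : Real.exp (k:ℝ) = Real.exp 1 ^ k := by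
      rw [← Real.exp_nat_mul, mul_one]
    rw [h3] at h2
    calc _ ≤ α ^ k / (Nat.factorial k : ℝ) * (Real.exp 1 ^ k * Real.exp 1 * (Nat.factorial (4*n) : ℝ)) := by gcongr
      _ = _ := by rw [mul_pow]; ring

lemma kraw_ULC (n K : ℕ) (hnK : n ≤ K) (p : ℝ) (hp : 0 < p) (hp1 : p < 1) (i : Fin n) :
    ULC (krawtchoukProb n K p i) := by
  have hq : 0 < 1 - p := by linarith
  set w : ℕ → ℝ := fun k => (Nat.choose K k : ℝ) * p ^ k * (1 - p) ^ (K - k) with hwdef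
  have h0 : ∀ k, 0 ≤ w k := fun k => by positivity
  have hrec : ∀ k : ℕ, ((k:ℝ)+1) * w (k+1) * (1 - p) = ((K - k : ℕ) : ℝ) * p * w k := by
    intro k
    simp only [hwdef]
    have h1 := Nat.choose_succ_right_eq K k
    have h2 : (Nat.choose K (k+1) : ℝ) * ((k:ℝ)+1) = Nat.choose K k * ((K - k : ℕ) : ℝ) := by
      exact_mod_cast h1
    rcases lt_or_ge k K with hk | hk
    · have e : K - k = K - (k+1) + 1 := by omega
      have e2 : (1-p)^(K-k) = (1-p)^(K-(k+1)) * (1-p) := by rw [e, pow_succ]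
      rw [e2, pow_succ]
      linear_combination (p^k * p * (1-p)^(K-(k+1)) * (1-p)) * h2
    · rw [Nat.choose_eq_zero_of_lt (by omega : K < k+1), Nat.sub_eq_zero_of_le hk]
      simp
  have hW : ∀ h, krawtchoukWeight n K p h = gW n w h := fun h => rfl
  have hz : ∀ (h : Fin n → ℕ), ¬ (∀ j, h j ≤ K) → gW n w h = 0 := by
    intro h hh
    push Not at hh
    obtain ⟨j, hj⟩ := hh
    have hwz : w (h j) = 0 := by simp [hwdef, Nat.choose_eq_zero_of_lt hj]
    have : ∏ j, w (h j) = 0 := Finset.prod_eq_zero (Finset.mem_univ j) hwz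
    rw [gW, this, mul_zero]
  have hred : ∀ P : (Fin n → ℕ) → Prop,
      ∑' h : {h : Fin n → ℕ // P h}, gW n w h.1 =
      ∑' h : {h : Fin n → ℕ // P h ∧ ∀ j, h j ≤ K}, gW n w h.1 := by
    intro P
    change ∑' h : {h : Fin n → ℕ | P h}, gW n w h.1 =
      ∑' h : {h : Fin n → ℕ | P h ∧ ∀ j, h j ≤ K}, gW n w h.1
    rw [tsum_subtype {h : Fin n → ℕ | P h}, tsum_subtype {h : Fin n → ℕ | P h ∧ ∀ j, h j ≤ K}]
    refine tsum_congr fun h => ?_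
    classical
    simp only [Set.indicator_apply, Set.mem_ofPred_eq]
    by_cases hh : ∀ j, h j ≤ K
    · simp [hh]
    · simp [hz h hh]
  have heq : krawtchoukProb n K p i =
      fun k => SS i w k / ∑' h : {h : Fin n → ℕ // StrictMono h}, gW n w h.1 := by
    ext k
    unfold krawtchoukProb SS
    rw [hred (fun h => StrictMono h ∧ h i = k), hred StrictMono]
    simp only [hW]
    congr 1
    exact (Equiv.subtypeEquivRight (fun h : Fin n → ℕ => (by tauto :
      (StrictMono h ∧ (∀ j, h j ≤ K) ∧ h i = k) ↔
      ((StrictMono h ∧ h i = k) ∧ ∀ j, h j ≤ K)))).tsum_eq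
      (fun h : {h : Fin n → ℕ // (StrictMono h ∧ h i = k) ∧ ∀ j, h j ≤ K} => gW n w h.1)
  rw [heq]
  refine gen_ULC i h0 (fun k l hkl => ?_) (summable_gW n _ h0 ?_) (fun j => ?_)
  · have h1 := hrec k
    have h2 := hrec l
    have h3 : ((K - l : ℕ):ℝ) ≤ ((K - k : ℕ) : ℝ) := by
      exact_mod_cast Nat.sub_le_sub_left hkl K
    have h4 : 0 ≤ p * w k * w l := mul_nonneg (mul_nonneg hp.le (h0 _)) (h0 _)
    refine le_of_mul_le_mul_right ?_ hq
    have h5 := mul_le_mul_of_nonneg_right h3 h4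
    linear_combination h5 + w k * h2 - w l * h1
  · refine summable_of_ne_finset_zero (s := Finset.range (K+1)) (fun k hk => ?_)
    have : K < k := by simpa using hk
    simp [hwdef, Nat.choose_eq_zero_of_lt this]
  · have : 0 < Nat.choose K (j:ℕ) := Nat.choose_pos (by omega)
    simp only [hwdef]
    positivity

/-- Poisson-type concentration for the one-dimensional marginals of the Charlier and
the Krawtchouk ensembles: sub-Poissonian upper and lower tail bounds around the mean,
and variance bounded by the mean. -/
theorem poisson_concentration_charlier_krawtchouk (p : ℕ → ℝ)
    (hp : (∃ n, 1 ≤ n ∧ ∃ α : ℝ, 0 < α ∧ ∃ i : Fin n, p = charlierProb n α i) ∨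
          (∃ n K, 1 ≤ n ∧ n ≤ K ∧ ∃ pr : ℝ, 0 < pr ∧ pr < 1 ∧ ∃ i : Fin n,
            p = krawtchoukProb n K pr i)) :
    (∀ t : ℝ, 0 ≤ t →
      upperTail p t ≤ Real.exp (-(t ^ 2 / (2 * pmfMean p)) * aFun (t / pmfMean p))) ∧
    (∀ t : ℝ, 0 ≤ t → t ≤ pmfMean p →
      lowerTail p t ≤ Real.exp (-(t ^ 2 / (2 * pmfMean p)) * aFun (-(t / pmfMean p)))) ∧
    pmfVar p ≤ pmfMean p := by
  rcases hp with ⟨n, _, α, hα, i, rfl⟩ | ⟨n, K, _, hnK, pr, h0, h1, i, rfl⟩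
  · exact (charlier_ULC n α hα i).conc
  · exact (kraw_ULC n K hnK pr h0 h1 i).conc
end
end

section
/- Let a = (a_1, a_2, …) and b = (b_1, b_2, …) be sequences of nonnegative reals, only finitely many nonzero, with a_i·b_j < 1 for all i, j, so that Z_{a,b} = Σ_λ s_λ(a)·s_λ(b) is finite and positive, and let P_{a,b}(λ) = Z_{a,b}^{−1}·s_λ(a)·s_λ(b) be the associated Schur measure on the set of all partitions. Then for each i ≥ 1 the distribution of λ_i under P_{a,b} is log-concave on ℕ: P_{a,b}(λ_i = k−1)·P_{a,b}(λ_i = k+1) ≤ P_{a,b}(λ_i = k)² for all k ≥ 1. -/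
open scoped BigOperators

noncomputable section

/-- The Schur polynomial `s_λ(x)` evaluated at a sequence of variables `x`:
the sum over all semistandard Young tableaux `T` of shape `λ` of `∏_{c ∈ λ} x_{T(c)}`. -/
def schurEval (x : ℕ → ℝ) (μ : YoungDiagram) : ℝ :=
  ∑' T : SemistandardYoungTableau μ, ∏ c ∈ μ.cells, x (T c.1 c.2)

/-- The Schur-measure probability that the `i`-th row (`1`-indexed) of the random
partition has length `k`: `Z⁻¹ · Σ_{λ : λ_i = k} s_λ(a) s_λ(b)`. -/
def schurRowProb (a b : ℕ → ℝ) (i k : ℕ) : ℝ :=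
  (∑' μ : {μ : YoungDiagram // μ.rowLen (i - 1) = k}, schurEval a μ.1 * schurEval b μ.1) /
    ∑' μ : YoungDiagram, schurEval a μ * schurEval b μ


lemma lcs_tsum_mul_le {α β : Type*} {f : α → ℝ} {g : β → ℝ} {C : ℝ} (hf : Summable f)
    (hg : Summable g) (h : ∀ s t, (∑ x ∈ s, f x) * ∑ y ∈ t, g y ≤ C) :
    (∑' x, f x) * ∑' y, g y ≤ C := by
  have h1 : ∀ s : Finset α, (∑ x ∈ s, f x) * ∑' y, g y ≤ C := fun s =>
    le_of_tendsto' (hg.hasSum.mul_left (∑ x ∈ s, f x)) (fun t => by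
      rw [← Finset.mul_sum]; exact h s t)
  exact le_of_tendsto' (hf.hasSum.mul_right _) (fun s => by
      rw [← Finset.sum_mul]; exact h1 s)

abbrev LcsL := Bool → ℕ → ℕ → ℤ

def lcsC (α : ℤ) : LcsL := fun _ _ _ => α

open Classical in
def lcsS (w : LcsL → ℝ) (i n : ℕ) (p : ℤ) : ℝ := ∑' x : LcsL, if x false i n = p then w x else 0

open Classical in
lemma lcs_ff (w : LcsL → ℝ) (hw0 : ∀ x, 0 ≤ w x) (hs : Summable w)
    (hw : ∀ α : ℤ, 0 ≤ α → ∀ x y,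
      w x * w y ≤ w (x ⊔ (y - lcsC α)) * w ((x + lcsC α) ⊓ y)) (i n : ℕ) (p q : ℤ) (hpq : p < q) :
    lcsS w i n p * lcsS w i n q ≤ lcsS w i n (p + 1) * lcsS w i n (q - 1) := by
  have hα : 0 ≤ q - p - 1 := by lia
  generalize hαd : q - p - 1 = α at hα
  have hsum : ∀ p : ℤ, Summable (fun x : LcsL => if x false i n = p then w x else 0) := fun p => by
    refine Summable.of_nonneg_of_le (fun x => ?_) (fun x => ?_) hs
    · split_ifs <;> simp [hw0]
    · split_ifs <;> simp [hw0]
  have hshift : ∀ p : ℤ, HasSum (fun x : LcsL => if x false i n = p then w (x + lcsC α) else 0)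
      (lcsS w i n (p + α)) := fun p => by
    have := (Equiv.addRight (lcsC α)).hasSum_iff.2 (hsum (p + α)).hasSum
    have hf : (fun x : LcsL => if x false i n = p then w (x + lcsC α) else 0) =
        (fun x => if x false i n = p + α then w x else 0) ∘ (Equiv.addRight (lcsC α)) := by
      funext x
      simp [lcsC]
    rw [hf]; exact this
  have e1 : lcsS w i n q = ∑' x : LcsL, if x false i n = p + 1 then w (x + lcsC α) else 0 := by
    rw [(hshift (p+1)).tsum_eq]; congr 1; lia
  have e2 : lcsS w i n (q - 1) = ∑' x : LcsL, if x false i n = p then w (x + lcsC α) else 0 := by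
    rw [(hshift p).tsum_eq]; congr 1; lia
  rw [e1, e2, mul_comm (lcsS w i n (p+1))]
  refine lcs_tsum_mul_le (hsum p) (hshift (p+1)).summable (fun s t => ?_)
  refine (four_functions_theorem _ _
    (fun x : LcsL => if x false i n = p then w (x + lcsC α) else 0)
    (fun x : LcsL => if x false i n = p + 1 then w x else 0) ?_ ?_ ?_ ?_ ?_ s t).trans ?_
  · intro x; dsimp; split_ifs <;> simp [hw0]
  · intro x; dsimp; split_ifs <;> simp [hw0]
  · intro x; dsimp; split_ifs <;> simp [hw0]
  · intro x; dsimp; split_ifs <;> simp [hw0]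
  · intro x y
    by_cases hx : x false i n = p
    · by_cases hy : y false i n = p + 1
      · have h1 : (x ⊓ y) false i n = p := by simp [hx, hy]
        have h2 : (x ⊔ y) false i n = p + 1 := by simp [hx, hy]
        simp only [hx, hy, h1, h2, if_true]
        have := hw α hα x (y + lcsC α)
        rw [add_sub_cancel_right] at this
        rw [mul_comm (w _) (w (x ⊔ y))]
        have he : (x + lcsC α) ⊓ (y + lcsC α) = x ⊓ y + lcsC α := by
          funext b i j
          simp [lcsC, min_add_add_right]
        rwa [he] at this
      · simp only [hy, if_false, mul_zero]
        apply mul_nonneg <;> split_ifs <;> simp [hw0]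
    · simp only [hx, if_false, zero_mul]
      apply mul_nonneg <;> split_ifs <;> simp [hw0]
  · apply mul_le_mul
    · apply (hshift p).summable.sum_le_tsum
      intros; split_ifs <;> simp [hw0]
    · apply (hsum (p+1)).sum_le_tsum
      intros; split_ifs <;> simp [hw0]
    · apply Finset.sum_nonneg
      intros; split_ifs <;> simp [hw0]
    · apply tsum_nonneg
      intros; split_ifs <;> simp [hw0]

/-! Gelfand-Tsetlin encoding -/

def lcsEnc {μ : YoungDiagram} (T : SemistandardYoungTableau μ) (i m : ℕ) : ℕ :=
  ((Finset.range (μ.rowLen i)).filter (fun j => T i j < m)).card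

lemma lcs_lt_enc {μ : YoungDiagram} (T : SemistandardYoungTableau μ) (i m j : ℕ) :
    j < lcsEnc T i m ↔ (i, j) ∈ μ ∧ T i j < m := by
  unfold lcsEnc
  constructor
  · intro h
    by_contra hc
    have : (Finset.range (μ.rowLen i)).filter (fun j => T i j < m) ⊆ Finset.range j := by
      intro k hk
      simp only [Finset.mem_filter, Finset.mem_range, ← YoungDiagram.mem_iff_lt_rowLen] at hk ⊢
      by_contra hkj
      push Not at hkj
      exact hc ⟨μ.up_left_mem le_rfl hkj hk.1, (T.row_weak_of_le hkj hk.1).trans_lt hk.2⟩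
    have := Finset.card_le_card this
    simp at this
    lia
  · rintro ⟨h1, h2⟩
    have : Finset.range (j+1) ⊆ (Finset.range (μ.rowLen i)).filter (fun j => T i j < m) := by
      intro k hk
      simp only [Finset.mem_filter, Finset.mem_range, ← YoungDiagram.mem_iff_lt_rowLen] at hk ⊢
      have hkj : k ≤ j := by lia
      exact ⟨μ.up_left_mem le_rfl hkj h1, (T.row_weak_of_le hkj h1).trans_lt h2⟩
    have := Finset.card_le_card this
    simp at this
    lia

lemma lcs_nat_le {a b : ℕ} (h : ∀ j, j < a → j < b) : a ≤ b := by
  by_contra hc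
  exact absurd (h b (by lia)) (lt_irrefl _)

lemma lcs_nat_eq {a b : ℕ} (h : ∀ j, j < a ↔ j < b) : a = b :=
  le_antisymm (lcs_nat_le fun j => (h j).1) (lcs_nat_le fun j => (h j).2)

def LcsBdd (N : ℕ) {μ : YoungDiagram} (T : SemistandardYoungTableau μ) : Prop :=
  ∀ i j, (i, j) ∈ μ → T i j < N

structure LcsGT (N : ℕ) (X : ℕ → ℕ → ℤ) : Prop where
  z : ∀ i, X i 0 = 0
  mono : ∀ i m, X i m ≤ X i (m + 1)
  int : ∀ i m, X (i + 1) (m + 1) ≤ X i m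
  top : ∀ i m, N ≤ m → X i m = X i N

lemma lcs_enc_gt {N : ℕ} {μ : YoungDiagram} {T : SemistandardYoungTableau μ} (h : LcsBdd N T) :
    LcsGT N (fun i m => (lcsEnc T i m : ℤ)) where
  z i := by simp [lcsEnc]
  mono i m := by
    norm_cast
    refine lcs_nat_le fun j => ?_
    rw [lcs_lt_enc, lcs_lt_enc]
    rintro ⟨h1, h2⟩
    exact ⟨h1, by lia⟩
  int i m := by
    norm_cast
    refine lcs_nat_le fun j => ?_
    rw [lcs_lt_enc, lcs_lt_enc]
    rintro ⟨h1, h2⟩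
    have := T.col_strict (Nat.lt_succ_self i) h1
    exact ⟨μ.up_left_mem (by lia) le_rfl h1, by lia⟩
  top i m hm := by
    norm_cast
    refine lcs_nat_eq fun j => ?_
    rw [lcs_lt_enc, lcs_lt_enc]
    constructor
    · rintro ⟨h1, h2⟩
      exact ⟨h1, h _ _ h1⟩
    · rintro ⟨h1, h2⟩
      exact ⟨h1, by lia⟩

lemma lcs_enc_top {N : ℕ} {μ : YoungDiagram} {T : SemistandardYoungTableau μ} (h : LcsBdd N T)
    (i : ℕ) : lcsEnc T i N = μ.rowLen i := by
  refine lcs_nat_eq fun j => ?_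
  rw [lcs_lt_enc, ← YoungDiagram.mem_iff_lt_rowLen]
  exact ⟨fun h => h.1, fun h' => ⟨h', h _ _ h'⟩⟩

lemma LcsGT.mono' {N : ℕ} {X : ℕ → ℕ → ℤ} (h : LcsGT N X) (i : ℕ) : Monotone (X i) :=
  monotone_nat_of_le_succ (h.mono i)

lemma LcsGT.anti {N : ℕ} {X : ℕ → ℕ → ℤ} (h : LcsGT N X) (m : ℕ) : Antitone (fun i => X i m) :=
  antitone_nat_of_succ_le (fun i => (h.mono _ _).trans (h.int i m))

lemma LcsGT.nonneg {N : ℕ} {X : ℕ → ℕ → ℤ} (h : LcsGT N X) (i m : ℕ) : 0 ≤ X i m := by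
  rw [← h.z i]; exact h.mono' i (Nat.zero_le _)

lemma LcsGT.zero {N : ℕ} {X : ℕ → ℕ → ℤ} (h : LcsGT N X) (m : ℕ) : ∀ i, m ≤ i → X i m = 0 := by
  induction m with
  | zero => intro i _; exact h.z i
  | succ m ih =>
    intro i hi
    obtain ⟨i, rfl⟩ : ∃ k, i = k + 1 := ⟨i - 1, by lia⟩
    exact le_antisymm ((h.int i m).trans (ih i (by lia)).le) (h.nonneg _ _)

lemma LcsGT.exists_shape {N : ℕ} {X : ℕ → ℕ → ℤ} (h : LcsGT N X) :
    ∃ μ : YoungDiagram, ∀ i j, (i, j) ∈ μ ↔ (j : ℤ) < X i N := by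
  refine ⟨⟨(Finset.range N ×ˢ Finset.range (X 0 N).toNat).filter (fun c => (c.2 : ℤ) < X c.1 N),
    ?_⟩, ?_⟩
  · rintro ⟨i, j⟩ ⟨i', j'⟩ ⟨h1, h2⟩ h3
    dsimp only at h1 h2
    simp only [Finset.coe_filter, Finset.mem_product, Finset.mem_range, Set.mem_ofPred_eq] at h3 ⊢
    have := h.anti N h1
    dsimp only at this
    refine ⟨⟨by lia, by lia⟩, by lia⟩
  · intro i j
    rw [← YoungDiagram.mem_cells]
    simp only [Finset.mem_filter, Finset.mem_product, Finset.mem_range]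
    refine ⟨fun h => h.2, fun h' => ⟨⟨?_, ?_⟩, h'⟩⟩
    · by_contra hc
      have := h.zero N i (by lia)
      lia
    · have := h.anti N (Nat.zero_le i)
      dsimp only at this
      lia

lemma LcsGT.exists_tab {N : ℕ} {X : ℕ → ℕ → ℤ} (h : LcsGT N X) (μ : YoungDiagram)
    (hμ : ∀ i j, (i, j) ∈ μ ↔ (j : ℤ) < X i N) :
    ∃ T : SemistandardYoungTableau μ, LcsBdd N T ∧ ∀ i m, (lcsEnc T i m : ℤ) = X i m := by
  classical
  let t : ℕ → ℕ → ℕ := fun i j =>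
    if hj : ∃ m, (j : ℤ) < X i (m + 1) then Nat.find hj else 0
  have hle : ∀ i m, X i m ≤ X i N := fun i m => by
    rcases le_total N m with hm | hm
    · exact (h.top i m hm).le
    · exact h.mono' i hm
  have hex : ∀ i j, (i, j) ∈ μ → ∃ m, (j : ℤ) < X i (m + 1) := fun i j hij =>
    ⟨N, ((hμ i j).1 hij).trans_le (h.mono i N)⟩
  have ht : ∀ i j, (i, j) ∈ μ → ∀ m, t i j < m ↔ (j : ℤ) < X i m := by
    intro i j hij m
    simp only [t, dif_pos (hex i j hij), Nat.find_lt_iff]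
    constructor
    · rintro ⟨k, hk, h1⟩
      exact h1.trans_le (h.mono' i hk)
    · intro hj
      rcases m with _ | m
      · rw [h.z] at hj; lia
      · exact ⟨m, by lia, hj⟩
  have hdec : ∀ i j1 j2, j1 ≤ j2 → (i, j2) ∈ μ → (i, j1) ∈ μ := fun i j1 j2 hj hm =>
    μ.up_left_mem le_rfl hj hm
  let T : SemistandardYoungTableau μ :=
    { entry := t
      row_weak' := by
        intro i j1 j2 hj hm
        have := (ht i j2 hm (t i j2 + 1)).1 (by lia)
        have := (ht i j1 (hdec i j1 j2 hj.le hm) (t i j2 + 1)).2 (by lia)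
        lia
      col_strict' := by
        intro i1 i2 j hi hm
        have h1 := (ht i2 j hm (t i2 j + 1)).1 (by lia)
        refine (ht i1 j (μ.up_left_mem hi.le le_rfl hm) (t i2 j)).2 ?_
        obtain ⟨k, rfl⟩ : ∃ k, i2 = k + 1 := ⟨i2 - 1, by lia⟩
        have h2 := h.int k (t (k+1) j)
        have h3 := h.anti (t (k+1) j) (show i1 ≤ k by lia)
        dsimp only at h3
        lia
      zeros' := by
        intro i j hij
        have : ¬ ∃ m, (j : ℤ) < X i (m + 1) := by
          rintro ⟨m, hm⟩
          exact hij ((hμ i j).2 (hm.trans_le (hle _ _)))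
        simp only [t, dif_neg this] }
  have hT : ∀ i j, T i j = t i j := fun _ _ => rfl
  refine ⟨T, ?_, ?_⟩
  · intro i j hij
    rw [hT, ht i j hij, ← hμ]; exact hij
  · intro i m
    have h0 := h.nonneg i m
    have : lcsEnc T i m = (X i m).toNat := by
      refine lcs_nat_eq fun j => ?_
      rw [lcs_lt_enc, hT]
      constructor
      · rintro ⟨h1, h2⟩
        have := (ht i j h1 m).1 h2
        lia
      · intro h1
        have h2 : (j : ℤ) < X i m := by lia
        have h3 := (hμ i j).2 (h2.trans_le (hle _ _))
        exact ⟨h3, (ht i j h3 m).2 h2⟩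
    rw [this]; lia

lemma LcsGT.sup {N : ℕ} {X Y : ℕ → ℕ → ℤ} (hX : LcsGT N X) (hY : LcsGT N Y) {α : ℤ} (hα : 0 ≤ α) :
    LcsGT N (fun i m => max (X i m) (Y i m - α)) where
  z i := by have := hX.z i; have := hY.z i; lia
  mono i m := by have := hX.mono i m; have := hY.mono i m; lia
  int i m := by have := hX.int i m; have := hY.int i m; lia
  top i m hm := by have := hX.top i m hm; have := hY.top i m hm; lia

lemma LcsGT.inf {N : ℕ} {X Y : ℕ → ℕ → ℤ} (hX : LcsGT N X) (hY : LcsGT N Y) {α : ℤ} (hα : 0 ≤ α) :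
    LcsGT N (fun i m => min (X i m + α) (Y i m)) where
  z i := by have := hX.z i; have := hY.z i; lia
  mono i m := by have := hX.mono i m; have := hY.mono i m; lia
  int i m := by have := hX.int i m; have := hY.int i m; lia
  top i m hm := by have := hX.top i m hm; have := hY.top i m hm; lia

/-! weights -/

def lcsWt (x : ℕ → ℝ) {μ : YoungDiagram} (T : SemistandardYoungTableau μ) : ℝ :=
  ∏ c ∈ μ.cells, x (T c.1 c.2)

def lcsCnt {μ : YoungDiagram} (T : SemistandardYoungTableau μ) (m : ℕ) : ℕ :=
  (μ.cells.filter (fun c => T c.1 c.2 = m)).card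

lemma lcs_wt_eq (x : ℕ → ℝ) {N : ℕ} {μ : YoungDiagram} {T : SemistandardYoungTableau μ}
    (h : LcsBdd N T) : lcsWt x T = ∏ m ∈ Finset.range N, x m ^ lcsCnt T m := by
  unfold lcsWt lcsCnt
  rw [← Finset.prod_fiberwise_of_maps_to (t := Finset.range N) (g := fun c => T c.1 c.2)]
  · refine Finset.prod_congr rfl fun m _ => ?_
    rw [Finset.prod_congr rfl (g := fun _ => x m), Finset.prod_const]
    intro c hc
    rw [(Finset.mem_filter.1 hc).2]
  · rintro ⟨i, j⟩ hc
    exact Finset.mem_range.2 (h i j hc)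

lemma lcs_row_le {μ : YoungDiagram} (T : SemistandardYoungTableau μ) (i j : ℕ) (h : (i, j) ∈ μ) :
    i ≤ T i j := by
  induction i with
  | zero => simp
  | succ i ih =>
    have := ih (μ.up_left_mem (by lia) le_rfl h)
    have := T.col_strict (Nat.lt_succ_self i) h
    lia

lemma lcs_card_lt {N : ℕ} {μ : YoungDiagram} {T : SemistandardYoungTableau μ}
    (h : LcsBdd N T) (m : ℕ) :
    (μ.cells.filter (fun c => T c.1 c.2 < m)).card = ∑ i ∈ Finset.range N, lcsEnc T i m := by
  rw [Finset.card_eq_sum_card_fiberwise (t := Finset.range N) (f := Prod.fst)]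
  · refine Finset.sum_congr rfl fun i _ => ?_
    rw [← Finset.card_range (lcsEnc T i m)]
    symm
    refine Finset.card_bij (fun j _ => (i, j)) ?_ ?_ ?_
    · intro j hj
      rw [Finset.mem_range, lcs_lt_enc] at hj
      simpa using hj
    · intro j _ j' _ hjj
      simpa using hjj
    · rintro ⟨i', j⟩ hc
      simp only [Finset.mem_filter, YoungDiagram.mem_cells] at hc
      obtain ⟨⟨h1, h2⟩, rfl⟩ := hc
      exact ⟨j, by rw [Finset.mem_range, lcs_lt_enc]; exact ⟨h1, h2⟩, rfl⟩
  · rintro ⟨i, j⟩ hc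
    simp only [Finset.coe_filter, Set.mem_ofPred_eq, YoungDiagram.mem_cells] at hc
    have := lcs_row_le T i j hc.1
    have := h i j hc.1
    simp only [Finset.coe_range, Set.mem_Iio]
    lia

lemma lcs_cnt_eq {N : ℕ} {μ : YoungDiagram} {T : SemistandardYoungTableau μ}
    (h : LcsBdd N T) (m : ℕ) :
    (lcsCnt T m : ℤ) = ∑ i ∈ Finset.range N, ((lcsEnc T i (m+1) : ℤ) - lcsEnc T i m) := by
  have h1 := lcs_card_lt h m
  have h2 := lcs_card_lt h (m+1)
  have h3 : (μ.cells.filter (fun c => T c.1 c.2 < m + 1)).card =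
      (μ.cells.filter (fun c => T c.1 c.2 < m)).card + lcsCnt T m := by
    unfold lcsCnt
    rw [← Finset.card_union_of_disjoint, ← Finset.filter_or]
    · congr 1
      refine Finset.filter_congr fun c _ => ?_
      lia
    · rw [Finset.disjoint_filter]
      intro c _ h1 h2
      lia
  rw [Finset.sum_sub_distrib]
  have h1' : ((μ.cells.filter (fun c => T c.1 c.2 < m)).card : ℤ) = _ := congrArg Nat.cast h1
  have h2' : ((μ.cells.filter (fun c => T c.1 c.2 < m+1)).card : ℤ) = _ := congrArg Nat.cast h2
  push_cast at h1' h2'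
  lia

lemma lcs_wt_mul (x : ℕ → ℝ) {N : ℕ} {μ₁ μ₂ μ₃ μ₄ : YoungDiagram}
    {T₁ : SemistandardYoungTableau μ₁} {T₂ : SemistandardYoungTableau μ₂}
    {T₃ : SemistandardYoungTableau μ₃} {T₄ : SemistandardYoungTableau μ₄}
    (h₁ : LcsBdd N T₁) (h₂ : LcsBdd N T₂) (h₃ : LcsBdd N T₃) (h₄ : LcsBdd N T₄)
    (h : ∀ i m, (lcsEnc T₁ i m : ℤ) + lcsEnc T₂ i m = lcsEnc T₃ i m + lcsEnc T₄ i m) :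
    lcsWt x T₁ * lcsWt x T₂ = lcsWt x T₃ * lcsWt x T₄ := by
  rw [lcs_wt_eq x h₁, lcs_wt_eq x h₂, lcs_wt_eq x h₃, lcs_wt_eq x h₄,
    ← Finset.prod_mul_distrib, ← Finset.prod_mul_distrib]
  refine Finset.prod_congr rfl fun m _ => ?_
  rw [← pow_add, ← pow_add]
  congr 1
  zify
  rw [lcs_cnt_eq h₁, lcs_cnt_eq h₂, lcs_cnt_eq h₃, lcs_cnt_eq h₄,
    ← Finset.sum_add_distrib, ← Finset.sum_add_distrib]
  refine Finset.sum_congr rfl fun i _ => ?_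
  have := h i m
  have := h i (m+1)
  lia

lemma lcs_bdd_of_wt {x : ℕ → ℝ} {N : ℕ} (hx : ∀ i, N ≤ i → x i = 0) {μ : YoungDiagram}
    {T : SemistandardYoungTableau μ} (h : lcsWt x T ≠ 0) : LcsBdd N T := by
  intro i j hij
  by_contra hc
  exact (Finset.prod_ne_zero_iff.1 h) (i, j) hij (hx _ (by simpa using hc))

lemma lcs_wt_summable {x : ℕ → ℝ} {N : ℕ} (hx : ∀ i, N ≤ i → x i = 0) (μ : YoungDiagram) :
    Summable (fun T : SemistandardYoungTableau μ => lcsWt x T) := by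
  apply summable_of_hasFiniteSupport
  let φ : SemistandardYoungTableau μ → (μ.cells → ℕ) := fun T c => T c.1.1 c.1.2
  have hφ : Function.Injective φ := by
    intro T T' h
    ext i j
    by_cases hij : (i, j) ∈ μ
    · exact congrFun h ⟨(i, j), hij⟩
    · rw [T.zeros hij, T'.zeros hij]
  have hfin : {f : μ.cells → ℕ | ∀ c, f c ∈ Set.Iio N}.Finite :=
    Set.Finite.pi' (fun _ => Set.finite_Iio N)
  refine (hfin.preimage hφ.injOn).subset ?_
  rintro T hT ⟨⟨i, j⟩, hc⟩
  exact lcs_bdd_of_wt hx hT i j hc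

abbrev LcsD := Σ μ : YoungDiagram, SemistandardYoungTableau μ × SemistandardYoungTableau μ

def lcsE (d : LcsD) : LcsL := fun b i m =>
  bif b then (lcsEnc d.2.2 i m : ℤ) else (lcsEnc d.2.1 i m : ℤ)

def lcsW (a b : ℕ → ℝ) (d : LcsD) : ℝ := lcsWt a d.2.1 * lcsWt b d.2.2

lemma lcs_tab_eq {μ : YoungDiagram} {T T' : SemistandardYoungTableau μ}
    (h : ∀ i m, lcsEnc T i m = lcsEnc T' i m) : T = T' := by
  ext i j
  by_cases hij : (i, j) ∈ μ
  · have h1 := (lcs_lt_enc T i (T i j + 1) j).2 ⟨hij, by lia⟩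
    rw [h, lcs_lt_enc] at h1
    have h2 := (lcs_lt_enc T' i (T' i j + 1) j).2 ⟨hij, by lia⟩
    rw [← h, lcs_lt_enc] at h2
    lia
  · rw [T.zeros hij, T'.zeros hij]

lemma lcs_shape_le {μ μ' : YoungDiagram} {T : SemistandardYoungTableau μ}
    {T' : SemistandardYoungTableau μ'}
    (h : ∀ i m, lcsEnc T i m = lcsEnc T' i m) (i j : ℕ) (hij : (i, j) ∈ μ) : (i, j) ∈ μ' := by
  have h1 := (lcs_lt_enc T i (T i j + 1) j).2 ⟨hij, by lia⟩
  rw [h, lcs_lt_enc] at h1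
  exact h1.1

lemma lcsE_inj : Function.Injective lcsE := by
  rintro ⟨μ, T, S⟩ ⟨μ', T', S'⟩ h
  have h1 : ∀ i m, lcsEnc T i m = lcsEnc T' i m := fun i m => by
    simpa [lcsE] using congrFun (congrFun (congrFun h false) i) m
  have h2 : ∀ i m, lcsEnc S i m = lcsEnc S' i m := fun i m => by
    simpa [lcsE] using congrFun (congrFun (congrFun h true) i) m
  obtain rfl : μ = μ' := by
    ext ⟨i, j⟩
    exact ⟨lcs_shape_le h1 i j, lcs_shape_le (fun i m => (h1 i m).symm) i j⟩
  rw [lcs_tab_eq h1, lcs_tab_eq h2]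

lemma lcs_ops (a b : ℕ → ℝ) {N : ℕ} {d d' : LcsD} (h1 : LcsBdd N d.2.1) (h2 : LcsBdd N d.2.2)
    (h1' : LcsBdd N d'.2.1) (h2' : LcsBdd N d'.2.2) {α : ℤ} (hα : 0 ≤ α) :
    ∃ u v : LcsD, lcsE u = lcsE d ⊔ (lcsE d' - lcsC α) ∧ lcsE v = (lcsE d + lcsC α) ⊓ lcsE d' ∧
      lcsW a b d * lcsW a b d' = lcsW a b u * lcsW a b v := by
  obtain ⟨μ, T, S⟩ := d
  obtain ⟨μ', T', S'⟩ := d'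
  dsimp only at h1 h2 h1' h2'
  have tt : ∀ i, lcsEnc T i N = lcsEnc S i N := fun i => by
    rw [lcs_enc_top h1, lcs_enc_top h2]
  have tt' : ∀ i, lcsEnc T' i N = lcsEnc S' i N := fun i => by
    rw [lcs_enc_top h1', lcs_enc_top h2']
  have g1 := (lcs_enc_gt h1).sup (lcs_enc_gt h1') hα
  have g2 := (lcs_enc_gt h2).sup (lcs_enc_gt h2') hα
  have g3 := (lcs_enc_gt h1).inf (lcs_enc_gt h1') hα
  have g4 := (lcs_enc_gt h2).inf (lcs_enc_gt h2') hα
  obtain ⟨ν, hν⟩ := g1.exists_shape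
  obtain ⟨ρ, hρ⟩ := g3.exists_shape
  obtain ⟨A, hA, eA⟩ := g1.exists_tab ν hν
  obtain ⟨B, hB, eB⟩ := g2.exists_tab ν (by simpa only [tt, tt'] using hν)
  obtain ⟨A', hA', eA'⟩ := g3.exists_tab ρ hρ
  obtain ⟨B', hB', eB'⟩ := g4.exists_tab ρ (by simpa only [tt, tt'] using hρ)
  refine ⟨⟨ν, A, B⟩, ⟨ρ, A', B'⟩, ?_, ?_, ?_⟩
  · funext c i m
    cases c
    · simp [lcsE, lcsC, eA]
    · simp [lcsE, lcsC, eB]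
  · funext c i m
    cases c
    · simp [lcsE, lcsC, eA']
    · simp [lcsE, lcsC, eB']
  · have w1 := lcs_wt_mul a h1 h1' hA hA' (fun i m => by rw [eA, eA']; lia)
    have w2 := lcs_wt_mul b h2 h2' hB hB' (fun i m => by rw [eB, eB']; lia)
    simp only [lcsW]
    calc _ = (lcsWt a T * lcsWt a T') * (lcsWt b S * lcsWt b S') := by ring
      _ = _ := by rw [w1, w2]; ring

def lcsNum (a b : ℕ → ℝ) (i k : ℕ) : ℝ :=
  ∑' μ : {μ : YoungDiagram // μ.rowLen i = k}, schurEval a μ.1 * schurEval b μ.1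

lemma lcs_wt_nonneg {x : ℕ → ℝ} (hx : ∀ i, 0 ≤ x i) {μ : YoungDiagram}
    (T : SemistandardYoungTableau μ) : 0 ≤ lcsWt x T := Finset.prod_nonneg fun _ _ => hx _

lemma lcs_num_mul (a b : ℕ → ℝ) (ha0 : ∀ i, 0 ≤ a i) (hb0 : ∀ j, 0 ≤ b j)
    {N : ℕ} (ha : ∀ i, N ≤ i → a i = 0) (hb : ∀ j, N ≤ j → b j = 0)
    (hZ : Summable fun μ : YoungDiagram => schurEval a μ * schurEval b μ)
    (i k l : ℕ) (hkl : k < l) :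
    lcsNum a b i k * lcsNum a b i l ≤ lcsNum a b i (k + 1) * lcsNum a b i (l - 1) := by
  classical
  have hWf : ∀ μ, HasSum (fun t : SemistandardYoungTableau μ × SemistandardYoungTableau μ =>
      lcsW a b ⟨μ, t⟩) (schurEval a μ * schurEval b μ) := fun μ => by
    have s1 := lcs_wt_summable ha μ
    have s2 := lcs_wt_summable hb μ
    have s3 := s1.mul_of_nonneg s2 (fun T => lcs_wt_nonneg ha0 T) (fun T => lcs_wt_nonneg hb0 T)
    have := s1.tsum_mul_tsum s2 s3
    rw [show schurEval a μ * schurEval b μ = _ from this]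
    exact s3.hasSum
  have hW0 : ∀ d, 0 ≤ lcsW a b d := fun d => mul_nonneg (lcs_wt_nonneg ha0 _) (lcs_wt_nonneg hb0 _)
  have hWs : Summable (lcsW a b) := by
    rw [summable_sigma_of_nonneg hW0]
    refine ⟨fun μ => (hWf μ).summable, ?_⟩
    simp only [(hWf _).tsum_eq]
    exact hZ
  let w : LcsL → ℝ := Function.extend lcsE (lcsW a b) 0
  have hwE : ∀ d, w (lcsE d) = lcsW a b d := fun d => lcsE_inj.extend_apply _ _ _
  have hwn : ∀ x, (¬ ∃ d, lcsE d = x) → w x = 0 := fun x hx => by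
    simp only [w]; rw [Function.extend_apply' _ _ _ hx]; rfl
  have hw0 : ∀ x, 0 ≤ w x := fun x => by
    by_cases hx : ∃ d, lcsE d = x
    · obtain ⟨d, rfl⟩ := hx
      rw [hwE]; exact hW0 d
    · rw [hwn x hx]
  have hws : Summable w := by
    rw [← lcsE_inj.summable_iff (fun x hx => hwn x hx)]
    convert hWs using 1
    funext d; exact hwE d
  have hbdd : ∀ d, lcsW a b d ≠ 0 → LcsBdd N d.2.1 ∧ LcsBdd N d.2.2 := fun d hd =>
    ⟨lcs_bdd_of_wt ha (left_ne_zero_of_mul hd), lcs_bdd_of_wt hb (right_ne_zero_of_mul hd)⟩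
  have hww : ∀ α : ℤ, 0 ≤ α → ∀ x y,
      w x * w y ≤ w (x ⊔ (y - lcsC α)) * w ((x + lcsC α) ⊓ y) := by
    intro α hα x y
    by_cases hxy : w x * w y = 0
    · rw [hxy]; exact mul_nonneg (hw0 _) (hw0 _)
    have hx : ∃ d, lcsE d = x := by
      by_contra hc; exact hxy (by rw [hwn x hc, zero_mul])
    have hy : ∃ d, lcsE d = y := by
      by_contra hc; exact hxy (by rw [hwn y hc, mul_zero])
    obtain ⟨d, rfl⟩ := hx
    obtain ⟨d', rfl⟩ := hy
    rw [hwE, hwE] at hxy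
    obtain ⟨h1, h2⟩ := hbdd d (left_ne_zero_of_mul hxy)
    obtain ⟨h1', h2'⟩ := hbdd d' (right_ne_zero_of_mul hxy)
    obtain ⟨u, v, hu, hv, huv⟩ := lcs_ops a b h1 h2 h1' h2' hα
    rw [← hu, ← hv, hwE, hwE, hwE, hwE, huv]
  have hnum : ∀ k : ℕ, lcsNum a b i k = lcsS w i N (k : ℤ) := by
    intro k
    have e1 : lcsS w i N (k : ℤ) =
        ∑' d : LcsD, if d.1.rowLen i = k then lcsW a b d else 0 := by
      unfold lcsS
      rw [← lcsE_inj.tsum_eq]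
      · refine tsum_congr fun d => ?_
        rw [hwE]
        by_cases hd : lcsW a b d = 0
        · simp [hd]
        · have := lcs_enc_top (hbdd d hd).1 i
          simp [lcsE, this]
      · intro x hx
        by_contra hc
        apply hx
        simp only [hwn x hc, ite_self]
    have hs : Summable (fun d : LcsD => if d.1.rowLen i = k then lcsW a b d else 0) := by
      refine Summable.of_nonneg_of_le (fun x => ?_) (fun x => ?_) hWs
      · split_ifs <;> simp [hW0]
      · split_ifs <;> simp [hW0]
    rw [e1, hs.tsum_sigma]
    unfold lcsNum
    refine (tsum_subtype {μ : YoungDiagram | μ.rowLen i = k}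
      (fun μ => schurEval a μ * schurEval b μ)).trans ?_
    refine tsum_congr fun μ => ?_
    by_cases hμ : μ.rowLen i = k
    · simp [Set.indicator, hμ, (hWf μ).tsum_eq]
    · simp [Set.indicator, hμ]
  rw [hnum, hnum, hnum, hnum]
  have := lcs_ff w hw0 hws hww i N k l (by exact_mod_cast hkl)
  push_cast [Nat.cast_sub (show 1 ≤ l by lia)]
  exact this

lemma lcs_pos_between {P : ℕ → ℝ} (h0 : ∀ k, 0 ≤ P k)
    (h : ∀ k l, k < l → P k * P l ≤ P (k + 1) * P (l - 1)) :
    ∀ n k₁ k₂ k₃ : ℕ, k₃ - k₁ ≤ n → k₁ ≤ k₂ → k₂ ≤ k₃ → 0 < P k₁ → 0 < P k₃ → 0 < P k₂ := by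
  intro n
  induction n with
  | zero =>
    intro k₁ k₂ k₃ h1 h2 h3 h4 h5
    obtain rfl : k₂ = k₁ := by lia
    exact h4
  | succ n ih =>
    intro k₁ k₂ k₃ h1 h2 h3 h4 h5
    rcases h2.eq_or_lt with rfl | h2
    · exact h4
    rcases h3.eq_or_lt with rfl | h3
    · exact h5
    have hp := (mul_pos h4 h5).trans_le (h k₁ k₃ (by lia))
    have p1 : 0 < P (k₁ + 1) := (h0 _).lt_of_ne' (left_ne_zero_of_mul hp.ne')
    have p2 : 0 < P (k₃ - 1) := (h0 _).lt_of_ne' (right_ne_zero_of_mul hp.ne')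
    exact ih (k₁ + 1) k₂ (k₃ - 1) (by lia) (by lia) (by lia) p1 p2


/-- For nonnegative specializations `a`, `b`, each with finitely many nonzero entries
and `a_i b_j < 1` for all `i, j` (so that the Schur measure `P_{a,b}` is well defined),
the distribution of each row length `λ_i` under `P_{a,b}` is log-concave on ℕ. -/
theorem logConcave_row_schur_measure (a b : ℕ → ℝ)
    (ha0 : ∀ i, 0 ≤ a i) (hb0 : ∀ j, 0 ≤ b j)
    (hafin : ∃ N, ∀ i, N ≤ i → a i = 0) (hbfin : ∃ N, ∀ j, N ≤ j → b j = 0)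
    (hab : ∀ i j, a i * b j < 1) :
    ∀ i : ℕ, 1 ≤ i →
      (∀ k : ℕ, 1 ≤ k →
        schurRowProb a b i (k - 1) * schurRowProb a b i (k + 1) ≤
          (schurRowProb a b i k) ^ 2) ∧
      (∀ k₁ k₂ k₃ : ℕ, k₁ ≤ k₂ → k₂ ≤ k₃ →
        0 < schurRowProb a b i k₁ → 0 < schurRowProb a b i k₃ →
        0 < schurRowProb a b i k₂) := by
  intro i hi
  obtain ⟨Na, ha⟩ := hafin
  obtain ⟨Nb, hb⟩ := hbfin
  have hSE : ∀ x : ℕ → ℝ, (∀ i, 0 ≤ x i) → ∀ μ, 0 ≤ schurEval x μ := fun x hx μ =>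
    tsum_nonneg fun T => lcs_wt_nonneg hx T
  have hP0 : ∀ k, 0 ≤ schurRowProb a b i k := fun k =>
    div_nonneg (tsum_nonneg fun μ => mul_nonneg (hSE a ha0 _) (hSE b hb0 _))
      (tsum_nonneg fun μ => mul_nonneg (hSE a ha0 _) (hSE b hb0 _))
  have hP : ∀ k l, k < l → schurRowProb a b i k * schurRowProb a b i l ≤
      schurRowProb a b i (k + 1) * schurRowProb a b i (l - 1) := by
    intro k l hkl
    by_cases hZ : Summable fun μ : YoungDiagram => schurEval a μ * schurEval b μ
    · have := lcs_num_mul a b ha0 hb0 (N := max Na Nb) (fun i hi => ha i (by lia))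
        (fun j hj => hb j (by lia)) hZ (i - 1) k l hkl
      unfold schurRowProb
      rw [div_mul_div_comm, div_mul_div_comm]
      exact div_le_div_of_nonneg_right this (mul_self_nonneg _)
    · unfold schurRowProb
      rw [tsum_eq_zero_of_not_summable hZ]
      simp
  refine ⟨fun k hk => ?_, fun k₁ k₂ k₃ h1 h2 h3 h4 =>
    lcs_pos_between hP0 hP (k₃ - k₁) k₁ k₂ k₃ le_rfl h1 h2 h3 h4⟩
  have := hP (k - 1) (k + 1) (by lia)
  rw [Nat.sub_add_cancel hk, Nat.add_sub_cancel] at this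
  rw [sq]; exact this
end
end

section
/- Let β > 0, n ≥ 1, and let V : ℝ → ℝ ∪ {∞} be convex and such that Z = ∫_{W_n} exp(−β·H_n(x)) dx is finite and positive, where H_n(x) = −Σ_{1≤i<j≤n} log|x_i − x_j| + Σ_{i=1}^n V(x_i) and W_n = {x ∈ ℝ^n : x_1 < x_2 < ⋯ < x_n}. Let X = (x_1 < ⋯ < x_n) be distributed according to the ordered β-Coulomb gas with density proportional to exp(−β·H_n)·1_{W_n}. Then for each k ∈ {1, …, n} the distribution of the ordered point x_k is log-concave on ℝ, and for each k ∈ {2, …, n} the distribution of the gap x_k − x_{k−1} is log-concave on ℝ. -/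
open scoped BigOperators
open MeasureTheory

noncomputable section

/-- `exp(-t)` for an extended-real `t`, with `exp(-∞) = 0`. -/
def expNeg (t : EReal) : ℝ :=
  if t = ⊤ then 0 else if t = ⊥ then 0 else Real.exp (-(t.toReal))

open Classical in
/-- The unnormalized density `exp(-β H_n(x)) 1_{W_n}(x)` of the ordered β-Coulomb gas
with potential `V : ℝ → ℝ ∪ {∞}`. -/
def coulombDensity (n : ℕ) (β : ℝ) (V : ℝ → EReal) (x : Fin n → ℝ) : ℝ :=
  if StrictMono x then
    (∏ i : Fin n, ∏ j : Fin n, if i < j then (x j - x i) ^ β else 1) *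
      ∏ i : Fin n, expNeg ((β : EReal) * V (x i))
  else 0

/-- The (normalized) ordered β-Coulomb gas as a measure on `ℝⁿ`. -/
def coulombMeasure (n : ℕ) (β : ℝ) (V : ℝ → EReal) : Measure (Fin n → ℝ) :=
  volume.withDensity fun x =>
    ENNReal.ofReal (coulombDensity n β V x / ∫ z : Fin n → ℝ, coulombDensity n β V z)

open scoped ENNReal

def PL {E : Type*} [AddCommGroup E] [Module ℝ E] [MeasurableSpace E] (μ : Measure E) : Prop :=
  ∀ f g h : E → ℝ≥0∞, Measurable f → Measurable g → Measurable h → ∀ s : ℝ, 0 < s → s < 1 →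
    (∀ x y, f x ^ s * g y ^ (1 - s) ≤ h (s • x + (1 - s) • y)) →
    (∫⁻ x, f x ∂μ) ^ s * (∫⁻ x, g x ∂μ) ^ (1 - s) ≤ ∫⁻ x, h x ∂μ

lemma PL.prod {E F : Type*} [AddCommGroup E] [Module ℝ E] [MeasurableSpace E]
    [AddCommGroup F] [Module ℝ F] [MeasurableSpace F] {μ : Measure E} {ν : Measure F}
    [SFinite μ] [SFinite ν] (hμ : PL μ) (hν : PL ν) : PL (μ.prod ν) := by
  intro f g h hf hg hh s hs hs1 H
  rw [lintegral_prod _ hf.aemeasurable, lintegral_prod _ hg.aemeasurable,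
    lintegral_prod _ hh.aemeasurable]
  refine hμ _ _ _ hf.lintegral_prod_right' hg.lintegral_prod_right' hh.lintegral_prod_right'
    s hs hs1 ?_
  intro x y
  refine hν _ _ _ (hf.comp measurable_prodMk_left) (hg.comp measurable_prodMk_left)
    (hh.comp measurable_prodMk_left) s hs hs1 ?_
  intro a b
  exact H (x, a) (y, b)

lemma PL_fin (hR : PL (volume : Measure ℝ)) (n : ℕ) : PL (volume : Measure (Fin n → ℝ)) := by
  induction n with
  | zero =>
    intro f g h hf hg hh s hs hs1 H
    have hv : (volume : Measure (Fin 0 → ℝ)) = Measure.dirac default := by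
      rw [volume_pi, Measure.pi_of_empty]
      congr 1
      exact Subsingleton.elim _ _
    rw [hv, lintegral_dirac, lintegral_dirac, lintegral_dirac]
    convert H default default
  | succ n ih =>
    intro f g h hf hg hh s hs hs1 H
    have e := (volume_preserving_piFinSuccAbove (fun _ : Fin (n+1) => ℝ) 0).symm
    have P := hR.prod ih
    have me := (MeasurableEquiv.piFinSuccAbove (fun _ : Fin (n+1) => ℝ) 0).symm.measurable
    rw [← e.lintegral_comp hf, ← e.lintegral_comp hg, ← e.lintegral_comp hh]
    refine P _ _ _ (hf.comp me) (hg.comp me) (hh.comp me) s hs hs1 ?_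
    intro x y
    refine (H _ _).trans (le_of_eq ?_)
    congr 1
    funext i
    refine Fin.cases ?_ (fun i => ?_) i <;>
    simp [MeasurableEquiv.piFinSuccAbove, Fin.insertNthEquiv]

lemma amgm (a b : ℝ≥0∞) (s : ℝ) (hs : 0 < s) (hs1 : s < 1) :
    a ^ s * b ^ (1 - s) ≤ ENNReal.ofReal s * a + ENNReal.ofReal (1 - s) * b := by
  have h1 : 0 < 1 - s := by linarith
  by_cases ha : a = ⊤
  · subst ha; rw [ENNReal.mul_top (by simpa using hs)]; simp
  by_cases hb : b = ⊤
  · subst hb; rw [ENNReal.mul_top (by simpa using hs1)]; simp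
  lift a to NNReal using ha
  lift b to NNReal using hb
  have := NNReal.geom_mean_le_arith_mean2_weighted ⟨s, hs.le⟩ ⟨1 - s, h1.le⟩ a b
    (by apply NNReal.eq; show s + (1 - s) = 1; ring)
  rw [← ENNReal.coe_rpow_of_nonneg _ hs.le, ← ENNReal.coe_rpow_of_nonneg _ h1.le]
  rw [ENNReal.ofReal_eq_coe_nnreal hs.le, ENNReal.ofReal_eq_coe_nnreal h1.le]
  exact_mod_cast this

lemma vol_add_compact {A B C : Set ℝ} (hA : IsCompact A) (hB : IsCompact B) (nA : A.Nonempty)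
    (nB : B.Nonempty) (H : ∀ a ∈ A, ∀ b ∈ B, a + b ∈ C) :
    volume A + volume B ≤ volume C := by
  obtain ⟨a, ha, ha'⟩ := hA.exists_isGreatest nA
  obtain ⟨b, hb, hb'⟩ := hB.exists_isLeast nB
  have h1 : volume A = volume ((fun x => x + b) '' A) := by
    simp
  have h2 : volume B = volume ((fun x => a + x) '' B) := by
    simp
  rw [h1, h2]
  have : volume (((fun x => x + b) '' A) ∩ ((fun x => a + x) '' B)) = 0 := by
    refine measure_mono_null (t := {a + b}) ?_ (by simp)
    rintro z ⟨⟨x, hx, rfl⟩, ⟨y, hy, hxy⟩⟩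
    have := ha' hx
    have := hb' hy
    simp only [Set.mem_singleton_iff]
    simp only at hxy ⊢
    linarith
  have mB : MeasurableSet ((fun x => a + x) '' B) :=
    (hB.image (by fun_prop)).isClosed.measurableSet
  rw [← measure_union_add_inter _ mB, this, add_zero]
  apply measure_mono
  rintro z (⟨x, hx, rfl⟩ | ⟨x, hx, rfl⟩)
  · exact H _ hx _ hb
  · exact H _ ha _ hx

lemma vol_combo {A B C : Set ℝ} (hA : MeasurableSet A) (hB : MeasurableSet B) (nA : A.Nonempty)
    (nB : B.Nonempty) (s : ℝ) (hs : 0 < s) (hs1 : s < 1)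
    (H : ∀ a ∈ A, ∀ b ∈ B, s * a + (1 - s) * b ∈ C) :
    ENNReal.ofReal s * volume A + ENNReal.ofReal (1 - s) * volume B ≤ volume C := by
  have h1 : 0 < 1 - s := by linarith
  have key : ∀ K L : Set ℝ, K ⊆ A → L ⊆ B → IsCompact K → IsCompact L → 
      ENNReal.ofReal s * volume K + ENNReal.ofReal (1 - s) * volume L ≤ volume C := by
    have main : ∀ K L : Set ℝ, K ⊆ A → L ⊆ B → IsCompact K → IsCompact L → K.Nonempty → L.Nonempty →
      ENNReal.ofReal s * volume K + ENNReal.ofReal (1 - s) * volume L ≤ volume C := by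
      intro K L hK hL cK cL nK nL
      have := vol_add_compact (A := (fun x => s * x) '' K) (B := (fun x => (1 - s) * x) '' L) (C := C)
        (cK.image (by fun_prop)) (cL.image (by fun_prop)) (nK.image _) (nL.image _) (by
          rintro _ ⟨a, ha, rfl⟩ _ ⟨b, hb, rfl⟩
          exact H _ (hK ha) _ (hL hb))
      have e1 : volume ((fun x => s * x) '' K) = ENNReal.ofReal s * volume K := by
        have := Measure.addHaar_smul (volume : Measure ℝ) s K
        simpa [abs_of_pos hs, ← Set.image_smul] using this
      have e2 : volume ((fun x => (1 - s) * x) '' L) = ENNReal.ofReal (1 - s) * volume L := by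
        have := Measure.addHaar_smul (volume : Measure ℝ) (1 - s) L
        simpa [abs_of_pos h1, ← Set.image_smul] using this
      rwa [e1, e2] at this
    intro K L hK hL cK cL
    obtain ⟨a, ha⟩ := nA
    obtain ⟨b, hb⟩ := nB
    refine le_trans ?_ (main (insert a K) (insert b L) (Set.insert_subset ha hK)
      (Set.insert_subset hb hL) (cK.insert a) (cL.insert b) (by simp) (by simp))
    gcongr <;> simp
  have hsup : ∀ (A : Set ℝ) (c : ℝ≥0∞), MeasurableSet A →
      c * volume A = ⨆ K : {K : Set ℝ // K ⊆ A ∧ IsCompact K}, c * volume K.1 := by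
    intro A c hA
    rw [hA.measure_eq_iSup_isCompact]
    simp only [ENNReal.mul_iSup, iSup_subtype, iSup_and]
  rw [hsup A _ hA, hsup B _ hB]
  have : ∀ A : Set ℝ, Nonempty {K : Set ℝ // K ⊆ A ∧ IsCompact K} :=
    fun A => ⟨⟨∅, by simp⟩⟩
  exact ENNReal.iSup_add_iSup_le fun K L => key K.1 L.1 K.2.1 L.2.1 K.2.2 L.2.2

lemma layer (f : ℝ → ℝ≥0∞) (hf : Measurable f) :
    ∫⁻ x, f x = ∫⁻ t in Set.Ioi (0:ℝ), volume {x | ENNReal.ofReal t < f x} := by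
  have hm : MeasurableSet {p : ℝ × ℝ | ENNReal.ofReal p.1 < f p.2} :=
    measurableSet_lt (by fun_prop) (by fun_prop)
  have h1 : ∀ t : ℝ, volume {x | ENNReal.ofReal t < f x} =
      ∫⁻ x, {p : ℝ × ℝ | ENNReal.ofReal p.1 < f p.2}.indicator 1 (t, x) := by
    intro t
    have := lintegral_indicator_one (μ := volume)
      (hm.preimage (measurable_prodMk_left (x := t)))
    exact this.symm
  simp_rw [h1]
  rw [lintegral_lintegral_swap]
  · congr 1
    funext x
    have : ∫⁻ t in Set.Ioi (0:ℝ), {p : ℝ × ℝ | ENNReal.ofReal p.1 < f p.2}.indicator 1 (t, x)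
       = volume ({t : ℝ | ENNReal.ofReal t < f x} ∩ Set.Ioi 0) := by
      have mm := hm.preimage (measurable_prodMk_right (y := x))
      have h2 := lintegral_indicator_one (μ := volume.restrict (Set.Ioi (0:ℝ))) mm
      rw [Measure.restrict_apply mm] at h2
      exact h2
    rw [this]
    by_cases hx : f x = ⊤
    · simp [hx]
    · have : {t : ℝ | ENNReal.ofReal t < f x} ∩ Set.Ioi 0 = Set.Ioo 0 (f x).toReal := by
        ext t
        simp only [Set.mem_inter_iff, Set.mem_ofPred_eq, Set.mem_Ioi, Set.mem_Ioo]
        constructor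
        · rintro ⟨h, h0⟩
          exact ⟨h0, (ENNReal.ofReal_lt_iff_lt_toReal h0.le hx).1 h⟩
        · rintro ⟨h0, h⟩
          exact ⟨(ENNReal.ofReal_lt_iff_lt_toReal h0.le hx).2 h, h0⟩
      rw [this, Real.volume_Ioo]; simp [hx]
  · exact ((measurable_one.indicator hm)).aemeasurable

lemma PL_norm (f g h : ℝ → ℝ≥0∞) (hf : Measurable f) (hg : Measurable g) (hh : Measurable h)
    (s : ℝ) (hs : 0 < s) (hs1 : s < 1)
    (H : ∀ x y, f x ^ s * g y ^ (1 - s) ≤ h (s * x + (1 - s) * y))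
    (sf : ⨆ x, f x = 1) (sg : ⨆ x, g x = 1) :
    (∫⁻ x, f x) ^ s * (∫⁻ x, g x) ^ (1 - s) ≤ ∫⁻ x, h x := by
  have h1 : 0 < 1 - s := by linarith
  refine (amgm _ _ s hs hs1).trans ?_
  rw [layer f hf, layer g hg, layer h hh]
  have mes : ∀ f : ℝ → ℝ≥0∞, Measurable fun t : ℝ => volume {x | ENNReal.ofReal t < f x} := by
    intro f
    refine Antitone.measurable ?_
    intro a b hab
    apply measure_mono
    intro x hx
    exact lt_of_le_of_lt (ENNReal.ofReal_le_ofReal hab) hx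
  rw [← lintegral_const_mul _ (mes f), ← lintegral_const_mul _ (mes g),
    ← lintegral_add_left ((mes f).const_mul _)]
  refine setLIntegral_mono (mes h) ?_
  intro t ht
  by_cases ht1 : t < 1
  · have lt1 : ENNReal.ofReal t < 1 := by simpa using ht1
    refine vol_combo (measurableSet_lt measurable_const hf) (measurableSet_lt measurable_const hg)
      ?_ ?_ s hs hs1 ?_
    · rw [← sf] at lt1
      exact lt_iSup_iff.1 lt1
    · rw [← sg] at lt1
      exact lt_iSup_iff.1 lt1
    · intro a ha b hb
      refine lt_of_lt_of_le ?_ (H a b)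
      have e : ENNReal.ofReal t = ENNReal.ofReal t ^ s * ENNReal.ofReal t ^ (1 - s) := by
        rw [← ENNReal.rpow_add _ _ (by simpa using ht) (by simp)]
        simp
      rw [e]
      exact ENNReal.mul_lt_mul (ENNReal.rpow_lt_rpow ha hs) (ENNReal.rpow_lt_rpow hb h1)
  · have : ∀ f : ℝ → ℝ≥0∞, ⨆ x, f x = 1 → volume {x | ENNReal.ofReal t < f x} = 0 := by
      intro f sf
      convert measure_empty (μ := (volume : Measure ℝ))
      ext x
      simp only [Set.mem_ofPred_eq, Set.mem_empty_iff_false, iff_false, not_lt]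
      calc f x ≤ ⨆ x, f x := le_iSup f x
        _ = 1 := sf
        _ ≤ _ := by simpa using ht1
    rw [this f sf, this g sg]; simp

lemma PL_bdd (f g h : ℝ → ℝ≥0∞) (hf : Measurable f) (hg : Measurable g) (hh : Measurable h)
    (s : ℝ) (hs : 0 < s) (hs1 : s < 1)
    (H : ∀ x y, f x ^ s * g y ^ (1 - s) ≤ h (s * x + (1 - s) * y))
    (sf : ⨆ x, f x ≠ ⊤) (sg : ⨆ x, g x ≠ ⊤) :
    (∫⁻ x, f x) ^ s * (∫⁻ x, g x) ^ (1 - s) ≤ ∫⁻ x, h x := by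
  have h1 : 0 < 1 - s := by linarith
  set c := ⨆ x, f x with hc
  set d := ⨆ x, g x with hd
  by_cases c0 : c = 0
  · have : ∀ x, f x = 0 := by
      intro x; exact le_antisymm (c0 ▸ le_iSup f x) bot_le
    simp [this, hs]
  by_cases d0 : d = 0
  · have : ∀ x, g x = 0 := by
      intro x; exact le_antisymm (d0 ▸ le_iSup g x) bot_le
    simp [this, h1]
  have cs0 : c ^ s ≠ 0 := by simp [c0, sf, ENNReal.rpow_eq_zero_iff]
  have cst : c ^ s ≠ ⊤ := by simp [c0, sf, ENNReal.rpow_eq_top_iff]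
  have ds0 : d ^ (1 - s) ≠ 0 := by simp [d0, sg, ENNReal.rpow_eq_zero_iff]
  have dst : d ^ (1 - s) ≠ ⊤ := by simp [d0, sg, ENNReal.rpow_eq_top_iff]
  have alg : ∀ a b : ℝ≥0∞, (c⁻¹ * a) ^ s * (d⁻¹ * b) ^ (1 - s) =
      (c ^ s * d ^ (1 - s))⁻¹ * (a ^ s * b ^ (1 - s)) := by
    intro a b
    rw [ENNReal.mul_rpow_of_nonneg _ _ hs.le, ENNReal.mul_rpow_of_nonneg _ _ h1.le,
      ENNReal.mul_inv (Or.inl cs0) (Or.inl cst), ENNReal.inv_rpow, ENNReal.inv_rpow]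
    ring
  have := PL_norm (fun x => c⁻¹ * f x) (fun x => d⁻¹ * g x)
    (fun x => (c ^ s * d ^ (1 - s))⁻¹ * h x) (hf.const_mul _) (hg.const_mul _) (hh.const_mul _)
    s hs hs1 (by
      intro x y
      simp only [alg]
      gcongr
      exact H x y) (by
      rw [← ENNReal.mul_iSup]; exact ENNReal.inv_mul_cancel c0 sf) (by
      rw [← ENNReal.mul_iSup]; exact ENNReal.inv_mul_cancel d0 sg)
  rw [lintegral_const_mul _ hf, lintegral_const_mul _ hg, lintegral_const_mul _ hh, alg] at this
  rwa [ENNReal.mul_le_mul_iff_right] at this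
  · simp only [ne_eq, ENNReal.inv_eq_zero]; exact ENNReal.mul_ne_top cst dst
  · simp only [ne_eq, ENNReal.inv_eq_top]; exact mul_ne_zero cs0 ds0

lemma trunc_tendsto (f : ℝ → ℝ≥0∞) (hf : Measurable f) :
    Filter.Tendsto (fun N : ℕ => ∫⁻ x, min (f x) N) Filter.atTop (nhds (∫⁻ x, f x)) := by
  refine lintegral_tendsto_of_tendsto_of_monotone (fun N => (hf.min measurable_const).aemeasurable)
    (Filter.Eventually.of_forall fun x => ?_) (Filter.Eventually.of_forall fun x => ?_)
  · intro a b hab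
    simp only
    gcongr
  · have := (tendsto_const_nhds (x := f x)).min ENNReal.tendsto_nat_nhds_top
    simpa using this

lemma PL_real : PL (volume : Measure ℝ) := by
  intro f g h hf hg hh s hs hs1 H
  have h1 : 0 < 1 - s := by linarith
  by_cases f0 : ∫⁻ x, f x = 0
  · simp [f0, hs]
  by_cases g0 : ∫⁻ x, g x = 0
  · simp [g0, h1]
  refine le_of_tendsto (ENNReal.Tendsto.mul ((ENNReal.continuous_rpow_const (y := s)).tendsto _ |>.comp
    (trunc_tendsto f hf)) (Or.inl ?_) ((ENNReal.continuous_rpow_const (y := 1 - s)).tendsto _ |>.comp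
    (trunc_tendsto g hg)) (Or.inl ?_)) (Filter.Eventually.of_forall fun N => ?_)
  · simp [ENNReal.rpow_eq_zero_iff, f0, hs.le, hs.not_gt]
  · simp [ENNReal.rpow_eq_zero_iff, g0, h1.le, h1.not_gt]
  · have bd : ∀ f : ℝ → ℝ≥0∞, ⨆ x, min (f x) (N : ℝ≥0∞) ≠ ⊤ := fun f =>
      ne_top_of_le_ne_top (ENNReal.natCast_ne_top N) (iSup_le fun x => min_le_right _ _)
    refine PL_bdd _ _ h (hf.min measurable_const) (hg.min measurable_const) hh s hs hs1 ?_
      (bd f) (bd g)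
    intro x y
    refine le_trans ?_ (H x y)
    gcongr <;> exact min_le_left _ _

lemma LC_finite (G : ℝ → ℝ≥0∞) (hG : Measurable G) (h0 : ∫⁻ x, G x ≠ 0) (ht : ∫⁻ x, G x ≠ ⊤)
    (H : ∀ s : ℝ, 0 < s → s < 1 → ∀ x y, G x ^ s * G y ^ (1 - s) ≤ G (s * x + (1 - s) * y)) (t : ℝ) :
    G t ≠ ⊤ := by
  intro htop
  have : ∃ u, u ≠ t ∧ G u ≠ 0 := by
    by_contra! hc
    apply h0
    rw [lintegral_eq_zero_iff hG]
    have : ∀ᵐ x : ℝ, x ≠ t := by simp [ae_iff]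
    filter_upwards [this] with x hx
    exact hc x hx
  obtain ⟨u, hut, hu⟩ := this
  have hae := ae_lt_top hG ht
  rw [ae_iff] at hae
  have hsub : Set.Ioo (min t u) (max t u) ⊆ {x | ¬ G x < ⊤} := by
    rw [← openSegment_eq_Ioo' hut.symm]
    rintro _ ⟨a, b, ha, hb, hab, rfl⟩
    obtain rfl : b = 1 - a := by linarith
    have := H a ha (by linarith) t u
    rw [htop, ENNReal.top_rpow_of_pos ha, ENNReal.top_mul] at this
    · simpa using this
    · simp only [ne_eq, ENNReal.rpow_eq_zero_iff, hu, false_and, false_or, not_and, not_lt]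
      intro _; exact hb.le
  have := measure_mono_null hsub hae
  rw [Real.volume_Ioo] at this
  simp only [ENNReal.ofReal_eq_zero] at this
  have : min t u < max t u := by simpa using hut
  linarith

lemma marginal {m : ℕ} (f : (Fin (m + 1) → ℝ) → ℝ≥0∞) (hf : Measurable f)
    (h0 : ∫⁻ x, f x ≠ 0) (ht : ∫⁻ x, f x ≠ ⊤)
    (H : ∀ s : ℝ, 0 < s → s < 1 → ∀ x y, f x ^ s * f y ^ (1 - s) ≤ f (s • x + (1 - s) • y))
    (k : Fin (m + 1)) (c : (Fin m → ℝ) →ₗ[ℝ] ℝ) :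
    ∃ g : ℝ → ℝ, (∀ t, 0 ≤ g t) ∧
      (volume.withDensity f).map (fun x => x k - c (fun i => x (k.succAbove i))) =
        volume.withDensity (fun t => ENNReal.ofReal (g t)) ∧
      (∀ t u s : ℝ, 0 ≤ s → s ≤ 1 →
        g t ^ s * g u ^ (1 - s) ≤ g (s * t + (1 - s) * u)) := by
  have hc : Measurable c := c.continuous_of_finiteDimensional.measurable
  have mphi : Measurable (fun x : Fin (m+1) → ℝ => x k - c (fun i => x (k.succAbove i))) := by
    refine (measurable_pi_apply k).sub (hc.comp ?_)
    exact measurable_pi_lambda _ fun i => measurable_pi_apply _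
  let e := (MeasurableEquiv.piFinSuccAbove (fun _ : Fin (m+1) => ℝ) k).symm
  have he : MeasurePreserving e := (volume_preserving_piFinSuccAbove (fun _ : Fin (m+1) => ℝ) k).symm
  have he_apply : ∀ p, e p = k.insertNth p.1 p.2 := fun p => rfl
  let F : ℝ → (Fin m → ℝ) → ℝ≥0∞ := fun t y => f (e (t + c y, y))
  have mF : Measurable (fun p : ℝ × (Fin m → ℝ) => F p.1 p.2) := by
    refine hf.comp (e.measurable.comp ?_)
    exact (measurable_fst.add (hc.comp measurable_snd)).prodMk measurable_snd
  let G : ℝ → ℝ≥0∞ := fun t => ∫⁻ y, F t y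
  have mG : Measurable G := mF.lintegral_prod_right'
  have key : ∀ A : Set ℝ, MeasurableSet A →
      ∫⁻ x in (fun x : Fin (m+1) → ℝ => x k - c (fun i => x (k.succAbove i))) ⁻¹' A, f x
        = ∫⁻ t in A, G t := by
    intro A hA
    rw [← lintegral_indicator (mphi hA), ← lintegral_indicator hA]
    have mi := hf.indicator (mphi hA)
    have me : Measurable (fun p => ((fun x : Fin (m+1) → ℝ =>
      x k - c (fun i => x (k.succAbove i))) ⁻¹' A).indicator f (e p)) := mi.comp e.measurable
    rw [← he.lintegral_comp mi, Measure.volume_eq_prod, lintegral_prod_symm _ me.aemeasurable]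
    have : ∀ y : Fin m → ℝ, ∫⁻ t : ℝ, ((fun x : Fin (m+1) → ℝ => x k - c (fun i => x (k.succAbove i))) ⁻¹' A).indicator f (e (t, y))
        = ∫⁻ t : ℝ, A.indicator (fun t => F t y) t := by
      intro y
      rw [← lintegral_add_right_eq_self _ (c y)]
      refine lintegral_congr fun t => ?_
      have hiff : e (t + c y, y) ∈ ((fun x : Fin (m+1) → ℝ =>
          x k - c (fun i => x (k.succAbove i))) ⁻¹' A) ↔ t ∈ A := by
        simp [he_apply]
      by_cases h : t ∈ A
      · rw [Set.indicator_of_mem h, Set.indicator_of_mem (hiff.2 h)]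
      · rw [Set.indicator_of_notMem h, Set.indicator_of_notMem (fun h' => h (hiff.1 h'))]
    simp_rw [this]
    rw [lintegral_lintegral_swap]
    · congr 1
      funext t
      by_cases hA : t ∈ A <;> simp [hA, G]
    · have : Measurable (fun p : (Fin m → ℝ) × ℝ => A.indicator (fun t => F t p.1) p.2) := by
        have h2 := (mF.comp measurable_swap).indicator (measurable_snd (α := Fin m → ℝ) hA)
        exact h2
      exact this.aemeasurable
  have tot : ∫⁻ x, f x = ∫⁻ t, G t := by
    simpa using key Set.univ MeasurableSet.univ
  rw [tot] at h0 ht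
  have LG : ∀ s : ℝ, 0 < s → s < 1 → ∀ x y, G x ^ s * G y ^ (1 - s) ≤ G (s * x + (1 - s) * y) := by
    intro s hs hs1 x y
    refine PL_fin PL_real m _ _ _ (mF.comp measurable_prodMk_left) (mF.comp measurable_prodMk_left)
      (mF.comp measurable_prodMk_left) s hs hs1 ?_
    intro a b
    refine (H s hs hs1 _ _).trans (le_of_eq ?_)
    simp only [F]
    congr 1
    simp only [he_apply]
    funext i
    refine Fin.succAboveCases k ?_ (fun i => ?_) i
    · simp; ring
    · simp
  have fin := LC_finite G mG h0 ht LG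
  refine ⟨fun t => (G t).toReal, fun t => ENNReal.toReal_nonneg, ?_, ?_⟩
  · simp only [ENNReal.ofReal_toReal (fin _)]
    ext A hA
    rw [Measure.map_apply mphi hA, withDensity_apply _ (mphi hA), withDensity_apply _ hA, key A hA]
  · intro t u s hs hs1
    rcases hs.eq_or_lt with rfl | hs
    · simp
    rcases hs1.eq_or_lt with rfl | hs1
    · simp
    have := ENNReal.toReal_mono (fin _) (LG s hs hs1 t u)
    rwa [ENNReal.toReal_mul, ← ENNReal.toReal_rpow, ← ENNReal.toReal_rpow] at this

lemma expNeg_nonneg (t : EReal) : 0 ≤ expNeg t := by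
  unfold expNeg; split_ifs <;> positivity

lemma expNeg_LC (β : ℝ) (hβ : 0 < β) (V : ℝ → EReal) (hVbot : ∀ x, V x ≠ ⊥)
    (hVconv : ∀ x y s : ℝ, 0 ≤ s → s ≤ 1 →
      V (s * x + (1 - s) * y) ≤ (s : EReal) * V x + ((1 - s : ℝ) : EReal) * V y)
    (s : ℝ) (hs : 0 < s) (hs1 : s < 1) (x y : ℝ) :
    expNeg (β * V x) ^ s * expNeg (β * V y) ^ (1 - s) ≤ expNeg (β * V (s * x + (1 - s) * y)) := by
  have h1 : 0 < 1 - s := by linarith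
  have htop : expNeg ((β : EReal) * ⊤) = 0 := by
    rw [EReal.coe_mul_top_of_pos hβ]; simp [expNeg]
  have hreal : ∀ v : ℝ, expNeg ((β : EReal) * (v : EReal)) = Real.exp (-(β * v)) := by
    intro v
    rw [← EReal.coe_mul]
    unfold expNeg
    rw [if_neg (EReal.coe_ne_top _), if_neg (EReal.coe_ne_bot _), EReal.toReal_coe]
  by_cases hx : V x = ⊤
  · rw [hx, htop, Real.zero_rpow hs.ne', zero_mul]; exact expNeg_nonneg _
  by_cases hy : V y = ⊤
  · rw [hy, htop, Real.zero_rpow h1.ne', mul_zero]; exact expNeg_nonneg _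
  have hc := hVconv x y s hs.le hs1.le
  have hb := hVbot (s * x + (1 - s) * y)
  have hbx := hVbot x
  have hby := hVbot y
  generalize V (s * x + (1 - s) * y) = c at *
  generalize V x = a at *
  generalize V y = b at *
  lift a to ℝ using ⟨hx, hbx⟩
  lift b to ℝ using ⟨hy, hby⟩
  have hct : c ≠ ⊤ := by
    rintro rfl
    rw [← EReal.coe_mul, ← EReal.coe_mul, ← EReal.coe_add] at hc
    exact absurd hc (not_le.2 (EReal.coe_lt_top _))
  lift c to ℝ using ⟨hct, hb⟩
  have hc' : c ≤ s * a + (1 - s) * b := by exact_mod_cast hc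
  rw [hreal, hreal, hreal, ← Real.exp_mul, ← Real.exp_mul, ← Real.exp_add]
  apply Real.exp_le_exp.2
  nlinarith [mul_le_mul_of_nonneg_left hc' hβ.le]

lemma LC_measurable (f : ℝ → ℝ) (h0 : ∀ x, 0 ≤ f x)
    (H : ∀ s : ℝ, 0 < s → s < 1 → ∀ x y, f x ^ s * f y ^ (1 - s) ≤ f (s * x + (1 - s) * y)) :
    Measurable f := by
  refine measurable_of_Ioi fun a => ?_
  refine Set.OrdConnected.measurableSet (Convex.ordConnected (𝕜 := ℝ) ?_)
  rw [convex_iff_forall_pos]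
  intro x hx y hy p q hp hq hpq
  obtain rfl : q = 1 - p := by linarith
  simp only [Set.mem_preimage, Set.mem_Ioi] at *
  rcases lt_or_ge a 0 with ha | ha
  · exact ha.trans_le (h0 _)
  refine lt_of_lt_of_le ?_ (H p hp (by linarith) x y)
  have hm : a < min (f x) (f y) := lt_min hx hy
  have hm0 : 0 < min (f x) (f y) := ha.trans_lt hm
  calc a < min (f x) (f y) := hm
    _ = min (f x) (f y) ^ p * min (f x) (f y) ^ (1 - p) := by
      rw [← Real.rpow_add hm0]; simp
    _ ≤ _ := by
      exact mul_le_mul (Real.rpow_le_rpow hm0.le (min_le_left _ _) hp.le)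
        (Real.rpow_le_rpow hm0.le (min_le_right _ _) hq.le) (Real.rpow_nonneg hm0.le _)
        (Real.rpow_nonneg (h0 x) _)

lemma density_nonneg (n : ℕ) (β : ℝ) (V : ℝ → EReal) (x : Fin n → ℝ) :
    0 ≤ coulombDensity n β V x := by
  unfold coulombDensity
  split_ifs with h
  · refine mul_nonneg (Finset.prod_nonneg fun i _ => Finset.prod_nonneg fun j _ => ?_)
      (Finset.prod_nonneg fun i _ => expNeg_nonneg _)
    split_ifs with hij
    · exact Real.rpow_nonneg (sub_nonneg.2 (h hij).le) _
    · exact zero_le_one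
  · exact le_rfl

lemma density_measurable (n : ℕ) (β : ℝ) (hβ : 0 < β) (V : ℝ → EReal) (hVbot : ∀ x, V x ≠ ⊥)
    (hVconv : ∀ x y s : ℝ, 0 ≤ s → s ≤ 1 →
      V (s * x + (1 - s) * y) ≤ (s : EReal) * V x + ((1 - s : ℝ) : EReal) * V y) :
    Measurable (coulombDensity n β V) := by
  have hm : Measurable fun x => expNeg (β * V x) :=
    LC_measurable _ (fun _ => expNeg_nonneg _) (expNeg_LC β hβ V hVbot hVconv)
  unfold coulombDensity
  refine Measurable.ite ?_ ?_ measurable_const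
  · have : {x : Fin n → ℝ | StrictMono x} = ⋂ i, ⋂ j, ⋂ (_ : i < j), {x | x i < x j} := by
      ext x; simp [StrictMono]
    rw [this]
    refine MeasurableSet.iInter fun i => MeasurableSet.iInter fun j => MeasurableSet.iInter fun _ =>
      measurableSet_lt (measurable_pi_apply i) (measurable_pi_apply j)
  · refine Measurable.mul (Finset.measurable_prod _ fun i _ => Finset.measurable_prod _ fun j _ => ?_)
      (Finset.measurable_prod _ fun i _ => hm.comp (measurable_pi_apply i))
    split_ifs
    · exact ((measurable_pi_apply j).sub (measurable_pi_apply i)).pow_const β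
    · exact measurable_const

lemma density_LC (n : ℕ) (β : ℝ) (hβ : 0 < β) (V : ℝ → EReal) (hVbot : ∀ x, V x ≠ ⊥)
    (hVconv : ∀ x y s : ℝ, 0 ≤ s → s ≤ 1 →
      V (s * x + (1 - s) * y) ≤ (s : EReal) * V x + ((1 - s : ℝ) : EReal) * V y)
    (s : ℝ) (hs : 0 < s) (hs1 : s < 1) (x y : Fin n → ℝ) :
    coulombDensity n β V x ^ s * coulombDensity n β V y ^ (1 - s) ≤
      coulombDensity n β V (s • x + (1 - s) • y) := by
  have h1 : 0 < 1 - s := by linarith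
  by_cases hx : StrictMono x
  swap
  · have : coulombDensity n β V x = 0 := by simp [coulombDensity, hx]
    rw [this, Real.zero_rpow hs.ne', zero_mul]; exact density_nonneg _ _ _ _
  by_cases hy : StrictMono y
  swap
  · have : coulombDensity n β V y = 0 := by simp [coulombDensity, hy]
    rw [this, Real.zero_rpow h1.ne', mul_zero]; exact density_nonneg _ _ _ _
  have hz : StrictMono (s • x + (1 - s) • y) := by
    intro i j hij
    have := mul_lt_mul_of_pos_left (hx hij) hs
    have := mul_lt_mul_of_pos_left (hy hij) h1
    simp only [Pi.add_apply, Pi.smul_apply, smul_eq_mul]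
    linarith
  have fac : ∀ x : Fin n → ℝ, StrictMono x → ∀ i j : Fin n,
      0 ≤ if i < j then (x j - x i) ^ β else 1 := by
    intro x hx i j
    split_ifs with hij
    · exact Real.rpow_nonneg (sub_nonneg.2 (hx hij).le) _
    · exact zero_le_one
  have fac2 : ∀ x : Fin n → ℝ, StrictMono x →
      0 ≤ ∏ i : Fin n, ∏ j : Fin n, if i < j then (x j - x i) ^ β else 1 := fun x hx =>
    Finset.prod_nonneg fun i _ => Finset.prod_nonneg fun j _ => fac x hx i j
  have fac3 : ∀ x : Fin n → ℝ, 0 ≤ ∏ i : Fin n, expNeg ((β : EReal) * V (x i)) := fun x =>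
    Finset.prod_nonneg fun i _ => expNeg_nonneg _
  simp only [coulombDensity, if_pos hx, if_pos hy, if_pos hz]
  rw [Real.mul_rpow (fac2 x hx) (fac3 x), Real.mul_rpow (fac2 y hy) (fac3 y), mul_mul_mul_comm]
  refine mul_le_mul ?_ ?_ (mul_nonneg (Real.rpow_nonneg (fac3 x) _) (Real.rpow_nonneg (fac3 y) _))
    (fac2 _ hz)
  · rw [← Real.finsetProd_rpow _ _ (fun i _ => Finset.prod_nonneg fun j _ => fac x hx i j),
      ← Real.finsetProd_rpow _ _ (fun i _ => Finset.prod_nonneg fun j _ => fac y hy i j),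
      ← Finset.prod_mul_distrib]
    refine Finset.prod_le_prod (fun i _ => mul_nonneg
      (Real.rpow_nonneg (Finset.prod_nonneg fun j _ => fac x hx i j) _)
      (Real.rpow_nonneg (Finset.prod_nonneg fun j _ => fac y hy i j) _)) fun i _ => ?_
    rw [← Real.finsetProd_rpow _ _ (fun j _ => fac x hx i j),
      ← Real.finsetProd_rpow _ _ (fun j _ => fac y hy i j), ← Finset.prod_mul_distrib]
    refine Finset.prod_le_prod (fun j _ => mul_nonneg
      (Real.rpow_nonneg (fac x hx i j) _) (Real.rpow_nonneg (fac y hy i j) _)) fun j _ => ?_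
    split_ifs with hij
    · have ha : 0 ≤ x j - x i := sub_nonneg.2 (hx hij).le
      have hb : 0 ≤ y j - y i := sub_nonneg.2 (hy hij).le
      have am := Real.geom_mean_le_arith_mean2_weighted hs.le h1.le ha hb (by ring)
      rw [← Real.rpow_mul ha, ← Real.rpow_mul hb, mul_comm β, mul_comm β, Real.rpow_mul ha,
        Real.rpow_mul hb, ← Real.mul_rpow (Real.rpow_nonneg ha _) (Real.rpow_nonneg hb _)]
      refine Real.rpow_le_rpow (mul_nonneg (Real.rpow_nonneg ha _) (Real.rpow_nonneg hb _))
        (am.trans (le_of_eq ?_)) hβ.le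
      simp only [Pi.add_apply, Pi.smul_apply, smul_eq_mul]
      ring
    · simp
  · rw [← Real.finsetProd_rpow _ _ (fun i _ => expNeg_nonneg _),
      ← Real.finsetProd_rpow _ _ (fun i _ => expNeg_nonneg _), ← Finset.prod_mul_distrib]
    refine Finset.prod_le_prod (fun i _ => mul_nonneg
      (Real.rpow_nonneg (expNeg_nonneg _) _) (Real.rpow_nonneg (expNeg_nonneg _) _)) fun i _ => ?_
    exact expNeg_LC β hβ V hVbot hVconv s hs hs1 (x i) (y i)

lemma coulomb_aux (m : ℕ) (β : ℝ) (hβ : 0 < β) (V : ℝ → EReal)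
    (hVbot : ∀ x, V x ≠ ⊥)
    (hVconv : ∀ x y s : ℝ, 0 ≤ s → s ≤ 1 →
      V (s * x + (1 - s) * y) ≤ (s : EReal) * V x + ((1 - s : ℝ) : EReal) * V y)
    (hInt : Integrable (coulombDensity (m + 1) β V))
    (hZ : 0 < ∫ x : Fin (m + 1) → ℝ, coulombDensity (m + 1) β V x)
    (k : Fin (m + 1)) (c : (Fin m → ℝ) →ₗ[ℝ] ℝ) :
    ∃ g : ℝ → ℝ, (∀ t, 0 ≤ g t) ∧
      (coulombMeasure (m + 1) β V).map (fun x => x k - c (fun i => x (k.succAbove i))) =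
        volume.withDensity (fun t => ENNReal.ofReal (g t)) ∧
      (∀ t u s : ℝ, 0 ≤ s → s ≤ 1 →
        g t ^ s * g u ^ (1 - s) ≤ g (s * t + (1 - s) * u)) := by
  unfold coulombMeasure
  set Z := ∫ x : Fin (m + 1) → ℝ, coulombDensity (m + 1) β V x with hZd
  have tot : ∫⁻ x, ENNReal.ofReal (coulombDensity (m + 1) β V x / Z) = 1 := by
    rw [← ofReal_integral_eq_lintegral_ofReal (hInt.div_const Z)
      (Filter.Eventually.of_forall fun x => div_nonneg (density_nonneg _ _ _ _) hZ.le),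
      integral_div, ← hZd, div_self hZ.ne', ENNReal.ofReal_one]
  refine marginal _ ?_ ?_ ?_ ?_ k c
  · exact ((density_measurable _ β hβ V hVbot hVconv).div_const Z).ennreal_ofReal
  · rw [tot]; simp
  · rw [tot]; simp
  · intro s hs hs1 x y
    have h1 : 0 < 1 - s := by linarith
    have dx := density_nonneg (m + 1) β V x
    have dy := density_nonneg (m + 1) β V y
    rw [ENNReal.ofReal_rpow_of_nonneg (div_nonneg dx hZ.le) hs.le,
      ENNReal.ofReal_rpow_of_nonneg (div_nonneg dy hZ.le) h1.le,
      ← ENNReal.ofReal_mul (Real.rpow_nonneg (div_nonneg dx hZ.le) _)]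
    apply ENNReal.ofReal_le_ofReal
    rw [Real.div_rpow dx hZ.le, Real.div_rpow dy hZ.le, div_mul_div_comm, ← Real.rpow_add hZ]
    rw [add_sub_cancel, Real.rpow_one]
    exact div_le_div_of_nonneg_right (density_LC _ β hβ V hVbot hVconv s hs hs1 x y) hZ.le

/-- For a convex potential `V : ℝ → ℝ ∪ {∞}` (with finite positive normalizing
constant), each ordered point `x_k` of the β-Coulomb gas has a log-concave
distribution on ℝ, and so does each gap `x_k − x_{k-1}`. -/
theorem logConcave_points_and_gaps_coulomb_gas
    (n : ℕ) (hn : 1 ≤ n) (β : ℝ) (hβ : 0 < β) (V : ℝ → EReal)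
    (hVbot : ∀ x, V x ≠ ⊥)
    (hVconv : ∀ x y s : ℝ, 0 ≤ s → s ≤ 1 →
      V (s * x + (1 - s) * y) ≤ (s : EReal) * V x + ((1 - s : ℝ) : EReal) * V y)
    (hInt : Integrable (coulombDensity n β V))
    (hZ : 0 < ∫ x : Fin n → ℝ, coulombDensity n β V x) :
    (∀ k : Fin n, ∃ g : ℝ → ℝ, (∀ t, 0 ≤ g t) ∧
      (coulombMeasure n β V).map (fun x => x k) =
        volume.withDensity (fun t => ENNReal.ofReal (g t)) ∧
      (∀ t u s : ℝ, 0 ≤ s → s ≤ 1 →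
        g t ^ s * g u ^ (1 - s) ≤ g (s * t + (1 - s) * u))) ∧
    (∀ k l : Fin n, (l : ℕ) + 1 = (k : ℕ) → ∃ g : ℝ → ℝ, (∀ t, 0 ≤ g t) ∧
      (coulombMeasure n β V).map (fun x => x k - x l) =
        volume.withDensity (fun t => ENNReal.ofReal (g t)) ∧
      (∀ t u s : ℝ, 0 ≤ s → s ≤ 1 →
        g t ^ s * g u ^ (1 - s) ≤ g (s * t + (1 - s) * u))) := by
  obtain ⟨m, rfl⟩ : ∃ m, n = m + 1 := ⟨n - 1, by omega⟩
  constructor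
  · intro k
    simpa using coulomb_aux m β hβ V hVbot hVconv hInt hZ k 0
  · intro k l hkl
    have hne : l ≠ k := by rintro rfl; omega
    obtain ⟨j, rfl⟩ := Fin.exists_succAbove_eq hne
    exact coulomb_aux m β hβ V hVbot hVconv hInt hZ k (LinearMap.proj j)
end
end

section
/- Fix α > 0 and β > 0. For q ∈ (0,1), let γ_{n,q,β} be the probability measure on partitions with at most n rows obtained from the discrete ensemble on {h ∈ ℕ^n : h_1 < ⋯ < h_n} with probability proportional to ∏_{1≤i<j≤n}(h_j − h_i)^β · ∏_{j=1}^n q^{h_j}, via the bijection λ_i = h_{n+1−i} − (n−i). Then, as n → ∞, the measures γ_{n, α/n^β, β} converge in distribution to the mixed measure M^(α,β): for every partition λ, γ_{n, α/n^β, β}(λ) → M^(α,β)(λ). -/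
open scoped BigOperators
open Filter

noncomputable section

/-- The number of standard Young tableaux of shape `μ`. -/
def sytCard (μ : YoungDiagram) : ℕ :=
  Nat.card {T : SemistandardYoungTableau μ //
    (∀ c ∈ μ.cells, T c.1 c.2 < μ.card) ∧
    Set.InjOn (fun c : ℕ × ℕ => T c.1 c.2) ↑μ.cells}

/-- Unnormalized weight of a partition under `M^(α,β)`: `α^{|λ|}·(d_λ/|λ|!)^β`. -/
def mixedWeight (α β : ℝ) (μ : YoungDiagram) : ℝ :=
  α ^ μ.card * ((sytCard μ : ℝ) / (Nat.factorial μ.card : ℝ)) ^ β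

/-- `M^(α,β)(λ)`. -/
def mixedProb (α β : ℝ) (μ : YoungDiagram) : ℝ :=
  mixedWeight α β μ / ∑' τ : YoungDiagram, mixedWeight α β τ

/-- The strictly increasing tuple `h` attached to a partition `λ` with at most `n`
rows by the bijection `λ_i = h_{n+1-i} - (n-i)` (`0`-indexed: `h_j = λ_{n-j} + j`). -/
def tupleOf (n : ℕ) (μ : YoungDiagram) (j : Fin n) : ℕ :=
  μ.rowLen (n - 1 - (j : ℕ)) + (j : ℕ)

/-- Unnormalized weight `∏_{i<j}(h_j-h_i)^β · ∏_j q^{h_j}` of a partition with at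
most `n` rows under the ensemble `γ_{n,q,β}`. -/
def gammaWeight (n : ℕ) (q β : ℝ) (μ : YoungDiagram) : ℝ :=
  (∏ i : Fin n, ∏ j : Fin n,
      if i < j then ((tupleOf n μ j : ℝ) - (tupleOf n μ i : ℝ)) ^ β else 1) *
    ∏ j : Fin n, q ^ (tupleOf n μ j)

/-- `γ_{n,q,β}(λ)`: the probability of the partition `λ` (zero unless `λ` has at most
`n` rows). -/
def gammaProb (n : ℕ) (q β : ℝ) (μ : YoungDiagram) : ℝ :=
  if μ.colLen 0 ≤ n then
    gammaWeight n q β μ /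
      ∑' τ : {τ : YoungDiagram // τ.colLen 0 ≤ n}, gammaWeight n q β τ.1
  else 0


theorem aux_det_col_scale {n : ℕ} (A : Matrix (Fin n) (Fin n) ℝ) (c : Fin n → ℝ) :
    ∑ i, (A.updateRow i (fun j => A i j * c j)).det = (∑ j, c j) * A.det := by
  simp only [Matrix.det_apply']
  rw [Finset.sum_comm, Finset.mul_sum]
  refine Finset.sum_congr rfl fun σ _ => ?_
  have key : ∀ i : Fin n, ∏ x, (A.updateRow i (fun j => A i j * c j)) (σ x) x
      = (∏ x, A (σ x) x) * c (σ.symm i) := by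
    intro i
    have : ∀ x, (A.updateRow i (fun j => A i j * c j)) (σ x) x
        = A (σ x) x * (if x = σ.symm i then c x else 1) := by
      intro x
      by_cases h : σ x = i
      · subst h
        simp
      · have h' : x ≠ σ.symm i := fun e => h (by simp [e])
        simp [Matrix.updateRow_apply, h, h']
    rw [Finset.prod_congr rfl (fun x _ => this x), Finset.prod_mul_distrib]
    simp
  simp only [key]
  rw [← Finset.mul_sum, ← Finset.mul_sum, Equiv.sum_comp σ.symm c]
  ring

theorem aux_vand_identity {n : ℕ} (x : Fin n → ℝ) :
    ∑ i, x i * (Matrix.vandermonde (Function.update x i (x i - 1))).det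
      = (∑ i, x i - ∑ j : Fin n, (j : ℝ)) * (Matrix.vandermonde x).det := by
  have hv : ∀ y : Fin n → ℝ, (Matrix.vandermonde y).det =
      (Matrix.of (fun i j : Fin n => (descPochhammer ℝ (j : ℕ)).eval (y i))).det := fun y =>
    Matrix.det_eval_matrixOfPolynomials_eq_det_vandermonde y (fun j => descPochhammer ℝ (j : ℕ))
      (fun i => descPochhammer_natDegree ℝ i) (fun i => monic_descPochhammer ℝ i)
  simp only [hv]
  set A : Matrix (Fin n) (Fin n) ℝ :=
    Matrix.of (fun i j : Fin n => (descPochhammer ℝ (j : ℕ)).eval (x i)) with hA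
  have h1 : ∀ i, x i * (Matrix.of (fun i' j : Fin n =>
      (descPochhammer ℝ (j : ℕ)).eval (Function.update x i (x i - 1) i'))).det
      = x i * A.det - (A.updateRow i (fun j => A i j * (j : ℝ))).det := by
    intro i
    have e1 : (Matrix.of (fun i' j : Fin n =>
      (descPochhammer ℝ (j : ℕ)).eval (Function.update x i (x i - 1) i')))
      = A.updateRow i (fun j => (descPochhammer ℝ (j : ℕ)).eval (x i - 1)) := by
      ext a b
      by_cases h : a = i
      · subst h; simp
      · simp [Matrix.updateRow_apply, h, hA]
    rw [e1, ← Matrix.det_updateRow_smul]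
    have e2 : x i • (fun j : Fin n => (descPochhammer ℝ (j : ℕ)).eval (x i - 1))
        = x i • A i + (-1 : ℝ) • (fun j => A i j * (j : ℝ)) := by
      ext j
      have h3 := descPochhammer_succ_eval (S := ℝ) (j : ℕ) (x i)
      rw [descPochhammer_succ_left] at h3
      simp only [Polynomial.eval_mul, Polynomial.eval_X, Polynomial.eval_comp,
        Polynomial.eval_sub, Polynomial.eval_one] at h3
      simp only [Pi.smul_apply, Pi.add_apply, smul_eq_mul, hA, Matrix.of_apply]
      rw [h3]; ring
    rw [e2, Matrix.det_updateRow_add, Matrix.det_updateRow_smul, Matrix.det_updateRow_smul,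
      Matrix.updateRow_eq_self]
    ring
  simp only [h1]
  rw [Finset.sum_sub_distrib, aux_det_col_scale, ← Finset.sum_mul]
  ring

def remCorner (μ : YoungDiagram) (i : ℕ) (h : μ.rowLen (i + 1) < μ.rowLen i) : YoungDiagram where
  cells := μ.cells.erase (i, μ.rowLen i - 1)
  isLowerSet := by
    rintro ⟨a, b⟩ ⟨c, d⟩ hle hmem
    simp only [Finset.coe_erase, Set.mem_sdiff, Finset.mem_coe, YoungDiagram.mem_cells,
      Set.mem_singleton_iff, Prod.mk.injEq, YoungDiagram.mem_iff_lt_rowLen] at hmem ⊢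
    obtain ⟨hc, hd⟩ : c ≤ a ∧ d ≤ b := hle
    obtain ⟨hb, hne⟩ := hmem
    have h1 := μ.rowLen_anti c a hc
    refine ⟨by omega, ?_⟩
    rintro ⟨rfl, rfl⟩
    rcases Nat.lt_or_ge c a with h2 | h2
    · have := μ.rowLen_anti (c + 1) a h2
      omega
    · have : a = c := by omega
      subst this
      omega

theorem mem_remCorner {μ : YoungDiagram} {i : ℕ} {h : μ.rowLen (i + 1) < μ.rowLen i} {a b : ℕ} :
    (a, b) ∈ remCorner μ i h ↔ (a, b) ∈ μ ∧ ¬ (a = i ∧ b = μ.rowLen i - 1) := by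
  rw [← YoungDiagram.mem_cells]
  simp [remCorner, and_comm, Prod.ext_iff]

theorem rowLen_remCorner (μ : YoungDiagram) (i : ℕ) (h : μ.rowLen (i + 1) < μ.rowLen i) (r : ℕ) :
    (remCorner μ i h).rowLen r = if r = i then μ.rowLen i - 1 else μ.rowLen r := by
  have key : ∀ b, b < (remCorner μ i h).rowLen r ↔
      b < if r = i then μ.rowLen i - 1 else μ.rowLen r := by
    intro b
    rw [← YoungDiagram.mem_iff_lt_rowLen, mem_remCorner, YoungDiagram.mem_iff_lt_rowLen]
    split_ifs with hr
    · subst hr; omega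
    · tauto
  exact le_antisymm (le_of_forall_lt fun b hb => (key b).1 hb)
    (le_of_forall_lt fun b hb => (key b).2 hb)

theorem card_remCorner (μ : YoungDiagram) (i : ℕ) (h : μ.rowLen (i + 1) < μ.rowLen i) :
    (remCorner μ i h).card + 1 = μ.card := by
  have : (i, μ.rowLen i - 1) ∈ μ.cells := by
    rw [YoungDiagram.mem_cells, YoungDiagram.mem_iff_lt_rowLen]; omega
  exact Finset.card_erase_add_one this

abbrev SYT (μ : YoungDiagram) := {T : SemistandardYoungTableau μ //
    (∀ c ∈ μ.cells, T c.1 c.2 < μ.card) ∧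
    Set.InjOn (fun c : ℕ × ℕ => T c.1 c.2) ↑μ.cells}

instance finite_SYT (μ : YoungDiagram) : Finite (SYT μ) := by
  let f : SYT μ → (μ.cells → Fin μ.card) := fun T c => ⟨T.1 c.1.1 c.1.2, T.2.1 c.1 c.2⟩
  refine Finite.of_injective f ?_
  intro T T' hf
  apply Subtype.ext
  ext a b
  by_cases hm : (a, b) ∈ μ
  · have := congrFun hf ⟨(a, b), (YoungDiagram.mem_cells _).2 hm⟩
    simpa [f] using this
  · rw [T.1.zeros hm, T'.1.zeros hm]

theorem exists_top (μ : YoungDiagram) (hμ : 0 < μ.card) (T : SYT μ) :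
    ∃ i, μ.rowLen (i + 1) < μ.rowLen i ∧ T.1 i (μ.rowLen i - 1) = μ.card - 1 := by
  have himg : μ.cells.image (fun c : ℕ × ℕ => T.1 c.1 c.2) = Finset.range μ.card := by
    apply Finset.eq_of_subset_of_card_le
    · intro y hy
      obtain ⟨c, hc, rfl⟩ := Finset.mem_image.1 hy
      exact Finset.mem_range.2 (T.2.1 c hc)
    · rw [Finset.card_image_of_injOn T.2.2, Finset.card_range]
  have : μ.card - 1 ∈ μ.cells.image (fun c : ℕ × ℕ => T.1 c.1 c.2) := by
    rw [himg]; exact Finset.mem_range.2 (by omega)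
  obtain ⟨⟨i, j⟩, hc, hT⟩ := Finset.mem_image.1 this
  simp only at hT
  have hm := hc
  rw [YoungDiagram.mem_cells, YoungDiagram.mem_iff_lt_rowLen] at hm
  have hj : j = μ.rowLen i - 1 := by
    by_contra hne
    have hm2 : (i, j + 1) ∈ μ := YoungDiagram.mem_iff_lt_rowLen.2 (by omega)
    have h1 := T.1.row_weak (Nat.lt_succ_self j) hm2
    have h2 := T.2.1 (i, j + 1) ((YoungDiagram.mem_cells _).2 hm2)
    simp only at h2
    have h3 : T.1 i j = T.1 i (j + 1) := by
      have : T.1 i j ≤ T.1 i (j + 1) := h1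
      omega
    have h4 := T.2.2 (show (i, j) ∈ (μ.cells : Set (ℕ × ℕ)) from hc)
      (show (i, j + 1) ∈ (μ.cells : Set (ℕ × ℕ)) from (YoungDiagram.mem_cells _).2 hm2) h3
    simp at h4
  refine ⟨i, ?_, hj ▸ hT⟩
  by_contra hge
  have hm2 : (i + 1, j) ∈ μ := YoungDiagram.mem_iff_lt_rowLen.2 (by omega)
  have h1 := T.1.col_strict (Nat.lt_succ_self i) hm2
  have h2 := T.2.1 (i + 1, j) ((YoungDiagram.mem_cells _).2 hm2)
  simp only at h2
  have : T.1 i j < T.1 (i + 1) j := h1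
  omega

def remEquiv (μ : YoungDiagram) (i : ℕ) (h : μ.rowLen (i + 1) < μ.rowLen i) :
    {T : SYT μ // T.1 i (μ.rowLen i - 1) = μ.card - 1} ≃ SYT (remCorner μ i h) where
  toFun T := ⟨{
      entry := fun a b => if (a = i ∧ b = μ.rowLen i - 1) then 0 else T.1.1 a b
      row_weak' := by
        intro a b1 b2 hb hm
        obtain ⟨hm, hn⟩ := mem_remCorner.1 hm
        have := T.1.1.row_weak hb hm
        rw [if_neg hn]
        split_ifs <;> omega
      col_strict' := by
        intro a1 a2 b hb hm
        obtain ⟨hm, hn⟩ := mem_remCorner.1 hm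
        have := T.1.1.col_strict hb hm
        rw [if_neg hn]
        split_ifs <;> omega
      zeros' := by
        intro a b hm
        rw [mem_remCorner] at hm
        split_ifs with hc
        · rfl
        · exact T.1.1.zeros (fun hh => hm ⟨hh, hc⟩) }, by
    have hcell : (i, μ.rowLen i - 1) ∈ (μ.cells : Set (ℕ × ℕ)) := by
      rw [Finset.mem_coe, YoungDiagram.mem_cells, YoungDiagram.mem_iff_lt_rowLen]; omega
    constructor
    · rintro ⟨a, b⟩ hc
      rw [YoungDiagram.mem_cells] at hc
      obtain ⟨hm, hn⟩ := mem_remCorner.1 hc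
      have h1 := T.1.2.1 (a, b) ((YoungDiagram.mem_cells _).2 hm)
      have h2 := card_remCorner μ i h
      change (if (a = i ∧ b = μ.rowLen i - 1) then 0 else T.1.1 a b) < _
      rw [if_neg hn]
      simp only at h1
      have h3 : T.1.1 a b ≠ μ.card - 1 := by
        intro he
        have := T.1.2.2 (show (a, b) ∈ (μ.cells : Set (ℕ × ℕ)) from (YoungDiagram.mem_cells _).2 hm)
          hcell (he.trans T.2.symm)
        simp only [Prod.mk.injEq] at this
        exact hn this
      omega
    · rintro ⟨a, b⟩ hc ⟨a', b'⟩ hc' he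
      rw [Finset.mem_coe, YoungDiagram.mem_cells] at hc hc'
      obtain ⟨hm, hn⟩ := mem_remCorner.1 hc
      obtain ⟨hm', hn'⟩ := mem_remCorner.1 hc'
      change (if (a = i ∧ b = μ.rowLen i - 1) then 0 else T.1.1 a b) =
        (if (a' = i ∧ b' = μ.rowLen i - 1) then 0 else T.1.1 a' b') at he
      rw [if_neg hn, if_neg hn'] at he
      exact T.1.2.2 (show (a, b) ∈ (μ.cells : Set (ℕ × ℕ)) from (YoungDiagram.mem_cells _).2 hm)
        (show (a', b') ∈ (μ.cells : Set (ℕ × ℕ)) from (YoungDiagram.mem_cells _).2 hm') he⟩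
  invFun S := ⟨⟨{
      entry := fun a b => if (a = i ∧ b = μ.rowLen i - 1) then μ.card - 1 else S.1 a b
      row_weak' := by
        intro a b1 b2 hb hm
        have hm' := YoungDiagram.mem_iff_lt_rowLen.1 hm
        have h2 := card_remCorner μ i h
        by_cases hc1 : a = i ∧ b1 = μ.rowLen i - 1
        · obtain ⟨rfl, rfl⟩ := hc1
          omega
        rw [if_neg hc1]
        split_ifs with hc2
        · have hr : (a, b1) ∈ remCorner μ i h := 
            mem_remCorner.2 ⟨YoungDiagram.mem_iff_lt_rowLen.2 (by omega), hc1⟩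
          have := S.2.1 (a, b1) ((YoungDiagram.mem_cells _).2 hr)
          simp only at this
          omega
        · exact S.1.row_weak hb (mem_remCorner.2 ⟨hm, hc2⟩)
      col_strict' := by
        intro a1 a2 b ha hm
        have hm' := YoungDiagram.mem_iff_lt_rowLen.1 hm
        have h2 := card_remCorner μ i h
        by_cases hc1 : a1 = i ∧ b = μ.rowLen i - 1
        · obtain ⟨rfl, rfl⟩ := hc1
          have := μ.rowLen_anti (a1 + 1) a2 ha
          omega
        rw [if_neg hc1]
        split_ifs with hc2
        · have hr : (a1, b) ∈ remCorner μ i h := 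
            mem_remCorner.2 ⟨μ.up_left_mem ha.le le_rfl hm, hc1⟩
          have := S.2.1 (a1, b) ((YoungDiagram.mem_cells _).2 hr)
          simp only at this
          omega
        · exact S.1.col_strict ha (mem_remCorner.2 ⟨hm, hc2⟩)
      zeros' := by
        intro a b hm
        split_ifs with hc
        · obtain ⟨rfl, rfl⟩ := hc
          exact absurd (YoungDiagram.mem_iff_lt_rowLen.2 (by omega)) hm
        · exact S.1.zeros (fun hh => hm (mem_remCorner.1 hh).1) }, by
    have h2 := card_remCorner μ i h
    have hlt : ∀ a b, (a, b) ∈ μ → ¬ (a = i ∧ b = μ.rowLen i - 1) → S.1 a b < μ.card - 1 := by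
      intro a b hm hn
      have := S.2.1 (a, b) ((YoungDiagram.mem_cells _).2 (mem_remCorner.2 ⟨hm, hn⟩))
      simp only at this
      omega
    constructor
    · rintro ⟨a, b⟩ hc
      rw [YoungDiagram.mem_cells] at hc
      change (if (a = i ∧ b = μ.rowLen i - 1) then μ.card - 1 else S.1 a b) < _
      split_ifs with hn
      · omega
      · have := hlt a b hc hn
        omega
    · rintro ⟨a, b⟩ hc ⟨a', b'⟩ hc' he
      rw [Finset.mem_coe, YoungDiagram.mem_cells] at hc hc'
      change (if (a = i ∧ b = μ.rowLen i - 1) then μ.card - 1 else S.1 a b) =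
        (if (a' = i ∧ b' = μ.rowLen i - 1) then μ.card - 1 else S.1 a' b') at he
      split_ifs at he with hn hn' hn'
      · rw [hn.1, hn.2, hn'.1, hn'.2]
      · have := hlt a' b' hc' hn'
        omega
      · have := hlt a b hc hn
        omega
      · exact S.2.2
          (show (a, b) ∈ ((remCorner μ i h).cells : Set (ℕ × ℕ)) from
            (YoungDiagram.mem_cells _).2 (mem_remCorner.2 ⟨hc, hn⟩))
          (show (a', b') ∈ ((remCorner μ i h).cells : Set (ℕ × ℕ)) from
            (YoungDiagram.mem_cells _).2 (mem_remCorner.2 ⟨hc', hn'⟩)) he⟩, by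
    change (if (i = i ∧ μ.rowLen i - 1 = μ.rowLen i - 1) then μ.card - 1 else _) = _
    simp⟩
  left_inv T := by
    apply Subtype.ext
    apply Subtype.ext
    ext a b
    change (if (a = i ∧ b = μ.rowLen i - 1) then μ.card - 1 else
      (if (a = i ∧ b = μ.rowLen i - 1) then 0 else T.1.1 a b)) = T.1.1 a b
    split_ifs with hc
    · rw [hc.1, hc.2, T.2]
    · rfl
  right_inv S := by
    apply Subtype.ext
    ext a b
    change (if (a = i ∧ b = μ.rowLen i - 1) then 0 else
      (if (a = i ∧ b = μ.rowLen i - 1) then μ.card - 1 else S.1 a b)) = S.1 a b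
    split_ifs with hc
    · exact (S.1.zeros (fun hh => (mem_remCorner.1 hh).2 hc)).symm
    · rfl

theorem sytCard_rec (μ : YoungDiagram) (hμ : 0 < μ.card) (n : ℕ) (hn : μ.colLen 0 ≤ n) :
    sytCard μ = ∑ i : Fin n, if h : μ.rowLen (i + 1) < μ.rowLen i then
      sytCard (remCorner μ i h) else 0 := by
  have hlt : ∀ i, μ.rowLen (i + 1) < μ.rowLen i → i < n := by
    intro i hi
    have : (i, 0) ∈ μ := YoungDiagram.mem_iff_lt_rowLen.2 (by omega)
    have := YoungDiagram.mem_iff_lt_colLen.1 this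
    omega
  choose f hf1 hf2 using exists_top μ hμ
  let g : SYT μ → Fin n := fun T => ⟨f T, hlt _ (hf1 T)⟩
  have e1 : sytCard μ = ∑ i : Fin n, Nat.card {T : SYT μ // g T = i} := by
    rw [← Nat.card_sigma]
    exact (Nat.card_congr (Equiv.sigmaFiberEquiv g)).symm
  rw [e1]
  refine Finset.sum_congr rfl fun i _ => ?_
  split_ifs with h
  · have : ∀ T : SYT μ, g T = i ↔ T.1 i (μ.rowLen i - 1) = μ.card - 1 := by
      intro T
      constructor
      · intro hg
        rw [← hg]; exact hf2 T
      · intro ht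
        have m1 : ((i : ℕ), μ.rowLen i - 1) ∈ (μ.cells : Set (ℕ × ℕ)) := by
          rw [Finset.mem_coe, YoungDiagram.mem_cells, YoungDiagram.mem_iff_lt_rowLen]; omega
        have m2 : (f T, μ.rowLen (f T) - 1) ∈ (μ.cells : Set (ℕ × ℕ)) := by
          have := hf1 T
          rw [Finset.mem_coe, YoungDiagram.mem_cells, YoungDiagram.mem_iff_lt_rowLen]; omega
        have := T.2.2 m2 m1 ((hf2 T).trans ht.symm)
        simp only [Prod.mk.injEq] at this
        exact Fin.ext this.1
    exact Nat.card_congr ((Equiv.subtypeEquivRight this).trans (remEquiv μ i h))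
  · have : IsEmpty {T : SYT μ // g T = i} := ⟨fun T => h (by
      have := hf1 T.1
      have h2 : f T.1 = i := congrArg Fin.val T.2
      rwa [h2] at this)⟩
    exact Nat.card_of_isEmpty

theorem sytCard_zero (μ : YoungDiagram) (hμ : μ.card = 0) : sytCard μ = 1 := by
  have hc : ∀ c, c ∉ μ := by
    intro c hc
    have : μ.cells = ∅ := Finset.card_eq_zero.1 hμ
    rw [← YoungDiagram.mem_cells, this] at hc
    simp at hc
  rw [sytCard, Nat.card_eq_one_iff_unique]
  constructor
  · constructor
    intro a b
    apply Subtype.ext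
    ext i j
    rw [a.1.zeros (hc _), b.1.zeros (hc _)]
  · have he : (μ.cells : Set (ℕ × ℕ)) = ∅ := by
      rw [Finset.card_eq_zero.1 hμ]; simp
    exact ⟨⟨⟨fun _ _ => 0, fun _ _ => le_rfl, fun _ h => absurd h (hc _), fun _ => rfl⟩,
      fun c h => absurd ((YoungDiagram.mem_cells _).1 h) (hc c), by rw [he]; simp⟩⟩

theorem card_eq_sum (μ : YoungDiagram) (n : ℕ) (hn : μ.colLen 0 ≤ n) :
    μ.card = ∑ i ∈ Finset.range n, μ.rowLen i := by
  have : (μ.cells : Set (ℕ × ℕ)).MapsTo Prod.fst (Finset.range n : Set ℕ) := by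
    rintro ⟨a, b⟩ h
    have h1 : (a, 0) ∈ μ := μ.up_left_mem le_rfl (Nat.zero_le b) ((YoungDiagram.mem_cells _).1 h)
    have := YoungDiagram.mem_iff_lt_colLen.1 h1
    simp only [Finset.coe_range, Set.mem_Iio]
    omega
  rw [YoungDiagram.card, Finset.card_eq_sum_card_fiberwise this]
  refine Finset.sum_congr rfl fun i _ => ?_
  rw [YoungDiagram.rowLen_eq_card]
  rfl

theorem rowLen_zero_of_le (μ : YoungDiagram) (i : ℕ) (hi : μ.colLen 0 ≤ i) : μ.rowLen i = 0 := by
  by_contra h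
  have h1 : (i, 0) ∈ μ := YoungDiagram.mem_iff_lt_rowLen.2 (by omega)
  have := YoungDiagram.mem_iff_lt_colLen.1 h1
  omega

theorem rowLen_pos_of_lt (μ : YoungDiagram) (i : ℕ) (hi : i < μ.colLen 0) : 0 < μ.rowLen i := by
  have h1 : (i, 0) ∈ μ := YoungDiagram.mem_iff_lt_colLen.2 hi
  exact YoungDiagram.mem_iff_lt_rowLen.1 h1

theorem sum_tupleOf (μ : YoungDiagram) (n : ℕ) (hn : μ.colLen 0 ≤ n) :
    ∑ j : Fin n, tupleOf n μ j = μ.card + ∑ j : Fin n, (j : ℕ) := by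
  simp only [tupleOf]
  rw [Finset.sum_add_distrib, card_eq_sum μ n hn,
    Fin.sum_univ_eq_sum_range (fun j => μ.rowLen (n - 1 - j)), Finset.sum_range_reflect]

theorem det_vand_id (n : ℕ) : (Matrix.vandermonde (fun j : Fin n => ((j : ℕ) : ℝ))).det
    = ∏ j : Fin n, (Nat.factorial j : ℝ) := by
  have hv := Matrix.det_eval_matrixOfPolynomials_eq_det_vandermonde (fun j : Fin n => ((j : ℕ) : ℝ))
      (fun j => descPochhammer ℝ (j : ℕ))
      (fun i => descPochhammer_natDegree ℝ i) (fun i => monic_descPochhammer ℝ i)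
  rw [hv, Matrix.det_of_lowerTriangular]
  · refine Finset.prod_congr rfl fun j _ => ?_
    simp [descPochhammer_eval_eq_descFactorial, Nat.descFactorial_self]
  · intro i j hij
    simp only [Matrix.of_apply]
    rw [descPochhammer_eval_eq_descFactorial, Nat.cast_eq_zero, Nat.descFactorial_eq_zero_iff_lt]
    exact hij

theorem frob_formula (n : ℕ) : ∀ (k : ℕ) (μ : YoungDiagram), μ.card = k → μ.colLen 0 ≤ n →
    (sytCard μ : ℝ) * ∏ j : Fin n, (Nat.factorial (tupleOf n μ j) : ℝ)
      = (Nat.factorial k : ℝ) * (Matrix.vandermonde (fun j : Fin n => (tupleOf n μ j : ℝ))).det := by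
  intro k
  induction k with
  | zero =>
    intro μ hk hn
    have h0 : ∀ i, μ.rowLen i = 0 := by
      intro i
      by_contra h
      have h1 : (i, 0) ∈ μ.cells := by
        rw [YoungDiagram.mem_cells, YoungDiagram.mem_iff_lt_rowLen]; omega
      rw [Finset.card_eq_zero.1 hk] at h1
      simp at h1
    rw [sytCard_zero μ hk]
    simp only [tupleOf, h0, zero_add]
    rw [det_vand_id]
    simp
  | succ k ih =>
    intro μ hk hn
    let x : Fin n → ℝ := fun j => (tupleOf n μ j : ℝ)
    let d : ℕ → ℝ := fun i => if h : μ.rowLen (i + 1) < μ.rowLen i then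
      (sytCard (remCorner μ i h) : ℝ) else 0
    have e1 : (sytCard μ : ℝ) = ∑ j : Fin n, d (n - 1 - j) := by
      rw [sytCard_rec μ (by omega) n hn, Fin.sum_univ_eq_sum_range (fun j => d (n - 1 - j)),
        Finset.sum_range_reflect, Nat.cast_sum, ← Fin.sum_univ_eq_sum_range]
      refine Finset.sum_congr rfl fun i _ => ?_
      simp only [d]
      split_ifs <;> simp
    have e2 : ∀ j : Fin n, d (n - 1 - j) * ∏ j : Fin n, (Nat.factorial (tupleOf n μ j) : ℝ)
        = (Nat.factorial k : ℝ) *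
          (x j * (Matrix.vandermonde (Function.update x j (x j - 1))).det) := by
      intro j
      have hj := j.2
      simp only [d]
      split_ifs with h
      · have hc := card_remCorner μ _ h
        have hcol : (remCorner μ _ h).colLen 0 ≤ n := by
          by_contra hlt
          have h1 : (n, 0) ∈ remCorner μ _ h := YoungDiagram.mem_iff_lt_colLen.2 (by omega)
          have h2 := YoungDiagram.mem_iff_lt_colLen.1 (mem_remCorner.1 h1).1
          omega
        have hI := ih (remCorner μ _ h) (by omega) hcol
        have ht : ∀ j', tupleOf n (remCorner μ _ h) j' =
            if j' = j then tupleOf n μ j - 1 else tupleOf n μ j' := by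
          intro j'
          have hj' := j'.2
          simp only [tupleOf, rowLen_remCorner]
          by_cases hjj : j' = j
          · subst hjj
            simp; omega
          · have h3 : ¬ (n - 1 - (j' : ℕ) = n - 1 - (j : ℕ)) := by
              intro he
              apply hjj
              apply Fin.ext
              omega
            rw [if_neg h3, if_neg hjj]
        have hpos : 1 ≤ tupleOf n μ j := by
          simp only [tupleOf]; omega
        have ht2 : (fun j' => (tupleOf n (remCorner μ _ h) j' : ℝ))
            = Function.update x j (x j - 1) := by
          ext j'
          rw [ht]
          by_cases hjj : j' = j
          · subst hjj
            simp [x, Nat.cast_sub hpos]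
          · simp [hjj, x]
        rw [ht2] at hI
        have hp : ∏ j' : Fin n, (Nat.factorial (tupleOf n μ j') : ℝ)
            = x j * ∏ j' : Fin n, (Nat.factorial (tupleOf n (remCorner μ _ h) j') : ℝ) := by
          rw [← Finset.mul_prod_erase _ _ (Finset.mem_univ j),
            ← Finset.mul_prod_erase Finset.univ
              (fun j' => (Nat.factorial (tupleOf n (remCorner μ _ h) j') : ℝ)) (Finset.mem_univ j),
            ← mul_assoc]
          congr 1
          · rw [ht, if_pos rfl]
            simp only [x]
            rw [← Nat.cast_mul, Nat.mul_factorial_pred (by omega)]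
          · refine Finset.prod_congr rfl fun j' hj' => ?_
            rw [ht, if_neg (Finset.ne_of_mem_erase hj')]
        rw [hp]
        linear_combination x j * hI
      · rw [zero_mul]
        symm
        by_cases hj0 : (j : ℕ) = 0
        · have : tupleOf n μ j = 0 := by
            have h1 := rowLen_zero_of_le μ (n - 1 - j + 1) (by omega)
            simp only [tupleOf]; omega
          simp [x, this]
        · have hdet : (Matrix.vandermonde (Function.update x j (x j - 1))).det = 0 := by
            rw [Matrix.det_vandermonde_eq_zero_iff]
            refine ⟨j, ⟨j - 1, by omega⟩, ?_, ?_⟩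
            · have hne : (⟨(j : ℕ) - 1, by omega⟩ : Fin n) ≠ j := by
                intro he
                have := congrArg Fin.val he
                simp at this; omega
              rw [Function.update_self, Function.update_of_ne hne]
              have h1 : tupleOf n μ j = tupleOf n μ ⟨(j : ℕ) - 1, by omega⟩ + 1 := by
                simp only [tupleOf]
                have h2 := μ.rowLen_anti (n - 1 - j) (n - 1 - j + 1) (by omega)
                have h3 : n - 1 - ((j : ℕ) - 1) = n - 1 - j + 1 := by omega
                rw [h3]
                omega
              simp [x, h1]
            · intro he
              have := congrArg Fin.val he
              simp at this; omega
          rw [hdet]; simp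
    rw [e1, Finset.sum_mul, Finset.sum_congr rfl (fun j _ => e2 j), ← Finset.mul_sum,
      aux_vand_identity]
    have e3 : ∑ i, x i - ∑ j : Fin n, ((j : ℕ) : ℝ) = (k + 1 : ℝ) := by
      have := sum_tupleOf μ n hn
      rw [hk] at this
      have h2 : ((∑ j : Fin n, tupleOf n μ j : ℕ) : ℝ) = ((k + 1 + ∑ j : Fin n, (j : ℕ) : ℕ) : ℝ) := by
        rw [this]
      push_cast at h2
      simp only [x]
      linarith
    rw [e3, Nat.factorial_succ]
    push_cast
    ring

theorem det_eq_prod_ite {n : ℕ} (x : Fin n → ℝ) : (Matrix.vandermonde x).det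
    = ∏ i : Fin n, ∏ j : Fin n, if i < j then x j - x i else 1 := by
  rw [Matrix.det_vandermonde]
  refine Finset.prod_congr rfl fun i _ => ?_
  rw [← Finset.prod_filter]
  refine Finset.prod_congr ?_ fun _ _ => rfl
  ext j; simp

theorem frob_div (n : ℕ) (μ : YoungDiagram) (hn : μ.colLen 0 ≤ n) :
    (Matrix.vandermonde (fun j : Fin n => (tupleOf n μ j : ℝ))).det =
    (sytCard μ : ℝ) / (Nat.factorial μ.card : ℝ)
      * ∏ j : Fin n, (Nat.factorial (tupleOf n μ j) : ℝ) := by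
  have h := frob_formula n _ μ rfl hn
  have h0 : (Nat.factorial μ.card : ℝ) ≠ 0 := by positivity
  field_simp
  linarith

theorem tupleOf_lt (n : ℕ) (μ : YoungDiagram) (i j : Fin n) (h : i < j) :
    tupleOf n μ i < tupleOf n μ j := by
  simp only [tupleOf]
  have h1 : (i : ℕ) < j := h
  have := μ.rowLen_anti (n - 1 - j) (n - 1 - i) (by omega)
  omega

def pFac (n : ℕ) (μ : YoungDiagram) : ℝ :=
  ∏ i ∈ Finset.range n, ∏ t ∈ Finset.range (μ.rowLen i), ((n : ℝ) - i + t) / n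

theorem fact_add (j l : ℕ) : (Nat.factorial (l + j) : ℝ) =
    Nat.factorial j * ∏ t ∈ Finset.range l, ((j : ℝ) + 1 + t) := by
  induction l with
  | zero => simp
  | succ l ih =>
    rw [Finset.prod_range_succ, ← mul_assoc, ← ih, show l + 1 + j = (l + j) + 1 by omega,
      Nat.factorial_succ]
    push_cast
    ring

theorem prod_fact (n : ℕ) (μ : YoungDiagram) (hn : μ.colLen 0 ≤ n) (h0 : 0 < n) :
    ∏ j : Fin n, (Nat.factorial (tupleOf n μ j) : ℝ) =
      (∏ j : Fin n, (Nat.factorial j : ℝ)) * ((n : ℝ) ^ μ.card * pFac n μ) := by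
  have h0' : (n : ℝ) ≠ 0 := by positivity
  have e1 : ∀ j : Fin n, (Nat.factorial (tupleOf n μ j) : ℝ) = Nat.factorial j *
      ((n : ℝ) ^ μ.rowLen (n - 1 - j) *
      ∏ t ∈ Finset.range (μ.rowLen (n - 1 - j)), ((n : ℝ) - ((n - 1 - j : ℕ) : ℝ) + t) / n) := by
    intro j
    rw [tupleOf, fact_add, Finset.prod_div_distrib, Finset.prod_const, Finset.card_range]
    have hc : ((n - 1 - j : ℕ) : ℝ) = (n : ℝ) - 1 - j := by
      have := j.2
      rw [Nat.cast_sub (by omega), Nat.cast_sub (by omega)]; simp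
    rw [hc, mul_div_cancel₀ _ (pow_ne_zero _ h0')]
    congr 1
    refine Finset.prod_congr rfl fun t _ => ?_
    ring
  rw [Finset.prod_congr rfl (fun j _ => e1 j), Finset.prod_mul_distrib, Finset.prod_mul_distrib]
  congr 1
  congr 1
  · rw [Finset.prod_pow_eq_pow_sum, card_eq_sum μ n hn,
      Fin.sum_univ_eq_sum_range (fun j => μ.rowLen (n - 1 - j)), Finset.sum_range_reflect]
  · rw [pFac, Fin.prod_univ_eq_prod_range (fun j => ∏ t ∈ Finset.range (μ.rowLen (n - 1 - j)),
      ((n : ℝ) - ((n - 1 - j : ℕ) : ℝ) + t) / n),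
      Finset.prod_range_reflect (fun i => ∏ t ∈ Finset.range (μ.rowLen i),
      ((n : ℝ) - (i : ℝ) + t) / n)]

theorem pFac_nonneg (n : ℕ) (μ : YoungDiagram) : 0 ≤ pFac n μ := by
  refine Finset.prod_nonneg fun i hi => Finset.prod_nonneg fun t _ => ?_
  have : (i : ℝ) ≤ n := by exact_mod_cast (Finset.mem_range.1 hi).le
  have : 0 ≤ (n : ℝ) - i := by linarith
  positivity

def cFac (α β : ℝ) (n : ℕ) : ℝ :=
  (∏ j : Fin n, (Nat.factorial j : ℝ)) ^ β * (α / (n : ℝ) ^ β) ^ (∑ j : Fin n, (j : ℕ))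

theorem cFac_pos (α β : ℝ) (hα : 0 < α) (n : ℕ) (h0 : 0 < n) : 0 < cFac α β n := by
  have h0' : (0 : ℝ) < n := by positivity
  have : 0 < (∏ j : Fin n, (Nat.factorial j : ℝ)) := Finset.prod_pos fun j _ => by positivity
  rw [cFac]
  positivity

theorem gammaWeight_eq (α β : ℝ) (n : ℕ) (μ : YoungDiagram) (hn : μ.colLen 0 ≤ n) (h0 : 0 < n) :
    gammaWeight n (α / (n : ℝ) ^ β) β μ =
      cFac α β n * (mixedWeight α β μ * (pFac n μ) ^ β) := by
  have h0' : (0 : ℝ) < n := by positivity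
  have hle : ∀ i j : Fin n, 0 ≤ (if i < j then (tupleOf n μ j : ℝ) - tupleOf n μ i else 1) := by
    intro i j
    split_ifs with h
    · have : (tupleOf n μ i : ℝ) < tupleOf n μ j := by exact_mod_cast tupleOf_lt n μ i j h
      linarith
    · norm_num
  have e1 : (∏ i : Fin n, ∏ j : Fin n,
      if i < j then ((tupleOf n μ j : ℝ) - (tupleOf n μ i : ℝ)) ^ β else 1) =
      ((Matrix.vandermonde (fun j : Fin n => (tupleOf n μ j : ℝ))).det) ^ β := by
    rw [det_eq_prod_ite, ← Real.finsetProd_rpow _ _ (fun i _ => Finset.prod_nonneg fun j _ => hle i j)]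
    refine Finset.prod_congr rfl fun i _ => ?_
    rw [← Real.finsetProd_rpow _ _ (fun j _ => hle i j)]
    refine Finset.prod_congr rfl fun j _ => ?_
    split_ifs <;> simp
  have hP := pFac_nonneg n μ
  have hf : 0 ≤ (∏ j : Fin n, (Nat.factorial j : ℝ)) := Finset.prod_nonneg fun j _ => by positivity
  rw [gammaWeight, e1, frob_div n μ hn, prod_fact n μ hn h0, Finset.prod_pow_eq_pow_sum,
    sum_tupleOf μ n hn, Real.mul_rpow (by positivity) (by positivity),
    Real.mul_rpow hf (by positivity), Real.mul_rpow (by positivity) hP, cFac, mixedWeight,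
    pow_add, div_pow]
  have e2 : ((n : ℝ) ^ β) ^ μ.card = ((n : ℝ) ^ μ.card) ^ β := by
    rw [← Real.rpow_natCast, ← Real.rpow_natCast, ← Real.rpow_mul h0'.le, ← Real.rpow_mul h0'.le,
      mul_comm]
  rw [e2]
  have h3 : ((n : ℝ) ^ μ.card) ^ β ≠ 0 := by positivity
  field_simp

theorem pFac_tendsto (μ : YoungDiagram) : Tendsto (fun n => pFac n μ) atTop (nhds 1) := by
  have h1 : Tendsto (fun n : ℕ => ∏ i ∈ Finset.range (μ.colLen 0),
      ∏ t ∈ Finset.range (μ.rowLen i), ((n : ℝ) - i + t) / n) atTop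
      (nhds (∏ i ∈ Finset.range (μ.colLen 0), ∏ t ∈ Finset.range (μ.rowLen i), 1)) := by
    refine tendsto_finset_prod _ fun i _ => tendsto_finset_prod _ fun t _ => ?_
    have h2 : Tendsto (fun n : ℕ => 1 + ((t : ℝ) - i) / n) atTop (nhds (1 + 0)) :=
      tendsto_const_nhds.add (tendsto_const_div_atTop_nhds_zero_nat _)
    rw [add_zero] at h2
    refine h2.congr' ?_
    filter_upwards [eventually_gt_atTop 0] with n hn
    have : (n : ℝ) ≠ 0 := by positivity
    field_simp
    ring
  simp only [Finset.prod_const_one] at h1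
  refine h1.congr' ?_
  filter_upwards [eventually_ge_atTop (μ.colLen 0)] with n hn
  rw [pFac]
  refine Finset.prod_subset (fun i hi => ?_) fun i _ hi => ?_
  · simp only [Finset.mem_range] at hi ⊢; omega
  · rw [rowLen_zero_of_le μ i (by simpa using hi)]; simp

theorem desc_fact (m j : ℕ) : (∏ s ∈ Finset.range j, ((m : ℝ) + j - s)) * Nat.factorial m
    = Nat.factorial (m + j) := by
  induction j with
  | zero => simp
  | succ j ih =>
    rw [Finset.prod_range_succ', show m + (j + 1) = (m + j) + 1 by omega, Nat.factorial_succ]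
    have : ∏ s ∈ Finset.range j, ((m : ℝ) + ((j + 1 : ℕ) : ℝ) - ((s + 1 : ℕ) : ℝ))
        = ∏ s ∈ Finset.range j, ((m : ℝ) + j - s) := by
      refine Finset.prod_congr rfl fun s _ => ?_
      push_cast; ring
    rw [this]
    push_cast
    rw [← ih]
    push_cast
    ring

theorem dim_bound (μ : YoungDiagram) :
    (sytCard μ : ℝ) / (Nat.factorial μ.card : ℝ) ≤ 1 / (Nat.factorial (μ.colLen 0) *
      ∏ i ∈ Finset.range (μ.colLen 0), (Nat.factorial (μ.rowLen i - 1) : ℝ)) := by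
  set l := μ.colLen 0 with hl
  have hdet := frob_div l μ le_rfl
  rw [det_eq_prod_ite, Finset.prod_comm] at hdet
  have hrow : ∀ j : Fin l, (∏ i : Fin l, if i < j then (tupleOf l μ j : ℝ) - tupleOf l μ i else 1)
      * (((j : ℕ) + 1 : ℝ) * Nat.factorial (μ.rowLen (l - 1 - j) - 1))
      ≤ Nat.factorial (tupleOf l μ j) := by
    intro j
    have hj := j.2
    have hpos := rowLen_pos_of_lt μ (l - 1 - j) (by omega)
    obtain ⟨m, hm⟩ : ∃ m, μ.rowLen (l - 1 - j) = m + 1 := ⟨_, (Nat.succ_pred_eq_of_pos hpos).symm⟩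
    have ht : tupleOf l μ j = m + j + 1 := by rw [tupleOf, hm]; omega
    have hle : (∏ i : Fin l, if i < j then (tupleOf l μ j : ℝ) - tupleOf l μ i else 1)
        ≤ ∏ i : Fin l, if i < j then (m : ℝ) + j - i else 1 := by
      refine Finset.prod_le_prod (fun i _ => ?_) fun i _ => ?_
      · split_ifs with h
        · have : (tupleOf l μ i : ℝ) < tupleOf l μ j := by exact_mod_cast tupleOf_lt l μ i j h
          linarith
        · norm_num
      · split_ifs with h
        · have hp := rowLen_pos_of_lt μ (l - 1 - i) (by omega)
          have h2 : (i : ℕ) + 1 ≤ tupleOf l μ i := by rw [tupleOf]; omega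
          have h3 : ((i : ℕ) : ℝ) + 1 ≤ tupleOf l μ i := by exact_mod_cast h2
          rw [ht]; push_cast; linarith
        · exact le_rfl
    have heq : (∏ i : Fin l, if i < j then (m : ℝ) + j - i else 1)
        = ∏ s ∈ Finset.range j, ((m : ℝ) + j - s) := by
      have := Fin.prod_univ_eq_prod_range (fun s : ℕ => if s < (j : ℕ) then (m : ℝ) + j - s else 1) l
      simp only [Fin.lt_def]
      rw [this, ← Finset.prod_filter]
      refine Finset.prod_congr ?_ fun _ _ => rfl
      ext s; simp only [Finset.mem_filter, Finset.mem_range]; omega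
    rw [hm, Nat.add_sub_cancel]
    calc _ ≤ (∏ s ∈ Finset.range j, ((m : ℝ) + j - s)) * (((j : ℕ) + 1 : ℝ) * Nat.factorial m) := by
            rw [← heq]; exact mul_le_mul_of_nonneg_right hle (by positivity)
      _ = ((j : ℕ) + 1 : ℝ) * Nat.factorial (m + j) := by rw [← desc_fact]; ring
      _ ≤ _ := by
        rw [ht, Nat.factorial_succ]; push_cast
        gcongr
        have : (0 : ℝ) ≤ m := by positivity
        linarith
  have hprod := Finset.prod_le_prod (s := Finset.univ) (fun (j : Fin l) _ => ?_) (fun j _ => hrow j)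
  swap
  · refine mul_nonneg (Finset.prod_nonneg fun i _ => ?_) (by positivity)
    split_ifs with h
    · have : (tupleOf l μ i : ℝ) < tupleOf l μ j := by exact_mod_cast tupleOf_lt l μ i j h
      linarith
    · norm_num
  rw [Finset.prod_mul_distrib, hdet, Finset.prod_mul_distrib,
    Fin.prod_univ_eq_prod_range (fun j : ℕ => (j : ℝ) + 1),
    Fin.prod_univ_eq_prod_range (fun j : ℕ => (Nat.factorial (μ.rowLen (l - 1 - j) - 1) : ℝ)),
    Finset.prod_range_reflect (fun j : ℕ => (Nat.factorial (μ.rowLen j - 1) : ℝ))] at hprod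
  have hfl : ∏ j ∈ Finset.range l, ((j : ℝ) + 1) = Nat.factorial l := by
    rw [← Finset.prod_range_add_one_eq_factorial]; push_cast; rfl
  rw [hfl] at hprod
  have hX : (0 : ℝ) < ∏ j : Fin l, (Nat.factorial (tupleOf l μ j) : ℝ) :=
    Finset.prod_pos fun j _ => by positivity
  have hY : (0 : ℝ) < Nat.factorial l * ∏ i ∈ Finset.range l, (Nat.factorial (μ.rowLen i - 1) : ℝ) :=
    mul_pos (by positivity) (Finset.prod_pos fun j _ => by positivity)
  rw [le_div_iff₀ hY]
  refine le_of_mul_le_mul_right ?_ hX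
  linarith

def fRow (α β : ℝ) (N : ℕ) (m : ℕ) : ℝ :=
  α ^ m * (∏ t ∈ Finset.range m, (1 + ((t : ℝ) + 1) / N) / ((t : ℝ) + 1)) ^ β

def gBound (α β : ℝ) (N : ℕ) (p : Σ l : ℕ, (Fin l → ℕ)) : ℝ :=
  α ^ p.1 / (Nat.factorial p.1 : ℝ) ^ β * ∏ i, fRow α β N (p.2 i)

theorem fRow_pos (α β : ℝ) (hα : 0 < α) (N m : ℕ) : 0 < fRow α β N m := by
  have : 0 < ∏ t ∈ Finset.range m, (1 + ((t : ℝ) + 1) / N) / ((t : ℝ) + 1) :=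
    Finset.prod_pos fun t _ => by positivity
  rw [fRow]; positivity

theorem fRow_summable (α β : ℝ) (hα : 0 < α) (hβ : 0 < β) (N : ℕ)
    (hN : α * (1 / (N : ℝ)) ^ β < 1) : Summable (fRow α β N) := by
  refine summable_of_ratio_test_tendsto_lt_one hN
    (Eventually.of_forall fun m => (fRow_pos α β hα N m).ne') ?_
  have e : ∀ m : ℕ, ‖fRow α β N (m + 1)‖ / ‖fRow α β N m‖ =
      α * (1 / ((m : ℝ) + 1) + 1 / N) ^ β := by
    intro m
    rw [Real.norm_of_nonneg (fRow_pos α β hα N _).le, Real.norm_of_nonneg (fRow_pos α β hα N _).le,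
      div_eq_iff (fRow_pos α β hα N _).ne']
    have hp : 0 ≤ ∏ t ∈ Finset.range m, (1 + ((t : ℝ) + 1) / N) / ((t : ℝ) + 1) :=
      Finset.prod_nonneg fun t _ => by positivity
    have h1 : (1 + ((m : ℝ) + 1) / N) / ((m : ℝ) + 1) = 1 / ((m : ℝ) + 1) + 1 / N := by
      have : (m : ℝ) + 1 ≠ 0 := by positivity
      rw [add_div]; congr 1; field_simp
    rw [fRow, fRow, Finset.prod_range_succ, Real.mul_rpow hp (by positivity), h1]
    ring
  simp only [e]
  have h2 : Tendsto (fun m : ℕ => 1 / ((m : ℝ) + 1) + 1 / (N : ℝ)) atTop (nhds (0 + 1 / (N : ℝ))) :=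
    tendsto_one_div_add_atTop_nhds_zero_nat.add tendsto_const_nhds
  rw [zero_add] at h2
  exact (h2.rpow_const (Or.inr hβ.le)).const_mul α

theorem pow_div_fact_summable (A β : ℝ) (hA : 0 < A) (hβ : 0 < β) :
    Summable (fun l : ℕ => A ^ l / (Nat.factorial l : ℝ) ^ β) := by
  have hpos : ∀ l : ℕ, 0 < A ^ l / (Nat.factorial l : ℝ) ^ β := fun l => by positivity
  refine summable_of_ratio_test_tendsto_lt_one zero_lt_one
    (Eventually.of_forall fun m => (hpos m).ne') ?_
  have e : ∀ m : ℕ, ‖A ^ (m + 1) / (Nat.factorial (m + 1) : ℝ) ^ β‖ / 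
      ‖A ^ m / (Nat.factorial m : ℝ) ^ β‖ = A * (1 / ((m : ℝ) + 1)) ^ β := by
    intro m
    rw [Real.norm_of_nonneg (hpos _).le, Real.norm_of_nonneg (hpos _).le,
      div_eq_iff (hpos _).ne', Nat.factorial_succ, Nat.cast_mul,
      Real.mul_rpow (by positivity) (by positivity), Real.div_rpow (by positivity) (by positivity),
      Real.one_rpow]
    push_cast
    have : ((m : ℝ) + 1) ^ β ≠ 0 := by positivity
    have : (Nat.factorial m : ℝ) ^ β ≠ 0 := by positivity
    field_simp
    ring
  simp only [e]
  have := (tendsto_one_div_add_atTop_nhds_zero_nat (𝕜 := ℝ)).rpow_const (p := β) (Or.inr hβ.le)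
  rw [Real.zero_rpow hβ.ne'] at this
  simpa using this.const_mul A

theorem sum_pi_le (f : ℕ → ℝ) (hf : ∀ m, 0 ≤ f m) (hs : Summable f) (l : ℕ)
    (u : Finset (Fin l → ℕ)) : ∑ p ∈ u, ∏ i, f (p i) ≤ (∑' m, f m) ^ l := by
  classical
  let s : Finset ℕ := u.biUnion fun p => Finset.univ.image p
  calc ∑ p ∈ u, ∏ i, f (p i) ≤ ∑ p ∈ Fintype.piFinset (fun _ : Fin l => s), ∏ i, f (p i) := by
        refine Finset.sum_le_sum_of_subset_of_nonneg (fun p hp => ?_)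
          fun p _ _ => Finset.prod_nonneg fun i _ => hf _
        rw [Fintype.mem_piFinset]
        intro i
        exact Finset.mem_biUnion.2 ⟨p, hp, Finset.mem_image_of_mem _ (Finset.mem_univ i)⟩
    _ = ∏ _i : Fin l, ∑ m ∈ s, f m := (Finset.prod_univ_sum _ _).symm
    _ = (∑ m ∈ s, f m) ^ l := by simp
    _ ≤ _ := pow_le_pow_left₀ (Finset.sum_nonneg fun m _ => hf m)
        (hs.sum_le_tsum s fun m _ => hf m) l

theorem gBound_summable (α β : ℝ) (hα : 0 < α) (hβ : 0 < β) (N : ℕ)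
    (hN : α * (1 / (N : ℝ)) ^ β < 1) : Summable (gBound α β N) := by
  have hf := fun m => (fRow_pos α β hα N m)
  have hs := fRow_summable α β hα hβ N hN
  have hnn : ∀ l : ℕ, (0 : (Fin l → ℕ) → ℝ) ≤ fun p => ∏ i, fRow α β N (p i) :=
    fun l p => Finset.prod_nonneg fun i _ => (hf _).le
  have hle := sum_pi_le _ (fun m => (hf m).le) hs
  rw [summable_sigma_of_nonneg]
  · constructor
    · intro l
      exact (summable_of_sum_le (hnn l) (hle l)).mul_left (α ^ l / (Nat.factorial l : ℝ) ^ β)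
    · have hS : 0 < ∑' m, fRow α β N m := hs.tsum_pos (fun m => (hf m).le) 0 (hf 0)
      refine Summable.of_nonneg_of_le (fun l => ?_) (fun l => ?_)
        (pow_div_fact_summable (α * ∑' m, fRow α β N m) β (by positivity) hβ)
      · exact tsum_nonneg fun p => mul_nonneg (by positivity) (hnn l p)
      · simp only [gBound]
        rw [tsum_mul_left, mul_pow, mul_div_right_comm]
        exact mul_le_mul_of_nonneg_left (Real.tsum_le_of_sum_le (hnn l) (hle l)) (by positivity)
  · rintro ⟨l, p⟩
    exact mul_nonneg (by positivity) (hnn l p)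

def toSig (μ : YoungDiagram) : Σ l : ℕ, (Fin l → ℕ) :=
  ⟨μ.colLen 0, fun i => μ.rowLen i - 1⟩

theorem toSig_inj : Function.Injective toSig := by
  intro μ ν h
  have h1 : μ.colLen 0 = ν.colLen 0 := congrArg Sigma.fst h
  have h2 : ∀ i < μ.colLen 0, μ.rowLen i - 1 = ν.rowLen i - 1 := by
    intro i hi
    have : ∀ p q : (Σ l : ℕ, (Fin l → ℕ)), p = q → ∀ i (h : i < p.1) (h' : i < q.1),
      p.2 ⟨i, h⟩ = q.2 ⟨i, h'⟩ := by
      rintro p _ rfl i _ _; rfl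
    exact this _ _ h i hi (show i < ν.colLen 0 from h1 ▸ hi)
  have h3 : ∀ i, μ.rowLen i = ν.rowLen i := by
    intro i
    rcases lt_or_ge i (μ.colLen 0) with hi | hi
    · have := rowLen_pos_of_lt μ i hi
      have := rowLen_pos_of_lt ν i (h1 ▸ hi)
      have := h2 i hi
      omega
    · rw [rowLen_zero_of_le μ i hi, rowLen_zero_of_le ν i (h1 ▸ hi)]
  apply YoungDiagram.ext
  ext ⟨a, b⟩
  rw [YoungDiagram.mem_cells, YoungDiagram.mem_cells, YoungDiagram.mem_iff_lt_rowLen,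
    YoungDiagram.mem_iff_lt_rowLen, h3]

theorem mixed_bound (α β : ℝ) (hα : 0 < α) (hβ : 0 < β) (N n : ℕ) (hN : 0 < N) (hNn : N ≤ n)
    (μ : YoungDiagram) (hμ : μ.colLen 0 ≤ n) :
    mixedWeight α β μ * (pFac n μ) ^ β ≤ gBound α β N (toSig μ) := by
  set l := μ.colLen 0 with hl
  have hN0 : (0 : ℝ) < N := by exact_mod_cast hN
  have hn0 : (0 : ℝ) < n := by exact_mod_cast (lt_of_lt_of_le hN hNn)
  have hNn' : (N : ℝ) ≤ n := by exact_mod_cast hNn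
  have hP : pFac n μ ≤ ∏ i ∈ Finset.range l,
      ∏ t ∈ Finset.range (μ.rowLen i - 1), (1 + ((t : ℝ) + 1) / N) := by
    have e : pFac n μ = ∏ i ∈ Finset.range l, ∏ t ∈ Finset.range (μ.rowLen i),
        ((n : ℝ) - i + t) / n := by
      rw [pFac]
      symm
      refine Finset.prod_subset (fun i hi => ?_) fun i _ hi => ?_
      · simp only [Finset.mem_range] at hi ⊢; omega
      · rw [rowLen_zero_of_le μ i (by simpa using hi)]; simp
    rw [e]
    have hpos : ∀ i < l, ∀ t : ℕ, 0 ≤ ((n : ℝ) - i + t) / n := by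
      intro i hi t
      have : (i : ℝ) ≤ n := by exact_mod_cast (hi.le.trans hμ)
      have : 0 ≤ (n : ℝ) - i := by linarith
      positivity
    refine Finset.prod_le_prod (fun i hi => Finset.prod_nonneg fun t _ =>
      hpos i (Finset.mem_range.1 hi) t) fun i hi => ?_
    have hi := Finset.mem_range.1 hi
    obtain ⟨m, hm⟩ : ∃ m, μ.rowLen i = m + 1 :=
      ⟨_, (Nat.succ_pred_eq_of_pos (rowLen_pos_of_lt μ i hi)).symm⟩
    have e2 : ∏ t ∈ Finset.range (μ.rowLen i - 1), (1 + ((t : ℝ) + 1) / N)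
        = ∏ t ∈ Finset.range (μ.rowLen i), (1 + (t : ℝ) / N) := by
      rw [hm, Finset.prod_range_succ']
      simp
    rw [e2]
    refine Finset.prod_le_prod (fun t _ => hpos i hi t) fun t _ => ?_
    have h1 : ((n : ℝ) - i + t) / n ≤ 1 + (t : ℝ) / n := by
      rw [div_le_iff₀ hn0, add_mul, div_mul_cancel₀ _ hn0.ne']
      have : (0 : ℝ) ≤ i := by positivity
      linarith
    have h2 : (t : ℝ) / n ≤ t / N := by gcongr
    linarith
  have hd := dim_bound μ
  rw [← hl] at hd
  have hcard : μ.card = l + ∑ i ∈ Finset.range l, (μ.rowLen i - 1) := by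
    rw [card_eq_sum μ l le_rfl]
    have : ∀ i ∈ Finset.range l, μ.rowLen i = 1 + (μ.rowLen i - 1) := by
      intro i hi
      have := rowLen_pos_of_lt μ i (Finset.mem_range.1 hi)
      omega
    rw [Finset.sum_congr rfl this, Finset.sum_add_distrib]
    simp
  have hP0 := pFac_nonneg n μ
  have hA : ∀ i, (0 : ℝ) ≤ ∏ t ∈ Finset.range (μ.rowLen i - 1), (1 + ((t : ℝ) + 1) / N) /
      ((t : ℝ) + 1) := fun i => Finset.prod_nonneg fun t _ => by positivity
  have hdp : (sytCard μ : ℝ) / (Nat.factorial μ.card : ℝ) * pFac n μ ≤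
      1 / (Nat.factorial l : ℝ) * ∏ i ∈ Finset.range l,
      ∏ t ∈ Finset.range (μ.rowLen i - 1), (1 + ((t : ℝ) + 1) / N) / ((t : ℝ) + 1) := by
    refine (mul_le_mul hd hP hP0 ?_).trans (le_of_eq ?_)
    · have : (0 : ℝ) ≤ ∏ i ∈ Finset.range l, (Nat.factorial (μ.rowLen i - 1) : ℝ) :=
        Finset.prod_nonneg fun i _ => by positivity
      positivity
    · have : ∀ i, ∏ t ∈ Finset.range (μ.rowLen i - 1), (1 + ((t : ℝ) + 1) / N) / ((t : ℝ) + 1)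
          = (∏ t ∈ Finset.range (μ.rowLen i - 1), (1 + ((t : ℝ) + 1) / N)) /
            (Nat.factorial (μ.rowLen i - 1) : ℝ) := by
        intro i
        rw [Finset.prod_div_distrib, ← Finset.prod_range_add_one_eq_factorial]
        push_cast; rfl
      simp only [this]
      rw [Finset.prod_div_distrib, div_mul_div_comm]
      rw [div_mul_eq_mul_div]
  have hmw : mixedWeight α β μ * (pFac n μ) ^ β =
      α ^ μ.card * ((sytCard μ : ℝ) / (Nat.factorial μ.card : ℝ) * pFac n μ) ^ β := by
    rw [mixedWeight, Real.mul_rpow (by positivity) hP0]; ring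
  rw [hmw]
  have hg : gBound α β N (toSig μ) = α ^ μ.card * (1 / (Nat.factorial l : ℝ) *
      ∏ i ∈ Finset.range l, ∏ t ∈ Finset.range (μ.rowLen i - 1),
        (1 + ((t : ℝ) + 1) / N) / ((t : ℝ) + 1)) ^ β := by
    rw [Real.mul_rpow (by positivity) (Finset.prod_nonneg fun i _ => hA i),
      ← Real.finsetProd_rpow _ _ (fun i _ => hA i), hcard, pow_add, ← Finset.prod_pow_eq_pow_sum,
      Real.div_rpow (by positivity) (by positivity), Real.one_rpow]
    have : ∏ i : Fin l, fRow α β N (μ.rowLen i - 1) = 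
      (∏ i ∈ Finset.range l, α ^ (μ.rowLen i - 1)) * ∏ i ∈ Finset.range l,
        (∏ t ∈ Finset.range (μ.rowLen i - 1), (1 + ((t : ℝ) + 1) / N) / ((t : ℝ) + 1)) ^ β := by
      rw [Fin.prod_univ_eq_prod_range (fun i => fRow α β N (μ.rowLen i - 1)),
        ← Finset.prod_mul_distrib]
      rfl
    have e3 : gBound α β N (toSig μ) = α ^ l / (Nat.factorial l : ℝ) ^ β *
      ∏ i : Fin l, fRow α β N (μ.rowLen i - 1) := rfl
    rw [e3, this]
    ring
  rw [hg]
  gcongr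

def rRatio (α β : ℝ) (n : ℕ) (μ : YoungDiagram) : ℝ :=
  if μ.colLen 0 ≤ n then mixedWeight α β μ * (pFac n μ) ^ β else 0

theorem gammaProb_eq (α β : ℝ) (hα : 0 < α) (n : ℕ) (h0 : 0 < n) (μ : YoungDiagram) :
    gammaProb n (α / (n : ℝ) ^ β) β μ = rRatio α β n μ / ∑' τ, rRatio α β n τ := by
  have hc := cFac_pos α β hα n h0
  rw [gammaProb, rRatio]
  split_ifs with h
  · have e : ∑' τ : {τ : YoungDiagram // τ.colLen 0 ≤ n}, gammaWeight n (α / (n : ℝ) ^ β) β τ.1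
        = cFac α β n * ∑' τ, rRatio α β n τ := by
      have e1 := tsum_subtype {τ : YoungDiagram | τ.colLen 0 ≤ n}
        (fun τ => gammaWeight n (α / (n : ℝ) ^ β) β τ)
      refine e1.trans ?_
      rw [← tsum_mul_left]
      refine tsum_congr fun τ => ?_
      by_cases hτ : τ.colLen 0 ≤ n
      · rw [Set.indicator_of_mem (by exact hτ), rRatio, if_pos hτ, gammaWeight_eq α β n τ hτ h0]
      · rw [Set.indicator_of_notMem (by exact hτ), rRatio, if_neg hτ, mul_zero]
    rw [e, gammaWeight_eq α β n μ h h0, mul_div_mul_left _ _ hc.ne']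
  · simp

theorem mixedWeight_nonneg (α β : ℝ) (hα : 0 < α) (μ : YoungDiagram) : 0 ≤ mixedWeight α β μ := by
  rw [mixedWeight]; positivity

theorem rRatio_tendsto (α β : ℝ) (hβ : 0 < β) (μ : YoungDiagram) :
    Tendsto (fun n => rRatio α β n μ) atTop (nhds (mixedWeight α β μ)) := by
  have h := ((pFac_tendsto μ).rpow_const (p := β) (Or.inr hβ.le)).const_mul (mixedWeight α β μ)
  rw [Real.one_rpow, mul_one] at h
  refine h.congr' ?_
  filter_upwards [eventually_ge_atTop (μ.colLen 0)] with n hn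
  rw [rRatio, if_pos hn]

theorem exists_N (α β : ℝ) (hβ : 0 < β) : ∃ N : ℕ, 0 < N ∧ α * (1 / (N : ℝ)) ^ β < 1 := by
  have h := ((tendsto_one_div_atTop_nhds_zero_nat (𝕜 := ℝ)).rpow_const (p := β)
    (Or.inr hβ.le)).const_mul α
  rw [Real.zero_rpow hβ.ne', mul_zero] at h
  exact ((eventually_gt_atTop 0).and (h.eventually_lt_const zero_lt_one)).exists

/-- As `n → ∞`, the measures `γ_{n, α/n^β, β}` converge in distribution to the mixed
measure `M^(α,β)`: pointwise convergence of the probabilities of partitions. -/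
theorem gamma_tendsto_mixed_plancherel (α β : ℝ) (hα : 0 < α) (hβ : 0 < β) :
    ∀ μ : YoungDiagram,
      Tendsto (fun n : ℕ => gammaProb n (α / (n : ℝ) ^ β) β μ) atTop
        (nhds (mixedProb α β μ)) := by
  intro μ
  obtain ⟨N, hN0, hN⟩ := exists_N α β hβ
  have hsum : Summable (fun τ => gBound α β N (toSig τ)) :=
    (gBound_summable α β hα hβ N hN).comp_injective toSig_inj
  have hG0 : ∀ τ, 0 ≤ gBound α β N (toSig τ) := fun τ =>
    mul_nonneg (by positivity) (Finset.prod_nonneg fun i _ => (fRow_pos α β hα N _).le)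
  have hR0 : ∀ n τ, 0 ≤ rRatio α β n τ := by
    intro n τ
    rw [rRatio]
    split_ifs
    · exact mul_nonneg (mixedWeight_nonneg α β hα τ) (Real.rpow_nonneg (pFac_nonneg n τ) _)
    · exact le_rfl
  have hbd : ∀ᶠ n in atTop, ∀ τ, ‖rRatio α β n τ‖ ≤ gBound α β N (toSig τ) := by
    filter_upwards [eventually_ge_atTop N] with n hn τ
    rw [Real.norm_of_nonneg (hR0 n τ), rRatio]
    split_ifs with h
    · exact mixed_bound α β hα hβ N n hN0 hn τ h
    · exact hG0 τ
  have hlim := tendsto_tsum_of_dominated_convergence hsum (rRatio_tendsto α β hβ) hbd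
  have hms : Summable (mixedWeight α β) := by
    refine Summable.of_nonneg_of_le (mixedWeight_nonneg α β hα) (fun τ => ?_) hsum
    refine le_of_tendsto (rRatio_tendsto α β hβ τ) ?_
    filter_upwards [hbd] with n hn
    exact (le_abs_self _).trans (hn τ)
  have hbot : 0 < mixedWeight α β ⊥ := by
    have : sytCard ⊥ = 1 := sytCard_zero _ rfl
    rw [mixedWeight, this]; positivity
  have hpos : 0 < ∑' τ, mixedWeight α β τ :=
    hms.tsum_pos (mixedWeight_nonneg α β hα) ⊥ hbot
  have := (rRatio_tendsto α β hβ μ).div hlim hpos.ne'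
  rw [mixedProb]
  refine this.congr' ?_
  filter_upwards [eventually_gt_atTop 0] with n hn
  exact (gammaProb_eq α β hα n hn μ).symm
end
end
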